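/- (Herman) Let f : ℝ² → ℝ² be a C^∞ diffeomorphism preserving Lebesgue measure, with f(0) = 0, such that the derivative Df(0) has complex eigenvalues e^{2πiρ} and e^{−2πiρ}, where the rotation number ρ ∈ ℝ is Diophantine: there exist c > 0 and τ > 0 such that |ρ − p/q| ≥ c/|q|^{2+τ} for all integers p and all nonzero integers q. Then the elliptic fixed point 0 is stable: every neighborhood U of 0 contains a compact, f-invariant neighborhood K of 0 (so K ⊆ U, f(K) = K, and 0 lies in the interior of K); in particular, for every neighborhood U of 0 there is a neighborhood V of 0 with f^n(V) ⊆ U for all n ∈ ℤ. -/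

import Mathlib

open MeasureTheory

namespace HermanKAM

open Complex Set Filter Topology

/-- The character `exp (2 π i z)`. -/
noncomputable def ec (z : ℂ) : ℂ := exp (2 * Real.pi * I * z)

lemma ec_add (z w : ℂ) : ec (z + w) = ec z * ec w := by
  simp [ec, mul_add, Complex.exp_add]

lemma ec_zero : ec 0 = 1 := by simp [ec]

lemma ec_int (k : ℤ) : ec k = 1 := by
  have := Complex.exp_int_mul_two_pi_mul_I k
  rw [ec, ← this]; ring_nf

lemma ec_neg (z : ℂ) : ec (-z) = (ec z)⁻¹ := by
  simp [ec, Complex.exp_neg]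

lemma ec_ne_zero (z : ℂ) : ec z ≠ 0 := Complex.exp_ne_zero _

lemma norm_ec (z : ℂ) : ‖ec z‖ = Real.exp (-2 * Real.pi * z.im) := by
  rw [ec, Complex.norm_exp]; congr 1; simp

lemma conj_ec (z : ℂ) : (starRingEnd ℂ) (ec z) = ec (-(starRingEnd ℂ) z) := by
  have h2 : (starRingEnd ℂ) 2 = 2 := Complex.conj_ofNat 2
  rw [ec, ← Complex.exp_conj, ec]; congr 1; simp [h2]

lemma differentiable_ec : Differentiable ℂ ec := by
  unfold ec; fun_prop

lemma continuous_ec : Continuous ec := differentiable_ec.continuous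

lemma hasDerivAt_ec (z : ℂ) : HasDerivAt ec (2 * Real.pi * I * ec z) z := by
  have := ((hasDerivAt_id z).const_mul (2 * Real.pi * I)).cexp
  unfold ec
  simpa [mul_comm] using this

/-- The open horizontal strip of half-width `δ`. -/
def strip (δ : ℝ) : Set ℂ := {z | |z.im| < δ}

lemma isOpen_strip (δ : ℝ) : IsOpen (strip δ) :=
  isOpen_lt (by fun_prop) continuous_const

lemma strip_mono {δ δ' : ℝ} (h : δ' ≤ δ) : strip δ' ⊆ strip δ :=
  fun _ hz => lt_of_lt_of_le hz h

lemma add_real_mem_strip {δ : ℝ} {z : ℂ} (hz : z ∈ strip δ) (t : ℝ) : z + t ∈ strip δ := by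
  simpa [strip] using hz

lemma real_mem_strip {δ : ℝ} (hδ : 0 < δ) (x : ℝ) : (x : ℂ) ∈ strip δ := by
  simpa [strip] using hδ

lemma closedBall_subset_strip {δ η : ℝ} {z : ℂ} (hz : z ∈ strip (δ - η)) :
    Metric.closedBall z η ⊆ strip δ := by
  intro w hw
  have h1 : |(w - z).im| ≤ η := (Complex.abs_im_le_norm _).trans (by simpa [dist_eq_norm] using hw)
  have h2 : |z.im| < δ - η := hz
  have h3 : |w.im| ≤ |(w - z).im| + |z.im| := by
    have := abs_add_le (w - z).im z.im
    simpa using this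
  show |w.im| < δ
  linarith

variable {P : Type*} [TopologicalSpace P]

/-- Families of holomorphic functions on the strip of half-width `δ`, bounded by `C`,
`1`-periodic, real on the real axis and pointwise continuous in the parameter. -/
structure Ana (δ C : ℝ) (u : P → ℂ → ℂ) : Prop where
  diff : ∀ p, DifferentiableOn ℂ (u p) (strip δ)
  cont : ∀ z ∈ strip δ, Continuous fun p => u p z
  per : ∀ p z, u p (z + 1) = u p z
  bound : ∀ p, ∀ z ∈ strip δ, ‖u p z‖ ≤ C
  real : ∀ p, ∀ x : ℝ, (u p x).im = 0

namespace Ana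

variable {δ δ' C C' : ℝ} {u v : P → ℂ → ℂ}

lemma mono (h : Ana δ C u) (hδ : δ' ≤ δ) (hC : C ≤ C') : Ana δ' C' u where
  diff p := (h.diff p).mono (strip_mono hδ)
  cont z hz := h.cont z (strip_mono hδ hz)
  per := h.per
  bound p z hz := (h.bound p z (strip_mono hδ hz)).trans hC
  real := h.real

lemma of_bound (h : Ana δ C u) (hC : ∀ p, ∀ z ∈ strip δ, ‖u p z‖ ≤ C') : Ana δ C' u where
  diff := h.diff
  cont := h.cont
  per := h.per
  bound := hC
  real := h.real

lemma add (h : Ana δ C u) (h' : Ana δ C' v) : Ana δ (C + C') (fun p z => u p z + v p z) where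
  diff p := (h.diff p).add (h'.diff p)
  cont z hz := (h.cont z hz).add (h'.cont z hz)
  per p z := by simp only [h.per, h'.per]
  bound p z hz := (norm_add_le _ _).trans (add_le_add (h.bound p z hz) (h'.bound p z hz))
  real p x := by simp [h.real, h'.real]

lemma neg (h : Ana δ C u) : Ana δ C (fun p z => - u p z) where
  diff p := (h.diff p).neg
  cont z hz := (h.cont z hz).neg
  per p z := by simp only [h.per]
  bound p z hz := by simpa using h.bound p z hz
  real p x := by simp [h.real]

lemma sub (h : Ana δ C u) (h' : Ana δ C' v) : Ana δ (C + C') (fun p z => u p z - v p z) := by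
  simpa [sub_eq_add_neg] using h.add h'.neg

lemma mul (h : Ana δ C u) (h' : Ana δ C' v) : Ana δ (C * C') (fun p z => u p z * v p z) where
  diff p := (h.diff p).mul (h'.diff p)
  cont z hz := (h.cont z hz).mul (h'.cont z hz)
  per p z := by simp only [h.per, h'.per]
  bound p z hz := by
    rw [norm_mul]
    exact mul_le_mul (h.bound p z hz) (h'.bound p z hz) (norm_nonneg _)
      ((norm_nonneg _).trans (h.bound p z hz))
  real p x := by simp [h.real, h'.real]

lemma const {c : P → ℂ} (hc : Continuous c) (hb : ∀ p, ‖c p‖ ≤ C) (hr : ∀ p, (c p).im = 0) :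
    Ana δ C (fun p _ => c p) where
  diff _ := differentiableOn_const _
  cont _ _ := hc
  per _ _ := rfl
  bound p _ _ := hb p
  real p _ := hr p

lemma one : Ana δ 1 (fun (_ : P) _ => 1) :=
  const continuous_const (by simp) (by simp)

/-- Inverse of a family bounded away from zero. -/
lemma inv (h : Ana δ C u) {m : ℝ} (hm : 0 < m) (hlow : ∀ p, ∀ z ∈ strip δ, m ≤ ‖u p z‖) :
    Ana δ m⁻¹ (fun p z => (u p z)⁻¹) where
  diff p := (h.diff p).inv fun z hz h0 => by
    have := hlow p z hz
    rw [h0, norm_zero] at this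
    linarith
  cont z hz := (h.cont z hz).inv₀ fun p h0 => by
    have := hlow p z hz
    rw [h0, norm_zero] at this
    linarith
  per p z := by simp only [h.per]
  bound p z hz := by
    rw [norm_inv]
    exact inv_anti₀ hm (hlow p z hz)
  real p x := by simp [Complex.inv_im, h.real]

lemma pos_or (h : Ana δ C u) (hδ : 0 < δ) (p : P) : 0 ≤ C :=
  (norm_nonneg _).trans (h.bound p 0 (by simpa using real_mem_strip hδ 0))

lemma diffContOnCl (h : Ana δ C u) {η : ℝ} (p : P) {z : ℂ} (hz : z ∈ strip (δ - η)) :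
    DiffContOnCl ℂ (u p) (Metric.ball z η) :=
  ((h.diff p).mono (closedBall_subset_strip hz)).diffContOnCl_ball subset_rfl

lemma norm_deriv_le (h : Ana δ C u) {η : ℝ} (hη : 0 < η) (p : P) {z : ℂ}
    (hz : z ∈ strip (δ - η)) : ‖deriv (u p) z‖ ≤ C / η :=
  Complex.norm_deriv_le_of_forall_mem_sphere_norm_le hη (h.diffContOnCl p hz)
    fun w hw => h.bound p w (closedBall_subset_strip hz (Metric.sphere_subset_closedBall hw))

lemma hasDerivAt (h : Ana δ C u) (p : P) {z : ℂ} (hz : z ∈ strip δ) :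
    HasDerivAt (u p) (deriv (u p) z) z :=
  ((h.diff p).differentiableAt ((isOpen_strip δ).mem_nhds hz)).hasDerivAt

lemma continuous_deriv [FirstCountableTopology P] (h : Ana δ C u) {z : ℂ} (hz : z ∈ strip δ) :
    Continuous fun p => deriv (u p) z := by
  obtain ⟨η, hη, hzη⟩ : ∃ η, 0 < η ∧ z ∈ strip (δ - η) := by
    refine ⟨(δ - |z.im|) / 2, ?_, ?_⟩
    · have : |z.im| < δ := hz
      linarith
    · have : |z.im| < δ := hz
      show |z.im| < _
      linarith
  have hsub := closedBall_subset_strip hzη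
  have hmem : ∀ θ, circleMap z η θ ∈ strip δ := fun θ =>
    hsub (Metric.sphere_subset_closedBall (circleMap_mem_sphere z hη.le θ))
  have key : ∀ p, _root_.deriv (u p) z =
      (2 * Real.pi * I : ℂ)⁻¹ * ∮ w in C(z, η), (1 / (w - z) ^ 2) • u p w := fun p => by
    rw [(h.diffContOnCl p hzη).deriv_eq_smul_circleIntegral hη, smul_eq_mul,
      inv_mul_cancel_left₀ Complex.two_pi_I_ne_zero]
  simp_rw [key, circleIntegral]
  refine continuous_const.mul ?_
  refine intervalIntegral.continuous_of_dominated_interval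
    (bound := fun _ => η * ((η ^ 2)⁻¹ * C)) ?_ ?_ ?_ ?_
  · intro p
    refine Continuous.aestronglyMeasurable ?_
    have h1 : Continuous fun θ => u p (circleMap z η θ) :=
      (h.diff p).continuousOn.comp_continuous (continuous_circleMap z η) hmem
    have h2 : Continuous fun θ => 1 / (circleMap z η θ - z) ^ 2 := by
      refine continuous_const.div (by fun_prop) fun θ => ?_
      simp [circleMap, hη.ne']
    simp only [deriv_circleMap]
    exact ((continuous_circleMap 0 η).mul continuous_const).smul (h2.smul h1)
  · intro p
    refine Eventually.of_forall fun θ _ => ?_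
    simp only [deriv_circleMap, norm_smul, norm_mul, norm_circleMap_zero, Complex.norm_I, mul_one,
      abs_of_pos hη, circleMap_sub_center, norm_pow, norm_inv, one_div]
    gcongr
    exact h.bound p _ (hmem θ)
  · exact intervalIntegrable_const
  · refine Eventually.of_forall fun θ _ => ?_
    have := h.cont _ (hmem θ)
    simp only [smul_eq_mul]
    fun_prop

lemma deriv [FirstCountableTopology P] (h : Ana δ C u) {η : ℝ} (hη : 0 < η) :
    Ana (δ - η) (C / η) (fun p z => deriv (u p) z) where
  diff p := ((h.diff p).deriv (isOpen_strip δ)).mono (strip_mono (by linarith))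
  cont z hz := h.continuous_deriv (strip_mono (by linarith) hz)
  per p z := by
    have : (fun z => u p (z + 1)) = u p := funext fun z => h.per p z
    rw [← deriv_comp_add_const, this]
  bound p z hz := h.norm_deriv_le hη p hz
  real p x := by
    by_cases hd : DifferentiableAt ℂ (u p) x
    · have h1 : HasDerivAt (fun y : ℝ => u p y) (_root_.deriv (u p) x) x :=
        hd.hasDerivAt.comp_ofReal
      have h2 : HasDerivAt (fun y : ℝ => (u p y).im) (_root_.deriv (u p) x).im x :=
        Complex.imCLM.hasFDerivAt.comp_hasDerivAt x h1
      have h3 : (fun y : ℝ => (u p y).im) = fun _ => 0 := funext fun y => h.real p y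
      rw [h3] at h2
      exact h2.unique (hasDerivAt_const x 0)
    · rw [deriv_zero_of_not_differentiableAt hd]; simp

lemma lipschitz (h : Ana δ C u) {L : ℝ} (p : P)
    (hL : ∀ z ∈ strip δ, ‖_root_.deriv (u p) z‖ ≤ L) {z w : ℂ} (hz : z ∈ strip δ)
    (hw : w ∈ strip δ) : ‖u p w - u p z‖ ≤ L * ‖w - z‖ := by
  have hconv : Convex ℝ (strip δ) := by
    have : strip δ = Complex.imCLM ⁻¹' (Metric.ball 0 δ) := by
      ext z; simp [strip]
    rw [this]
    exact (convex_ball _ _).is_linear_preimage (Complex.imCLM.isBoundedLinearMap.toIsLinearMap)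
  exact hconv.norm_image_sub_le_of_norm_deriv_le
    (fun z hz => (h.hasDerivAt p hz).differentiableAt) hL hz hw

end Ana

/-- Translation of the argument by a parameter-dependent real number. -/
def sh (β : P → ℝ) (u : P → ℂ → ℂ) : P → ℂ → ℂ := fun p z => u p (z + β p)

@[simp] lemma sh_apply {P : Type*} (β : P → ℝ) (u : P → ℂ → ℂ) (p : P) (z : ℂ) :
    sh β u p z = u p (z + β p) := rfl

lemma Ana.sh {δ C : ℝ} {u : P → ℂ → ℂ} (h : Ana δ C u) {β : P → ℝ} (hβ : Continuous β) :
    Ana δ C (sh β u) where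
  diff p := (h.diff p).comp (by fun_prop) fun z hz => add_real_mem_strip hz _
  cont z hz := by
    rw [continuous_iff_continuousAt]
    intro p₀
    obtain ⟨η, hη, hzη⟩ : ∃ η, 0 < η ∧ z ∈ strip (δ - η) := by
      have : |z.im| < δ := hz
      refine ⟨(δ - |z.im|) / 2, by linarith, ?_⟩
      show |z.im| < _
      linarith
    have hlip : ∀ p, ‖u p (z + β p) - u p (z + β p₀)‖ ≤ C / η * ‖(β p : ℂ) - β p₀‖ := by
      intro p
      have := (h.mono (δ' := δ - η) (by linarith) le_rfl).lipschitz p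
        (fun w hw => h.norm_deriv_le hη p hw) (add_real_mem_strip hzη (β p₀))
        (add_real_mem_strip hzη (β p))
      simpa using this
    have h1 : Tendsto (fun p => u p (z + β p) - u p (z + β p₀)) (𝓝 p₀) (𝓝 0) := by
      refine squeeze_zero_norm hlip ?_
      have : Tendsto (fun p => C / η * ‖(β p : ℂ) - β p₀‖) (𝓝 p₀)
          (𝓝 (C / η * ‖(β p₀ : ℂ) - β p₀‖)) := by
        apply Continuous.tendsto; fun_prop
      simpa using this
    have h2 : Tendsto (fun p => u p (z + β p₀)) (𝓝 p₀) (𝓝 (u p₀ (z + β p₀))) :=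
      (h.cont _ (add_real_mem_strip hz _)).continuousAt
    simpa [ContinuousAt] using h1.add h2
  per p z := by simp only [sh_apply]; rw [add_right_comm, h.per]
  bound p z hz := h.bound p _ (add_real_mem_strip hz _)
  real p x := by
    have := h.real p (x + β p)
    push_cast at this
    exact this

end HermanKAM

namespace HermanKAM

open Complex Set Filter Topology

section Fourier

/-- Fourier inversion for continuous `1`-periodic functions with summable coefficients. -/
lemma hasSum_fourier_real {h : ℝ → ℂ} (hc : Continuous h) (hp : Function.Periodic h 1)
    (hs : Summable fun k : ℤ => ∫ x in (0 : ℝ)..1, h x * ec (-(k * x))) (x : ℝ) :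
    HasSum (fun k : ℤ => (∫ x in (0 : ℝ)..1, h x * ec (-(k * x))) * ec (k * x)) (h x) := by
  have : Fact ((0 : ℝ) < 1) := ⟨one_pos⟩
  let F : C(AddCircle (1 : ℝ), ℂ) := ⟨hp.lift, continuous_coinduced_dom.mpr hc⟩
  have hF : ∀ t : ℝ, F (t : AddCircle (1 : ℝ)) = h t := fun t => hp.lift_coe t
  have hec : ∀ (k : ℤ) (t : ℝ), fourier k (t : AddCircle (1 : ℝ)) = ec (k * t) := by
    intro k t
    rw [fourier_coe_apply, ec]
    congr 1
    push_cast
    ring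
  have hcoef : ∀ k : ℤ, fourierCoeff F k = ∫ x in (0 : ℝ)..1, h x * ec (-(k * x)) := by
    intro k
    rw [fourierCoeff_eq_intervalIntegral F k 0]
    simp only [zero_add, div_one, one_smul, hF, hec, smul_eq_mul]
    refine intervalIntegral.integral_congr fun t _ => ?_
    rw [mul_comm]
    push_cast
    rw [neg_mul]
  have := has_pointwise_sum_fourier_series_of_summable (f := F)
    (by rw [show fourierCoeff F = _ from funext hcoef]; exact hs) (x : AddCircle (1 : ℝ))
  simpa only [hcoef, hec, hF, smul_eq_mul] using this

end Fourier

variable {P : Type*} [TopologicalSpace P]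

/-- Fourier coefficients of a family of periodic functions. -/
noncomputable def coef (u : P → ℂ → ℂ) (p : P) (k : ℤ) : ℂ :=
  ∫ x in (0 : ℝ)..1, u p x * ec (-(k * x))

/-- Mean value of a family of periodic functions over a period. -/
noncomputable def mean (u : P → ℂ → ℂ) (p : P) : ℂ := ∫ x in (0 : ℝ)..1, u p x

lemma coef_zero_eq_mean {P : Type*} (u : P → ℂ → ℂ) (p : P) : coef u p 0 = mean u p := by
  simp [coef, mean, ec_zero]

namespace Ana

variable {δ δ' C C' : ℝ} {u v : P → ℂ → ℂ}

lemma continuous_line (h : Ana δ C u) (p : P) {y : ℝ} (hy : |y| < δ) :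
    Continuous fun x : ℝ => u p (x + y * I) :=
  (h.diff p).continuousOn.comp_continuous (by fun_prop) fun x => by simpa [strip] using hy

lemma continuous_real (h : Ana δ C u) (hδ : 0 < δ) (p : P) : Continuous fun x : ℝ => u p x := by
  simpa using h.continuous_line p (y := 0) (by simpa using hδ)

lemma coef_shift (h : Ana δ C u) (p : P) (k : ℤ) {y : ℝ} (hy : |y| < δ) :
    ∫ x in (0 : ℝ)..1, u p (x + y * I) * ec (-(k * (x + y * I))) = coef u p k := by
  have hδ : 0 < δ := (abs_nonneg y).trans_lt hy
  have hd : DifferentiableOn ℂ (fun z => u p z * ec (-(k * z))) (strip δ) :=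
    (h.diff p).mul (differentiable_ec.comp (by fun_prop)).differentiableOn
  have := Complex.integral_boundary_rect_eq_zero_of_differentiableOn
    (fun z => u p z * ec (-(k * z))) 0 (1 + y * I) (hd.mono ?_)
  · have hside : ∀ t : ℝ, u p (1 + t * I) * ec (-(k * (1 + t * I)))
        = u p (t * I) * ec (-(k * (t * I))) := by
      intro t
      rw [add_comm (1 : ℂ), h.per, mul_add, neg_add, ec_add]
      have : ec (-((k : ℂ) * 1)) = 1 := by
        have := ec_int (-k)
        push_cast at this
        simpa using this
      rw [this, mul_one]
    simp only [zero_re, zero_im, add_re, one_re, mul_re, ofReal_re, I_re, mul_zero, ofReal_im, I_im,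
      sub_self, add_zero, add_im, one_im, mul_im, mul_one, zero_add, ofReal_zero, zero_mul,
      ofReal_one, hside] at this
    rw [coef]
    rw [add_sub_cancel_right, sub_eq_zero] at this
    exact this.symm
  · intro z hz
    have : z.im ∈ Set.uIcc (0 : ℝ) y := by simpa using hz.2
    have h2 := abs_sub_left_of_mem_uIcc this
    simp only [sub_zero] at h2
    exact lt_of_le_of_lt h2 hy

lemma norm_coef_le (h : Ana δ C u) (hδ : 0 < δ) (p : P) (k : ℤ) :
    ‖coef u p k‖ ≤ C * Real.exp (-(2 * Real.pi * |k| * δ)) := by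
  have key : ∀ y : ℝ, |y| < δ → ‖coef u p k‖ ≤ C * Real.exp (2 * Real.pi * k * y) := by
    intro y hy
    rw [← h.coef_shift p k hy]
    have := intervalIntegral.norm_integral_le_of_norm_le_const (a := (0 : ℝ)) (b := 1)
      (f := fun x : ℝ => u p (x + y * I) * ec (-(k * (x + y * I))))
      (C := C * Real.exp (2 * Real.pi * k * y)) ?_
    · simpa using this
    · intro x _
      rw [norm_mul, norm_ec]
      refine mul_le_mul (h.bound p _ (by simpa [strip] using hy)) (le_of_eq ?_)
        (Real.exp_pos _).le (h.pos_or hδ p)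
      congr 1
      simp
      ring
  have h1 : ∀ y ∈ Ioo 0 δ, ‖coef u p k‖ ≤ C * Real.exp (-(2 * Real.pi * |k| * y)) := by
    intro y hy
    rcases le_total 0 k with hk | hk
    · have := key (-y) (by rw [abs_neg, abs_of_pos hy.1]; exact hy.2)
      rw [abs_of_nonneg hk]
      convert this using 3
      ring
    · have := key y (by rw [abs_of_pos hy.1]; exact hy.2)
      rw [abs_of_nonpos hk]
      convert this using 3
      push_cast
      ring
  have ht : Tendsto (fun y : ℝ => C * Real.exp (-(2 * Real.pi * |k| * y))) (𝓝[<] δ)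
      (𝓝 (C * Real.exp (-(2 * Real.pi * |k| * δ)))) := by
    apply Continuous.tendsto' _ _ _ rfl |>.mono_left nhdsWithin_le_nhds
    fun_prop
  refine ge_of_tendsto ht ?_
  filter_upwards [Ioo_mem_nhdsLT hδ] with y hy using h1 y hy

lemma continuous_coef [FirstCountableTopology P] (h : Ana δ C u) (hδ : 0 < δ) (k : ℤ) :
    Continuous fun p => coef u p k := by
  unfold coef
  refine intervalIntegral.continuous_of_dominated_interval (bound := fun _ => C) ?_ ?_ ?_ ?_
  · intro p
    exact ((h.continuous_real hδ p).mul
      (continuous_ec.comp (by fun_prop))).aestronglyMeasurable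
  · intro p
    refine Eventually.of_forall fun x _ => ?_
    rw [norm_mul, norm_ec]
    simpa using h.bound p x (real_mem_strip hδ x)
  · exact intervalIntegrable_const
  · refine Eventually.of_forall fun x _ => ?_
    exact (h.cont _ (real_mem_strip hδ x)).mul continuous_const

lemma coef_neg (h : Ana δ C u) (p : P) (k : ℤ) :
    coef u p (-k) = (starRingEnd ℂ) (coef u p k) := by
  unfold coef
  rw [intervalIntegral.integral_of_le zero_le_one, intervalIntegral.integral_of_le zero_le_one,
    ← integral_conj]
  congr 1
  ext x
  simp only [map_mul, conj_ec, Complex.conj_eq_iff_im.mpr (h.real p x)]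
  simp

lemma norm_mean_le (h : Ana δ C u) (hδ : 0 < δ) (p : P) : ‖mean u p‖ ≤ C := by
  have := h.norm_coef_le hδ p 0
  simpa [coef_zero_eq_mean] using this

lemma mean_im (h : Ana δ C u) (p : P) : (mean u p).im = 0 := by
  have := h.coef_neg p 0
  rw [neg_zero, coef_zero_eq_mean] at this
  exact Complex.conj_eq_iff_im.mp this.symm

lemma continuous_mean [FirstCountableTopology P] (h : Ana δ C u) (hδ : 0 < δ) :
    Continuous (mean u) := by
  simpa only [coef_zero_eq_mean] using h.continuous_coef hδ 0

lemma intervalIntegrable (h : Ana δ C u) (hδ : 0 < δ) (p : P) (a b : ℝ) :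
    IntervalIntegrable (fun x : ℝ => u p x) volume a b :=
  (h.continuous_real hδ p).intervalIntegrable a b

lemma mean_add (h : Ana δ C u) (h' : Ana δ C' v) (hδ : 0 < δ) (p : P) :
    mean (fun p z => u p z + v p z) p = mean u p + mean v p :=
  intervalIntegral.integral_add (h.intervalIntegrable hδ p 0 1) (h'.intervalIntegrable hδ p 0 1)

lemma mean_sub (h : Ana δ C u) (h' : Ana δ C' v) (hδ : 0 < δ) (p : P) :
    mean (fun p z => u p z - v p z) p = mean u p - mean v p :=
  intervalIntegral.integral_sub (h.intervalIntegrable hδ p 0 1) (h'.intervalIntegrable hδ p 0 1)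

lemma mean_sh (h : Ana δ C u) (β : P → ℝ) (p : P) : mean (HermanKAM.sh β u) p = mean u p := by
  have hper : Function.Periodic (fun x : ℝ => u p x) 1 := fun x => by
    simp only
    push_cast
    exact h.per p x
  have := hper.intervalIntegral_add_eq (β p) 0
  rw [mean, mean]
  simp only [sh_apply]
  have h2 := intervalIntegral.integral_comp_add_right (a := 0) (b := 1) (fun x : ℝ => u p x) (β p)
  simp only [ofReal_add] at h2
  rw [h2, zero_add, add_comm 1]
  simpa using this

lemma mean_deriv (h : Ana δ C u) (hδ : 0 < δ) (p : P) :
    mean (fun p z => _root_.deriv (u p) z) p = 0 := by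
  rw [mean, intervalIntegral.integral_eq_sub_of_hasDerivAt (f := fun x : ℝ => u p x)]
  · have := h.per p 0
    simp only [zero_add] at this
    simp [this]
  · intro x _
    exact (h.hasDerivAt p (real_mem_strip hδ x)).comp_ofReal
  · refine Continuous.intervalIntegrable ?_ _ _
    exact ((h.diff p).deriv (isOpen_strip δ)).continuousOn.comp_continuous (by fun_prop)
      fun x => real_mem_strip hδ x

end Ana

lemma mean_const_mul {P : Type*} (c : P → ℂ) (u : P → ℂ → ℂ) (p : P) :
    mean (fun p z => c p * u p z) p = c p * mean u p :=
  intervalIntegral.integral_const_mul _ _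

lemma norm_ec_int_mul (k : ℤ) (z : ℂ) : ‖ec (k * z)‖ ≤ Real.exp (2 * Real.pi * |k| * |z.im|) := by
  rw [norm_ec, Real.exp_le_exp]
  have : -((k : ℝ) * z.im) ≤ |(k : ℝ)| * |z.im| := by
    rw [← abs_mul]; exact neg_le_abs _
  have h2 : ((k : ℂ) * z).im = k * z.im := by simp
  rw [h2]
  push_cast
  nlinarith [Real.pi_pos]

lemma summable_exp_neg_abs {c : ℝ} (hc : 0 < c) :
    Summable fun k : ℤ => Real.exp (-(c * |k|)) := by
  have h1 : Summable fun n : ℕ => Real.exp (-(c * n)) := by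
    have := Real.summable_exp_nat_mul_iff.mpr (neg_lt_zero.mpr hc)
    refine this.congr fun n => ?_
    ring_nf
  refine Summable.of_nat_of_neg ?_ ?_
  · refine h1.congr fun n => by simp
  · refine h1.congr fun n => by simp

/-- Fourier inversion on the strip. -/
lemma Ana.hasSum_coef {δ C : ℝ} {u : P → ℂ → ℂ} (h : Ana δ C u) (p : P) {z : ℂ}
    (hz : z ∈ strip δ) : HasSum (fun k : ℤ => coef u p k * ec (k * z)) (u p z) := by
  have hδ : 0 < δ := (abs_nonneg _).trans_lt hz
  have hfc : ∀ k : ℤ, ∫ x in (0 : ℝ)..1, u p (x + z.im * I) * ec (-(k * x))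
      = coef u p k * ec (k * (z.im * I)) := by
    intro k
    rw [← h.coef_shift p k hz, ← intervalIntegral.integral_mul_const]
    refine intervalIntegral.integral_congr fun x _ => ?_
    rw [mul_assoc, ← ec_add]
    ring_nf
  have hper : Function.Periodic (fun x : ℝ => u p (x + z.im * I)) 1 := fun x => by
    simp only
    rw [← h.per p (x + z.im * I)]
    push_cast
    ring_nf
  have hsum : Summable fun k : ℤ => coef u p k * ec (k * (z.im * I)) := by
    refine Summable.of_norm_bounded (g := fun k : ℤ =>
      C * Real.exp (-((2 * Real.pi * (δ - |z.im|)) * |k|))) ?_ ?_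
    · refine (summable_exp_neg_abs ?_).mul_left C
      have : |z.im| < δ := hz
      have := sub_pos.mpr this
      positivity
    · intro k
      rw [norm_mul]
      have h1 := h.norm_coef_le hδ p k
      have h2 := norm_ec_int_mul k (z.im * I)
      have h3 : ((z.im : ℂ) * I).im = z.im := by simp
      rw [h3] at h2
      refine (mul_le_mul h1 h2 (norm_nonneg _) ((norm_nonneg _).trans h1)).trans (le_of_eq ?_)
      rw [mul_assoc, ← Real.exp_add]
      congr 2
      ring
  have := hasSum_fourier_real (h.continuous_line p hz) hper
    (by simpa only [hfc] using hsum) z.re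
  simp only [hfc, Complex.re_add_im, mul_assoc, ← ec_add] at this
  convert this using 4
  rw [← mul_add, add_comm, Complex.re_add_im]

/-- Fourier synthesis on a strip. -/
lemma ana_tsum {δ C : ℝ} {d : P → ℤ → ℂ} {M : ℤ → ℝ} (hM : HasSum M C)
    (hd : ∀ p k, ‖d p k‖ ≤ M k * Real.exp (-(2 * Real.pi * |k| * δ)))
    (hcont : ∀ k, Continuous fun p => d p k)
    (hreal : ∀ p k, d p (-k) = (starRingEnd ℂ) (d p k)) :
    Ana δ C (fun p z => ∑' k : ℤ, d p k * ec (k * z)) ∧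
    ∀ p, ∀ z ∈ strip δ, Summable fun k : ℤ => d p k * ec (k * z) := by
  have hb : ∀ p, ∀ z ∈ strip δ, ∀ k : ℤ, ‖d p k * ec (k * z)‖ ≤ M k := by
    intro p z hz k
    have hMk : 0 ≤ M k := by
      have := (norm_nonneg _).trans (hd p k)
      exact nonneg_of_mul_nonneg_left this (Real.exp_pos _)
    have h2 : ‖ec (k * z)‖ ≤ Real.exp (2 * Real.pi * |k| * δ) := by
      refine (norm_ec_int_mul k z).trans (Real.exp_le_exp.mpr ?_)
      have : |z.im| ≤ δ := le_of_lt hz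
      gcongr
    rw [norm_mul]
    refine (mul_le_mul (hd p k) h2 (norm_nonneg _) ((norm_nonneg _).trans (hd p k))).trans
      (le_of_eq ?_)
    rw [mul_assoc, ← Real.exp_add]
    simp
  refine ⟨⟨?_, ?_, ?_, ?_, ?_⟩, ?_⟩
  · intro p
    refine differentiableOn_tsum_of_summable_norm hM.summable (fun k => ?_) (isOpen_strip δ)
      fun k z hz => hb p z hz k
    exact ((differentiable_ec.comp (by fun_prop)).const_mul _).differentiableOn
  · intro z hz
    exact continuous_tsum (fun k => (hcont k).mul continuous_const) hM.summable
      fun k p => hb p z hz k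
  · intro p z
    congr 1
    ext k
    rw [mul_add, mul_one, ec_add, ec_int, mul_one]
  · intro p z hz
    exact tsum_of_norm_bounded hM (hb p z hz)
  · intro p x
    rw [← Complex.conj_eq_iff_im, Complex.conj_tsum, ← (Equiv.neg ℤ).tsum_eq]
    congr 1
    ext k
    simp [conj_ec, hreal]
  · intro p z hz
    exact Summable.of_norm_bounded hM.summable (hb p z hz)

end HermanKAM

namespace HermanKAM

open Complex Set Filter Topology

variable {P : Type*} [TopologicalSpace P]

/-- `β` is Diophantine with constant `γ` and exponent `s`. -/
def Dio (γ : ℝ) (s : ℕ) (β : ℝ) : Prop :=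
  ∀ k l : ℤ, k ≠ 0 → γ / |(k : ℝ)| ^ s ≤ |k * β - l|

/-- The value of the series of inverse squares of integers. -/
noncomputable def zetaTwo : ℝ := ∑' k : ℤ, 1 / (k : ℝ) ^ 2

lemma hasSum_zetaTwo : HasSum (fun k : ℤ => 1 / (k : ℝ) ^ 2) zetaTwo :=
  (Real.summable_one_div_int_pow.mpr one_lt_two).hasSum

lemma zetaTwo_nonneg : 0 ≤ zetaTwo := tsum_nonneg fun k => by positivity

lemma four_mul_le_norm_ec_sub_one {x d : ℝ} (h : ∀ l : ℤ, d ≤ |x - l|) :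
    4 * d ≤ ‖ec x - 1‖ := by
  have h1 : ec x = Complex.exp (I * ↑(2 * Real.pi * (x - round x))) := by
    have h2 : ec x = ec (x - round x) := by
      rw [sub_eq_add_neg, ec_add, ec_neg, ec_int]; simp
    rw [h2, ec]; congr 1; push_cast; ring
  rw [h1, Complex.norm_exp_I_mul_ofReal_sub_one]
  have h3 : |x - round x| ≤ 1 / 2 := abs_sub_round x
  have h4 := Real.mul_abs_le_abs_sin (x := Real.pi * (x - round x)) (by
    rw [abs_mul, abs_of_pos Real.pi_pos]
    nlinarith [Real.pi_pos])
  rw [abs_mul, abs_of_pos Real.pi_pos] at h4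
  have h5 : 2 / Real.pi * (Real.pi * |x - round x|) = 2 * |x - round x| := by
    field_simp
  rw [h5] at h4
  have h6 : 2 * Real.pi * (x - round x) / 2 = Real.pi * (x - round x) := by ring
  rw [h6, norm_mul, Real.norm_eq_abs, Real.norm_eq_abs, abs_two]
  have := h (round x)
  linarith

/-- Solution of the cohomological equation `L w = u - mean u`. -/
noncomputable def Linv (β : P → ℝ) (u : P → ℂ → ℂ) (p : P) (z : ℂ) : ℂ :=
  ∑' k : ℤ, coef u p k / (ec (k * β p) - 1) * ec (k * z)

/-- The constant in the small divisor estimate. -/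
noncomputable def CL (γ : ℝ) (s : ℕ) : ℝ := (s + 2).factorial / (4 * γ) * zetaTwo

lemma CL_nonneg {γ : ℝ} (hγ : 0 < γ) (s : ℕ) : 0 ≤ CL γ s := by
  have := zetaTwo_nonneg
  unfold CL
  positivity

lemma pow_mul_exp_neg_le (s : ℕ) {η : ℝ} (hη : 0 < η) {k : ℤ} (hk : k ≠ 0) :
    |(k : ℝ)| ^ s * Real.exp (-(2 * Real.pi * |(k : ℝ)| * η)) ≤
      (s + 2).factorial / η ^ (s + 2) * (1 / (k : ℝ) ^ 2) := by
  have hk' : 0 < |(k : ℝ)| := by simpa using hk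
  have h1 := Real.pow_div_factorial_le_exp (|(k : ℝ)| * η) (by positivity) (s + 2)
  have h2 : Real.exp (|(k : ℝ)| * η) ≤ Real.exp (2 * Real.pi * |(k : ℝ)| * η) := by
    apply Real.exp_le_exp.mpr
    have := Real.pi_gt_three
    nlinarith [mul_pos hk' hη]
  have h3 := h1.trans h2
  rw [Real.exp_neg, ← sq_abs (k : ℝ), ← div_eq_mul_inv, div_le_iff₀ (Real.exp_pos _)]
  calc |(k : ℝ)| ^ s = (s + 2).factorial / η ^ (s + 2) * (1 / |(k : ℝ)| ^ 2) *
        ((|(k : ℝ)| * η) ^ (s + 2) / (s + 2).factorial) := by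
        have : ((s + 2).factorial : ℝ) ≠ 0 := by positivity
        field_simp
        ring
    _ ≤ _ := by gcongr

lemma Ana.linv [FirstCountableTopology P] {δ C η γ : ℝ} {s : ℕ} {u : P → ℂ → ℂ} {β : P → ℝ}
    (h : Ana δ C u) (hδ : 0 < δ) (hη : 0 < η) (hγ : 0 < γ) (hβ : Continuous β)
    (hD : ∀ p, Dio γ s (β p)) :
    Ana (δ - η) (CL γ s * C / η ^ (s + 2)) (Linv β u) ∧
    ∀ p, ∀ z ∈ strip (δ - η), Linv β u p (z + β p) - Linv β u p z = u p z - mean u p := by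
  have hlow : ∀ p, ∀ k : ℤ, k ≠ 0 → 4 * (γ / |(k : ℝ)| ^ s) ≤ ‖ec (k * β p) - 1‖ := by
    intro p k hk
    have := four_mul_le_norm_ec_sub_one (x := k * β p) (fun l => hD p k l hk)
    simpa using this
  have hne : ∀ p, ∀ k : ℤ, k ≠ 0 → ec (k * β p) - 1 ≠ 0 := by
    intro p k hk
    have h1 : 0 < |(k : ℝ)| := by simpa using hk
    have h2 : 0 < 4 * (γ / |(k : ℝ)| ^ s) := by positivity
    exact norm_pos_iff.mp (h2.trans_le (hlow p k hk))
  obtain ⟨hA, hS⟩ := ana_tsum (δ := δ - η) (C := CL γ s * C / η ^ (s + 2))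
    (d := fun p k => coef u p k / (ec (k * β p) - 1))
    (M := fun k => (s + 2).factorial / (4 * γ) * C / η ^ (s + 2) * (1 / (k : ℝ) ^ 2)) (by
      have := hasSum_zetaTwo.mul_left ((s + 2).factorial / (4 * γ) * C / η ^ (s + 2))
      have h2 : (s + 2).factorial / (4 * γ) * C / η ^ (s + 2) * zetaTwo =
        CL γ s * C / η ^ (s + 2) := by unfold CL; ring
      rwa [h2] at this) (by
      intro p k
      have hC : 0 ≤ C := h.pos_or hδ p
      rcases eq_or_ne k 0 with rfl | hk
      · simp [ec_zero]
      have hk' : 0 < |(k : ℝ)| := by simpa using hk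
      have h1 := h.norm_coef_le hδ p k
      have h2 := pow_mul_exp_neg_le s hη hk
      rw [norm_div]
      calc ‖coef u p k‖ / ‖ec (k * β p) - 1‖
          ≤ (C * Real.exp (-(2 * Real.pi * |k| * δ))) / (4 * (γ / |(k : ℝ)| ^ s)) := by
            gcongr
            exact hlow p k hk
        _ = C / (4 * γ) * (|(k : ℝ)| ^ s * Real.exp (-(2 * Real.pi * |(k : ℝ)| * η))) *
              Real.exp (-(2 * Real.pi * |k| * (δ - η))) := by
            have : Real.exp (-(2 * Real.pi * |k| * δ)) =
              Real.exp (-(2 * Real.pi * |(k : ℝ)| * η)) *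
              Real.exp (-(2 * Real.pi * |k| * (δ - η))) := by
              rw [← Real.exp_add]; congr 1; push_cast; ring
            rw [this]
            field_simp
        _ ≤ C / (4 * γ) * ((s + 2).factorial / η ^ (s + 2) * (1 / (k : ℝ) ^ 2)) *
              Real.exp (-(2 * Real.pi * |k| * (δ - η))) := by gcongr
        _ = _ := by ring)
    (by
      intro k
      rcases eq_or_ne k 0 with rfl | hk
      · simpa [ec_zero] using continuous_const
      · exact (h.continuous_coef hδ k).div
          ((continuous_ec.comp (by fun_prop)).sub continuous_const) fun p => hne p k hk)
    (by
      intro p k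
      simp only [h.coef_neg, map_div₀, map_sub, conj_ec, map_one, map_mul, Complex.conj_ofReal,
        Int.cast_neg, map_intCast]
      ring_nf)
  refine ⟨hA, fun p z hz => ?_⟩
  have hzδ : z ∈ strip δ := strip_mono (by linarith) hz
  have h1 := (hS p (z + β p) (add_real_mem_strip hz _)).hasSum.sub (hS p z hz).hasSum
  have h2 := (h.hasSum_coef p hzδ).sub (hasSum_ite_eq (0 : ℤ) (mean u p))
  refine h1.unique (h2.congr_fun ?_)
  intro k
  rcases eq_or_ne k 0 with rfl | hk
  · simp [ec_zero, coef_zero_eq_mean]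
  · have := hne p k hk
    simp only [hk, if_false, sub_zero, mul_add, ec_add]
    field_simp

/-- Interpolation between a small bound on the real axis and a bound on a strip. -/
lemma Ana.interpolate {δ B a : ℝ} {X : P → ℂ → ℂ} (h : Ana δ (B ^ 2) X) (hδ : 0 < δ) (hδ1 : δ ≤ 1)
    (hB : 0 ≤ B) (ha : 0 ≤ a) (hX : ∀ p, ∀ x : ℝ, ‖X p x‖ ≤ a ^ 2) {p : P} {z : ℂ}
    (hz : z ∈ strip (δ / 4)) : ‖X p z‖ ≤ (1 + zetaTwo) * a * B / δ ^ 2 := by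
  have hcoef : ∀ k : ℤ, ‖coef X p k‖ ≤ a ^ 2 := by
    intro k
    have := intervalIntegral.norm_integral_le_of_norm_le_const (a := (0 : ℝ)) (b := 1)
      (f := fun x : ℝ => X p x * ec (-(k * x))) (C := a ^ 2) ?_
    · simpa [coef] using this
    · intro x _
      rw [norm_mul, norm_ec]
      simpa using hX p x
  have hcoef2 : ∀ k : ℤ, ‖coef X p k‖ ≤ a * B * Real.exp (-(Real.pi * |k| * δ)) := by
    intro k
    have h1 := h.norm_coef_le hδ p k
    have h2 : ‖coef X p k‖ ^ 2 ≤ (a * B * Real.exp (-(Real.pi * |k| * δ))) ^ 2 := by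
      calc ‖coef X p k‖ ^ 2 = ‖coef X p k‖ * ‖coef X p k‖ := sq _
        _ ≤ a ^ 2 * (B ^ 2 * Real.exp (-(2 * Real.pi * |k| * δ))) := by
          gcongr
          exact hcoef k
        _ = _ := by
          rw [mul_pow, mul_pow, ← Real.exp_nat_mul]
          push_cast
          ring_nf
    exact le_of_sq_le_sq h2 (by positivity)
  have hzδ : z ∈ strip δ := strip_mono (by linarith) hz
  have hz' : |z.im| ≤ δ / 4 := le_of_lt hz
  have hM : HasSum (fun k : ℤ => a * B * ((if k = 0 then 1 else 0) + 1 / δ ^ 2 * (1 / (k : ℝ) ^ 2)))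
      (a * B * (1 + 1 / δ ^ 2 * zetaTwo)) :=
    ((hasSum_ite_eq (0 : ℤ) (1 : ℝ)).add (hasSum_zetaTwo.mul_left _)).mul_left _
  rw [← (h.hasSum_coef p hzδ).tsum_eq]
  refine (tsum_of_norm_bounded hM fun k => ?_).trans ?_
  · have h0 : ‖coef X p k * ec (k * z)‖ ≤
        a * B * Real.exp (-(Real.pi / 2 * |(k : ℝ)| * δ)) := by
      rw [norm_mul]
      refine (mul_le_mul (hcoef2 k) ((norm_ec_int_mul k z).trans (Real.exp_le_exp.mpr
        (show _ ≤ 2 * Real.pi * |k| * (δ / 4) by gcongr))) (norm_nonneg _)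
        (by positivity)).trans (le_of_eq ?_)
      rw [mul_assoc (a * B), ← Real.exp_add]
      congr 2
      push_cast
      ring
    refine h0.trans ?_
    gcongr
    rcases eq_or_ne k 0 with rfl | hk
    · simp
    · have hk' : 0 < |(k : ℝ)| := by simpa using hk
      simp only [hk, if_false, zero_add]
      have h1 := Real.pow_div_factorial_le_exp (Real.pi / 2 * |(k : ℝ)| * δ) (by positivity) 2
      have h2 : (|(k : ℝ)| * δ) ^ 2 ≤ Real.exp (Real.pi / 2 * |(k : ℝ)| * δ) := by
        refine le_trans ?_ h1
        have h3 : (Real.pi / 2 * |(k : ℝ)| * δ) ^ 2 / (Nat.factorial 2) =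
          (Real.pi ^ 2 / 8) * (|(k : ℝ)| * δ) ^ 2 := by
          simp [Nat.factorial]; ring
        rw [h3]
        have := Real.pi_gt_three
        have h4 : 1 ≤ Real.pi ^ 2 / 8 := by nlinarith
        exact le_mul_of_one_le_left (by positivity) h4
      rw [Real.exp_neg, ← sq_abs (k : ℝ), one_div_mul_one_div, ← mul_pow, ← one_div, mul_comm δ]
      exact one_div_le_one_div_of_le (by positivity) h2
  · have h1 : 1 ≤ 1 / δ ^ 2 := by
      rw [le_div_iff₀ (by positivity), one_mul]
      exact pow_le_one₀ hδ.le hδ1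
    have h2 : (1 + zetaTwo) * a * B / δ ^ 2 = a * B * (1 / δ ^ 2 + 1 / δ ^ 2 * zetaTwo) := by ring
    rw [h2]
    gcongr

end HermanKAM

namespace HermanKAM

open Complex Set Filter Topology

variable {P : Type*} [TopologicalSpace P]

/-- The weight `1 + |k₁| + |k₂|` of a frequency. -/
def wt (k : ℤ × ℤ) : ℝ := 1 + |(k.1 : ℝ)| + |(k.2 : ℝ)|

lemma one_le_wt (k : ℤ × ℤ) : 1 ≤ wt k := by
  unfold wt
  have := abs_nonneg (k.1 : ℝ)
  have := abs_nonneg (k.2 : ℝ)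
  linarith

lemma abs_fst_le_wt (k : ℤ × ℤ) : |(k.1 : ℝ)| ≤ wt k := by
  unfold wt
  have := abs_nonneg (k.2 : ℝ)
  linarith

lemma abs_snd_le_wt (k : ℤ × ℤ) : |(k.2 : ℝ)| ≤ wt k := by
  unfold wt
  have := abs_nonneg (k.1 : ℝ)
  linarith

/-- Families of double Fourier coefficients with weighted `ℓ¹` bound. -/
structure Coefs (m : ℕ) (ε : ℝ) (g : P → ℤ × ℤ → ℂ) : Prop where
  cont : ∀ k, Continuous fun p => g p k
  conj : ∀ p k, g p (-k) = (starRingEnd ℂ) (g p k)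
  bound : ∃ a : ℤ × ℤ → ℝ, HasSum a ε ∧ (∀ k, 0 ≤ a k) ∧ ∀ p k, ‖g p k‖ * wt k ^ m ≤ a k

/-- Coefficients of the derivative in the first variable. -/
noncomputable def D1 (g : P → ℤ × ℤ → ℂ) (p : P) (k : ℤ × ℤ) : ℂ := 2 * Real.pi * I * k.1 * g p k

/-- Coefficients of the derivative in the second variable. -/
noncomputable def D2 (g : P → ℤ × ℤ → ℂ) (p : P) (k : ℤ × ℤ) : ℂ := 2 * Real.pi * I * k.2 * g p k

lemma norm_two_pi_I_mul_int (k : ℤ) : ‖(2 * Real.pi * I * k : ℂ)‖ = 2 * Real.pi * |(k : ℝ)| := by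
  simp [abs_of_pos Real.pi_pos]

namespace Coefs

variable {m : ℕ} {ε : ℝ} {g : P → ℤ × ℤ → ℂ}

lemma nonneg (h : Coefs m ε g) : 0 ≤ ε := by
  obtain ⟨a, ha, h0, -⟩ := h.bound
  exact ha.nonneg h0

lemma d1 (h : Coefs (m + 1) ε g) : Coefs m (2 * Real.pi * ε) (D1 g) where
  cont k := continuous_const.mul (h.cont k)
  conj p k := by simp [D1, h.conj, Complex.conj_ofNat 2]
  bound := by
    obtain ⟨a, ha, h0, hb⟩ := h.bound
    refine ⟨fun k => 2 * Real.pi * a k, ha.mul_left _, fun k => ?_, fun p k => ?_⟩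
    · have := h0 k; positivity
    · rw [D1, norm_mul, norm_two_pi_I_mul_int]
      have h1 := hb p k
      have h2 := abs_fst_le_wt k
      have h3 := one_le_wt k
      calc 2 * Real.pi * |(k.1 : ℝ)| * ‖g p k‖ * wt k ^ m
          ≤ 2 * Real.pi * wt k * ‖g p k‖ * wt k ^ m := by gcongr
        _ = 2 * Real.pi * (‖g p k‖ * wt k ^ (m + 1)) := by ring
        _ ≤ _ := mul_le_mul_of_nonneg_left h1 (by positivity)

lemma d2 (h : Coefs (m + 1) ε g) : Coefs m (2 * Real.pi * ε) (D2 g) where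
  cont k := continuous_const.mul (h.cont k)
  conj p k := by simp [D2, h.conj, Complex.conj_ofNat 2]
  bound := by
    obtain ⟨a, ha, h0, hb⟩ := h.bound
    refine ⟨fun k => 2 * Real.pi * a k, ha.mul_left _, fun k => ?_, fun p k => ?_⟩
    · have := h0 k; positivity
    · rw [D2, norm_mul, norm_two_pi_I_mul_int]
      have h1 := hb p k
      have h2 := abs_snd_le_wt k
      have h3 := one_le_wt k
      calc 2 * Real.pi * |(k.2 : ℝ)| * ‖g p k‖ * wt k ^ m
          ≤ 2 * Real.pi * wt k * ‖g p k‖ * wt k ^ m := by gcongr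
        _ = 2 * Real.pi * (‖g p k‖ * wt k ^ (m + 1)) := by ring
        _ ≤ _ := mul_le_mul_of_nonneg_left h1 (by positivity)

lemma sum_le (h : Coefs m ε g) {j : ℕ} (hj : j ≤ m) (p : P) (S : Finset (ℤ × ℤ)) :
    ∑ k ∈ S, ‖g p k‖ * wt k ^ j ≤ ε := by
  obtain ⟨a, ha, h0, hb⟩ := h.bound
  calc ∑ k ∈ S, ‖g p k‖ * wt k ^ j ≤ ∑ k ∈ S, a k := by
        refine Finset.sum_le_sum fun k _ => le_trans ?_ (hb p k)
        gcongr
        exact one_le_wt k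
    _ ≤ ε := sum_le_hasSum S (fun k _ => h0 k) ha

/-- Tail estimate: the part of the coefficients with weight at least `n`. -/
lemma sum_tail_le (h : Coefs m ε g) {n : ℝ} (hn : 0 < n) (p : P) (S : Finset (ℤ × ℤ))
    (hS : ∀ k ∈ S, n ≤ wt k) : ∑ k ∈ S, ‖g p k‖ ≤ ε / n ^ m := by
  rw [le_div_iff₀ (by positivity), Finset.sum_mul]
  refine le_trans (Finset.sum_le_sum fun k hk => ?_) (h.sum_le le_rfl p S)
  gcongr
  exact hS k hk

lemma summable (h : Coefs m ε g) (p : P) : Summable fun k => ‖g p k‖ :=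
  summable_of_sum_le (fun _ => norm_nonneg _) fun S => by
    simpa using h.sum_le (Nat.zero_le m) p S

end Coefs

/-- The frequencies with both components of absolute value at most `N`. -/
noncomputable def box (N : ℕ) : Finset (ℤ × ℤ) := Finset.Icc (-N : ℤ) N ×ˢ Finset.Icc (-N : ℤ) N

lemma mem_box {N : ℕ} {k : ℤ × ℤ} : k ∈ box N ↔ |k.1| ≤ N ∧ |k.2| ≤ N := by
  simp [box, abs_le]

lemma le_wt_of_notMem_box {N : ℕ} {k : ℤ × ℤ} (h : k ∉ box N) : (N : ℝ) ≤ wt k := by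
  rw [mem_box, not_and_or, not_le, not_le] at h
  rcases h with h | h
  · refine le_trans ?_ (abs_fst_le_wt k)
    exact_mod_cast h.le
  · refine le_trans ?_ (abs_snd_le_wt k)
    exact_mod_cast h.le

lemma box_mono {N M : ℕ} (h : N ≤ M) : box N ⊆ box M := by
  intro k hk
  rw [mem_box] at *
  have : (N : ℤ) ≤ M := by exact_mod_cast h
  exact ⟨hk.1.trans this, hk.2.trans this⟩

/-- The character with frequency `k` in two complex variables. -/
noncomputable def ec2 (k : ℤ × ℤ) (x y : ℂ) : ℂ := ec (k.1 * x + k.2 * y)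

/-- Truncated double Fourier series. -/
noncomputable def trig (g : P → ℤ × ℤ → ℂ) (N : ℕ) (p : P) (x y : ℂ) : ℂ :=
  ∑ k ∈ box N, g p k * ec2 k x y

lemma norm_ec2_le (k : ℤ × ℤ) {x y : ℂ} {r : ℝ} (hx : |x.im| ≤ r) (hy : |y.im| ≤ r) :
    ‖ec2 k x y‖ ≤ Real.exp (2 * Real.pi * ((|(k.1 : ℝ)| + |(k.2 : ℝ)|) * r)) := by
  rw [ec2, ec_add, norm_mul]
  refine (mul_le_mul (norm_ec_int_mul _ _) (norm_ec_int_mul _ _) (norm_nonneg _)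
    (Real.exp_pos _).le).trans ?_
  rw [← Real.exp_add, Real.exp_le_exp]
  push_cast
  calc 2 * Real.pi * |(k.1 : ℝ)| * |x.im| + 2 * Real.pi * |(k.2 : ℝ)| * |y.im|
      ≤ 2 * Real.pi * |(k.1 : ℝ)| * r + 2 * Real.pi * |(k.2 : ℝ)| * r := by gcongr
    _ = _ := by ring

/-- Uniform bound for characters of frequency at most `N` on a strip of half-width `2 / N`. -/
noncomputable def Ce : ℝ := Real.exp (8 * Real.pi)

lemma Ce_pos : 0 < Ce := Real.exp_pos _

lemma one_le_Ce : 1 ≤ Ce := Real.one_le_exp (by positivity)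

lemma norm_ec2_le_Ce {N : ℕ} (hN : 0 < N) {k : ℤ × ℤ} (hk : k ∈ box N) {x y : ℂ}
    (hx : |x.im| ≤ 2 / N) (hy : |y.im| ≤ 2 / N) : ‖ec2 k x y‖ ≤ Ce := by
  refine (norm_ec2_le k hx hy).trans ?_
  rw [Ce, Real.exp_le_exp]
  rw [mem_box] at hk
  have hN' : (0 : ℝ) < N := by exact_mod_cast hN
  have h1 : |(k.1 : ℝ)| ≤ N := by exact_mod_cast hk.1
  have h2 : |(k.2 : ℝ)| ≤ N := by exact_mod_cast hk.2
  have h3 : (|(k.1 : ℝ)| + |(k.2 : ℝ)|) * (2 / N) ≤ (N + N) * (2 / N) := by gcongr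
  have h4 : ((N : ℝ) + N) * (2 / N) = 4 := by field_simp; norm_num
  rw [h4] at h3
  nlinarith [Real.pi_pos]

lemma norm_ec2_real (k : ℤ × ℤ) (x y : ℝ) : ‖ec2 k x y‖ = 1 := by
  rw [ec2, norm_ec]; simp

lemma conj_trig {P : Type*} {g : P → ℤ × ℤ → ℂ} (hg : ∀ p k, g p (-k) = (starRingEnd ℂ) (g p k)) (N : ℕ)
    (p : P) (x y : ℂ) :
    (starRingEnd ℂ) (trig g N p x y) = trig g N p ((starRingEnd ℂ) x) ((starRingEnd ℂ) y) := by
  rw [trig, trig, map_sum]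
  refine Finset.sum_nbij' (fun k => -k) (fun k => -k) ?_ ?_ ?_ ?_ ?_
  · intro k hk; simpa [mem_box] using hk
  · intro k hk; simpa [mem_box] using hk
  · simp
  · simp
  · intro k _
    simp [ec2, hg, conj_ec]
    left
    ring_nf

namespace Coefs

variable {m : ℕ} {ε : ℝ} {g : P → ℤ × ℤ → ℂ}

lemma norm_trig_le (h : Coefs m ε g) {N : ℕ} (hN : 0 < N) (p : P) {x y : ℂ}
    (hx : |x.im| ≤ 2 / N) (hy : |y.im| ≤ 2 / N) : ‖trig g N p x y‖ ≤ Ce * ε := by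
  calc ‖trig g N p x y‖ ≤ ∑ k ∈ box N, ‖g p k‖ * Ce := by
        refine norm_sum_le_of_le _ fun k hk => ?_
        rw [norm_mul]
        gcongr
        exact norm_ec2_le_Ce hN hk hx hy
    _ = Ce * ∑ k ∈ box N, ‖g p k‖ * wt k ^ 0 := by
        simp only [pow_zero, mul_one]
        rw [← Finset.sum_mul, mul_comm]
    _ ≤ _ := mul_le_mul_of_nonneg_left (h.sum_le (Nat.zero_le m) p _) Ce_pos.le

lemma norm_trig_sub_trig_le (h : Coefs m ε g) {N M : ℕ} (hN : 0 < N) (hNM : N ≤ M) (p : P)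
    {x y : ℂ} (hx : |x.im| ≤ 2 / M) (hy : |y.im| ≤ 2 / M) :
    ‖trig g M p x y - trig g N p x y‖ ≤ Ce * (ε / (N : ℝ) ^ m) := by
  have hM : 0 < M := hN.trans_le hNM
  rw [trig, trig, ← Finset.sum_sdiff_eq_sub (box_mono hNM)]
  calc ‖∑ k ∈ box M \ box N, g p k * ec2 k x y‖ ≤ ∑ k ∈ box M \ box N, ‖g p k‖ * Ce := by
        refine norm_sum_le_of_le _ fun k hk => ?_
        rw [norm_mul]
        gcongr
        exact norm_ec2_le_Ce hM (Finset.mem_sdiff.mp hk).1 hx hy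
    _ = Ce * ∑ k ∈ box M \ box N, ‖g p k‖ := by rw [← Finset.sum_mul, mul_comm]
    _ ≤ _ := by
        gcongr
        · exact Ce_pos.le
        · exact h.sum_tail_le (by exact_mod_cast hN) p _ fun k hk =>
            le_wt_of_notMem_box (Finset.mem_sdiff.mp hk).2

lemma summable_ec2 (h : Coefs m ε g) (p : P) (x y : ℝ) :
    Summable fun k => g p k * ec2 k x y :=
  Summable.of_norm_bounded (h.summable p) fun k => by rw [norm_mul, norm_ec2_real, mul_one]

lemma norm_tsum_sub_trig_le (h : Coefs m ε g) {N : ℕ} (hN : 0 < N) (p : P) (x y : ℝ) :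
    ‖∑' k, g p k * ec2 k x y - trig g N p x y‖ ≤ ε / (N : ℝ) ^ m := by
  have h1 := (h.summable_ec2 p x y).sum_add_tsum_subtype_compl (box N)
  rw [← h1, trig, add_sub_cancel_left]
  have hs : Summable fun k : {k // k ∉ box N} => ‖g p k‖ := (h.summable p).subtype _
  refine (tsum_of_norm_bounded hs.hasSum (fun k => ?_)).trans ?_
  · rw [norm_mul, norm_ec2_real, mul_one]
  · refine hs.tsum_le_of_sum_le fun S => ?_
    have := h.sum_tail_le (n := N) (by exact_mod_cast hN) p (S.map (Function.Embedding.subtype _))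
      (by
        intro k hk
        simp only [Finset.mem_map, Function.Embedding.coe_subtype, Subtype.exists] at hk
        obtain ⟨k', hk', _, rfl⟩ := hk
        exact le_wt_of_notMem_box hk')
    simpa using this

lemma continuous_tsum (h : Coefs m ε g) (p : P) :
    Continuous fun q : ℝ × ℝ => ∑' k, g p k * ec2 k q.1 q.2 := by
  refine _root_.continuous_tsum (fun k => ?_) (h.summable p) fun k q => ?_
  · unfold ec2
    exact continuous_const.mul (continuous_ec.comp (by fun_prop))
  · rw [norm_mul, norm_ec2_real, mul_one]

/-- Second order Taylor estimate for trigonometric polynomials. -/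
lemma taylor (h : Coefs (m + 2) ε g) {N : ℕ} (hN : 0 < N) (p : P) {x y k₁ k₂ : ℂ} {r : ℝ}
    (hx : |x.im| ≤ 2 / N) (hy : |y.im| ≤ 2 / N) (h1 : ‖k₁‖ ≤ r) (h2 : ‖k₂‖ ≤ r)
    (hr : r * (4 * Real.pi * N) ≤ 1) :
    ‖trig g N p (x + k₁) (y + k₂) - trig g N p x y - trig (D1 g) N p x y * k₁ -
      trig (D2 g) N p x y * k₂‖ ≤ Ce * (4 * Real.pi ^ 2) * ε * r ^ 2 := by
  have hr0 : 0 ≤ r := (norm_nonneg _).trans h1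
  simp only [trig, Finset.sum_mul, ← Finset.sum_sub_distrib]
  calc _ ≤ ∑ k ∈ box N, Ce * (4 * Real.pi ^ 2) * (‖g p k‖ * wt k ^ 2) * r ^ 2 := by
        refine norm_sum_le_of_le _ fun k hk => ?_
        set w : ℂ := 2 * Real.pi * I * (k.1 * k₁ + k.2 * k₂) with hw
        have e1 : ec2 k (x + k₁) (y + k₂) = ec2 k x y * Complex.exp w := by
          rw [hw, ec2, ec2, ← ec, ← ec_add]
          congr 1; ring
        have e2 : g p k * ec2 k (x + k₁) (y + k₂) - g p k * ec2 k x y - D1 g p k * ec2 k x y * k₁ -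
            D2 g p k * ec2 k x y * k₂ = g p k * (ec2 k x y * (Complex.exp w - 1 - w)) := by
          rw [e1, hw, D1, D2]; ring
        have hw1 : ‖w‖ ≤ 2 * Real.pi * ((|(k.1 : ℝ)| + |(k.2 : ℝ)|) * r) := by
          rw [hw, norm_mul]
          have : ‖(2 * Real.pi * I : ℂ)‖ = 2 * Real.pi := by simp [abs_of_pos Real.pi_pos]
          rw [this]
          gcongr
          refine (norm_add_le _ _).trans ?_
          rw [norm_mul, norm_mul, Complex.norm_intCast, Complex.norm_intCast, add_mul]
          gcongr
        have hb := mem_box.mp hk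
        have hb1 : |(k.1 : ℝ)| ≤ N := by exact_mod_cast hb.1
        have hb2 : |(k.2 : ℝ)| ≤ N := by exact_mod_cast hb.2
        have hw2 : ‖w‖ ≤ 1 := by
          refine hw1.trans (le_trans ?_ hr)
          have : (|(k.1 : ℝ)| + |(k.2 : ℝ)|) * r ≤ (N + N) * r := by gcongr
          nlinarith [Real.pi_pos]
        have hw3 : ‖w‖ ≤ 2 * Real.pi * (wt k * r) := by
          refine hw1.trans ?_
          gcongr
          unfold wt; linarith
        rw [e2, norm_mul, norm_mul]
        calc ‖g p k‖ * (‖ec2 k x y‖ * ‖Complex.exp w - 1 - w‖)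
            ≤ ‖g p k‖ * (Ce * (2 * Real.pi * (wt k * r)) ^ 2) := by
              gcongr
              · exact Ce_pos.le
              · exact norm_ec2_le_Ce hN hk hx hy
              · refine (Complex.norm_exp_sub_one_sub_id_le hw2).trans ?_
                gcongr
          _ = _ := by ring
    _ = Ce * (4 * Real.pi ^ 2) * (∑ k ∈ box N, ‖g p k‖ * wt k ^ 2) * r ^ 2 := by
        rw [← Finset.sum_mul, ← Finset.mul_sum]
    _ ≤ _ := by
        have := Ce_pos
        gcongr
        exact h.sum_le (by omega) p _

end Coefs

/-- A bound on the derivative controls the imaginary part on a strip. -/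
lemma Ana.abs_im_le {δ C L : ℝ} {u : P → ℂ → ℂ} (h : Ana δ C u)
    (hL : ∀ p, ∀ z ∈ strip δ, ‖_root_.deriv (u p) z‖ ≤ L) (p : P) {z : ℂ} (hz : z ∈ strip δ) :
    |(u p z).im| ≤ L * |z.im| := by
  have hδ : 0 < δ := (abs_nonneg _).trans_lt hz
  have h1 := h.lipschitz p (hL p) (real_mem_strip hδ z.re) hz
  have h2 : z - z.re = z.im * I := by
    rw [sub_eq_iff_eq_add, add_comm, Complex.re_add_im]
  rw [h2, norm_mul, Complex.norm_I, mul_one, Complex.norm_real, Real.norm_eq_abs] at h1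
  refine le_trans ?_ h1
  have h3 := Complex.abs_im_le_norm (u p z - u p z.re)
  rwa [Complex.sub_im, h.real, sub_zero] at h3

/-- Composition of a trigonometric polynomial with a graph-like curve. -/
noncomputable def cmp (g : P → ℤ × ℤ → ℂ) (N : ℕ) (u v : P → ℂ → ℂ) : P → ℂ → ℂ :=
  fun p z => trig g N p (z + u p z) (v p z)

lemma hasDerivAt_trig_comp {P : Type*} (g : P → ℤ × ℤ → ℂ) (N : ℕ) (p : P) {x y : ℂ → ℂ} {x' y' z : ℂ}
    (hx : HasDerivAt x x' z) (hy : HasDerivAt y y' z) :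
    HasDerivAt (fun z => trig g N p (x z) (y z))
      (trig (D1 g) N p (x z) (y z) * x' + trig (D2 g) N p (x z) (y z) * y') z := by
  simp only [trig, Finset.sum_mul, ← Finset.sum_add_distrib]
  refine HasDerivAt.fun_sum fun k _ => ?_
  have := ((hasDerivAt_ec (k.1 * x z + k.2 * y z)).comp z
    ((hx.const_mul (k.1 : ℂ)).add (hy.const_mul (k.2 : ℂ)))).const_mul (g p k)
  refine this.congr_deriv ?_
  simp only [D1, D2, ec2]
  ring

lemma Ana.cmp {m N : ℕ} {ε δ C C' : ℝ} {g : P → ℤ × ℤ → ℂ} {u v : P → ℂ → ℂ} (hg : Coefs m ε g)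
    (hN : 0 < N) (hu : Ana δ C u) (hv : Ana δ C' v)
    (hx : ∀ p, ∀ z ∈ strip δ, |(z + u p z).im| ≤ 2 / N)
    (hy : ∀ p, ∀ z ∈ strip δ, |(v p z).im| ≤ 2 / N) : Ana δ (Ce * ε) (cmp g N u v) where
  diff p z hz := by
    have h1 := ((hu.hasDerivAt p hz))
    have h2 := ((hv.hasDerivAt p hz))
    exact (hasDerivAt_trig_comp g N p ((hasDerivAt_id z).add h1)
      h2).differentiableAt.differentiableWithinAt
  cont z hz := by
    unfold HermanKAM.cmp trig ec2
    refine continuous_finsetSum _ fun k _ => (hg.cont k).mul (continuous_ec.comp ?_)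
    have := hu.cont z hz
    have := hv.cont z hz
    fun_prop
  per p z := by
    unfold HermanKAM.cmp trig
    refine Finset.sum_congr rfl fun k _ => ?_
    rw [hu.per, hv.per]
    congr 1
    rw [ec2, ec2, show (k.1 * (z + 1 + u p z) + k.2 * v p z : ℂ) =
      (k.1 * (z + u p z) + k.2 * v p z) + k.1 by ring, ec_add, ec_int, mul_one]
  bound p z hz := hg.norm_trig_le hN p (hx p z hz) (hy p z hz)
  real p x := by
    rw [← Complex.conj_eq_iff_im, HermanKAM.cmp, conj_trig hg.conj, map_add,
      Complex.conj_eq_iff_im.mpr (hu.real p x), Complex.conj_eq_iff_im.mpr (hv.real p x),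
      Complex.conj_ofReal]

end HermanKAM

namespace HermanKAM

open Complex Set Filter Topology

section Algebra

variable {a Ra w₁ Rw₁ w₂ Rw₂ G1x G1y G2x G2y v' Rv' E1 E2 E1' E2' c1 c2 : ℂ}

/-- The linearised first equation is solved up to a quadratic error. -/
lemma newton_identity_fst (ha : a ≠ 0) (hRa0 : Ra ≠ 0) (hRa : Ra - a = G1x * a + G1y * v' + E1')
    (hw₁ : Rw₁ - w₁ = G1y * a⁻¹ * Ra⁻¹ * w₂ + (c1 - E1) * Ra⁻¹) :
    E1 - c1 + (Ra * Rw₁ - a * w₁) - G1x * (a * w₁) - G1y * (v' * w₁ + w₂ * a⁻¹) = E1' * w₁ := by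
  have h1 : Rw₁ = w₁ + (G1y * a⁻¹ * Ra⁻¹ * w₂ + (c1 - E1) * Ra⁻¹) := by rw [← hw₁]; ring
  have h2 : E1' = Ra - a - (G1x * a + G1y * v') := by rw [hRa]; ring
  rw [h1, h2]
  field_simp
  ring

/-- The linearised second equation is solved up to a quadratic error and an error proportional
to the defect of area preservation. -/
lemma newton_identity_snd (ha : a ≠ 0) (hRa0 : Ra ≠ 0) (hRa : Ra - a = G1x * a + G1y * v' + E1')
    (hRv : Rv' - v' = G2x * a + G2y * v' + E2')
    (hw₁ : Rw₁ - w₁ = G1y * a⁻¹ * Ra⁻¹ * w₂ + (c1 - E1) * Ra⁻¹)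
    (hw₂ : Rw₂ - w₂ = -(Ra * (E2 - c2) - Rv' * (E1 - c1))) :
    E2 - c2 + (Rv' * Rw₁ + Rw₂ * Ra⁻¹ - (v' * w₁ + w₂ * a⁻¹)) - G2x * (a * w₁)
      - G2y * (v' * w₁ + w₂ * a⁻¹) = E2' * w₁ + w₂ * (a⁻¹ * Ra⁻¹ *
        (-(a * ((1 + G1x) * (1 + G2y) - G1y * G2x - 1)) - E1' * (1 + G2y) + G1y * E2')) := by
  have h1 : Rw₁ = w₁ + (G1y * a⁻¹ * Ra⁻¹ * w₂ + (c1 - E1) * Ra⁻¹) := by rw [← hw₁]; ring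
  have h3 : Rw₂ = w₂ + -(Ra * (E2 - c2) - Rv' * (E1 - c1)) := by rw [← hw₂]; ring
  have h2 : E1' = Ra - a - (G1x * a + G1y * v') := by rw [hRa]; ring
  have h4 : E2' = Rv' - v' - (G2x * a + G2y * v') := by rw [hRv]; ring
  rw [h1, h3, h2, h4]
  field_simp
  ring

end Algebra

variable {P : Type*} [TopologicalSpace P]

/-- An approximately invariant curve `z ↦ (z + u, v)` for the truncation at order `N`. -/
structure Approx (β : P → ℝ) (g₁ g₂ : P → ℤ × ℤ → ℂ) (N : ℕ) (δ κ ε : ℝ) (u v V : P → ℂ → ℂ)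
    (Λ₁ Λ₂ : P → ℂ) : Prop where
  hu : Ana δ κ u
  hv : Ana δ κ v
  hV : Ana δ κ V
  du : Ana δ κ (fun p z => deriv (u p) z)
  dv : Ana δ κ (fun p z => deriv (v p) z)
  eqV : ∀ p, ∀ z ∈ strip δ, V p (z + β p) - V p z = deriv (v p) z
  cont₁ : Continuous Λ₁
  cont₂ : Continuous Λ₂
  real₁ : ∀ p, (Λ₁ p).im = 0
  real₂ : ∀ p, (Λ₂ p).im = 0
  err₁ : ∀ p, ∀ z ∈ strip δ, ‖u p (z + β p) - u p z - cmp g₁ N u v p z - Λ₁ p‖ ≤ ε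
  err₂ : ∀ p, ∀ z ∈ strip δ, ‖v p (z + β p) - v p z - cmp g₂ N u v p z - Λ₂ p‖ ≤ ε

/-- Bounds on derivatives keep the curve in the region where characters are bounded. -/
lemma im_bounds {N : ℕ} {δ C C' : ℝ} {u v : P → ℂ → ℂ} (hN : 0 < N) (hδN : δ ≤ 1 / N)
    (hu : Ana δ C u) (hv : Ana δ C' v)
    (hdu : ∀ p, ∀ z ∈ strip δ, ‖deriv (u p) z‖ ≤ 1 / 8)
    (hdv : ∀ p, ∀ z ∈ strip δ, ‖deriv (v p) z‖ ≤ 1 / 8) :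
    (∀ p, ∀ z ∈ strip δ, |(z + u p z).im| ≤ 2 / N) ∧
    (∀ p, ∀ z ∈ strip δ, |(v p z).im| ≤ 2 / N) := by
  have hN' : (0 : ℝ) < 1 / N := by positivity
  have h2 : (2 : ℝ) / N = 2 * (1 / N) := by ring
  constructor
  · intro p z hz
    have h1 := hu.abs_im_le hdu p hz
    have h3 : |z.im| < δ := hz
    have h4 := abs_add_le z.im (u p z).im
    rw [add_im, h2]
    linarith
  · intro p z hz
    have h1 := hv.abs_im_le hdv p hz
    have h3 : |z.im| < δ := hz
    rw [h2]
    linarith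

/-- The error terms form analytic families and their derivatives can be computed. -/
lemma error_family [FirstCountableTopology P] {m N : ℕ} {ε₀ δ κ ε : ℝ} {g : P → ℤ × ℤ → ℂ}
    {u v w : P → ℂ → ℂ} {β : P → ℝ} {Λ : P → ℂ} (hg : Coefs (m + 1) ε₀ g) (hN : 0 < N)
    (hβ : Continuous β) (hu : Ana δ κ u) (hv : Ana δ κ v) (hw : Ana δ κ w) (hΛ : Continuous Λ)
    (hΛr : ∀ p, (Λ p).im = 0)
    (hx : ∀ p, ∀ z ∈ strip δ, |(z + u p z).im| ≤ 2 / N)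
    (hy : ∀ p, ∀ z ∈ strip δ, |(v p z).im| ≤ 2 / N)
    (herr : ∀ p, ∀ z ∈ strip δ, ‖w p (z + β p) - w p z - cmp g N u v p z - Λ p‖ ≤ ε) :
    ∃ E : P → ℂ → ℂ, (∀ p z, E p z = w p (z + β p) - w p z - cmp g N u v p z - Λ p) ∧
      Ana δ ε E ∧ ∀ p, ∀ z ∈ strip δ, deriv (w p) (z + β p) - deriv (w p) z =
        cmp (D1 g) N u v p z * (1 + deriv (u p) z) + cmp (D2 g) N u v p z * deriv (v p) z +
          deriv (E p) z := by
  have hE : Ana δ ε (fun p z => w p (z + β p) - w p z - cmp g N u v p z - Λ p) := by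
    have h1 := ((hw.sh hβ).sub hw).sub (Ana.cmp hg hN hu hv hx hy)
    refine ⟨fun p => ((h1.diff p).sub_const (Λ p)), fun z hz => (h1.cont z hz).sub hΛ,
      fun p z => ?_, herr, fun p x => ?_⟩
    · have := h1.per p z
      simp only [sh_apply] at this
      rw [this]
    · have := h1.real p x
      simp only [sh_apply] at this
      rw [sub_im, this, hΛr, sub_zero]
  refine ⟨_, fun _ _ => rfl, hE, fun p z hz => ?_⟩
  have hc : HasDerivAt (fun z => cmp g N u v p z)
      (cmp (D1 g) N u v p z * (1 + deriv (u p) z) + cmp (D2 g) N u v p z * deriv (v p) z) z :=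
    hasDerivAt_trig_comp g N p ((hasDerivAt_id z).add (hu.hasDerivAt p hz)) (hv.hasDerivAt p hz)
  have hs : HasDerivAt (fun z => w p (z + β p)) (deriv (w p) (z + β p)) z := by
    have := (hw.hasDerivAt p (add_real_mem_strip hz (β p)))
    exact this.comp_add_const z (β p)
  have := ((hs.sub (hw.hasDerivAt p hz)).sub hc).sub_const (Λ p)
  rw [show deriv (fun z => w p (z + β p) - w p z - cmp g N u v p z - Λ p) z = _ from this.deriv]
  ring

end HermanKAM

namespace HermanKAM

open Complex Set Filter Topology

variable {P : Type*} [TopologicalSpace P]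

lemma inv_near_one {z : ℂ} (h : ‖z - 1‖ ≤ 1 / 8) : 7 / 8 ≤ ‖z‖ ∧ z ≠ 0 ∧ ‖z⁻¹ - 1‖ ≤ 1 / 7 := by
  have h1 : 7 / 8 ≤ ‖z‖ := by
    have := norm_sub_norm_le 1 (1 - z)
    rw [sub_sub_cancel, norm_one, norm_sub_rev] at this
    linarith
  have h0 : z ≠ 0 := norm_pos_iff.mp (by linarith)
  refine ⟨h1, h0, ?_⟩
  have : z⁻¹ - 1 = (1 - z) * z⁻¹ := by field_simp
  rw [this, norm_mul, norm_inv, norm_sub_rev]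
  calc ‖z - 1‖ * ‖z‖⁻¹ ≤ (1 / 8) * (7 / 8)⁻¹ := by gcongr
    _ = 1 / 7 := by norm_num

set_option maxHeartbeats 1600000 in
/-- The Newton step: corrections solving the linearised equations, with quadratic error. -/
theorem newton_step [FirstCountableTopology P] {m N s : ℕ} {ε₀ δ κ ε η γ A ξ : ℝ}
    {g₁ g₂ : P → ℤ × ℤ → ℂ} {u v V : P → ℂ → ℂ} {β : P → ℝ} {Λ₁ Λ₂ : P → ℂ}
    (hg₁ : Coefs (m + 2) ε₀ g₁) (hg₂ : Coefs (m + 2) ε₀ g₂) (hN : 0 < N)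
    (hδN : δ = 1 / N) (hη : η = δ / 16) (hδ1 : δ ≤ 1) (hκ : κ ≤ 1 / 8)
    (hβ : Continuous β) (hγ : 0 < γ) (hD : ∀ p, Dio γ s (β p))
    (hA : A = 1 + CL γ s) (hε₀ : Ce * (2 * Real.pi * ε₀) ≤ 1 / 16)
    (hε₀' : Ce * (4 * Real.pi ^ 2) * ε₀ ≤ 1)
    (happ : Approx β g₁ g₂ N δ κ ε u v V Λ₁ Λ₂) (hε : 0 ≤ ε)
    {e : ℝ} (he : e = ε / η ^ (2 * (s + 2)))
    (hr : 8 * A ^ 2 * e * (4 * Real.pi * N) ≤ 1)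
    (hξ : ∀ p, ∀ z ∈ strip (δ / 4), ‖(1 + cmp (D1 g₁) N u v p z) * (1 + cmp (D2 g₂) N u v p z) -
      cmp (D2 g₁) N u v p z * cmp (D1 g₂) N u v p z - 1‖ ≤ ξ) :
    ∃ (h₁ h₂ W : P → ℂ → ℂ) (c1 c2 : P → ℂ),
      Ana (δ - 2 * η) (8 * A ^ 2 * e) h₁ ∧ Ana (δ - 2 * η) (8 * A ^ 2 * e) h₂ ∧
      Ana (δ - 4 * η) (A * (8 * A ^ 2 * e / η) / η ^ (s + 2)) W ∧
      (∀ p, ∀ z ∈ strip (δ - 4 * η), W p (z + β p) - W p z = deriv (h₂ p) z) ∧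
      Continuous c1 ∧ Continuous c2 ∧ (∀ p, (c1 p).im = 0) ∧ (∀ p, (c2 p).im = 0) ∧
      (∀ p, ‖c1 p‖ ≤ 4 * A * e) ∧ (∀ p, ‖c2 p‖ ≤ 4 * A * e) ∧
      (∀ p, ∀ z ∈ strip (δ / 4), ‖(u p (z + β p) + h₁ p (z + β p)) - (u p z + h₁ p z) -
        trig g₁ N p (z + u p z + h₁ p z) (v p z + h₂ p z) - (Λ₁ p + c1 p)‖ ≤ 79 * A ^ 4 * e ^ 2 +
          8 * A * e * ξ) ∧
      (∀ p, ∀ z ∈ strip (δ / 4), ‖(v p (z + β p) + h₂ p (z + β p)) - (v p z + h₂ p z) -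
        trig g₂ N p (z + u p z + h₁ p z) (v p z + h₂ p z) - (Λ₂ p + c2 p)‖ ≤ 79 * A ^ 4 * e ^ 2 +
          8 * A * e * ξ) := by
  have hN' : (0 : ℝ) < N := by exact_mod_cast hN
  have hδ : 0 < δ := by rw [hδN]; positivity
  have hη0 : 0 < η := by rw [hη]; positivity
  have hη1 : η ≤ 1 := by rw [hη]; linarith
  have hCL := CL_nonneg hγ s
  have hA1 : 1 ≤ A := by linarith
  have hdu : ∀ p, ∀ z ∈ strip δ, ‖deriv (u p) z‖ ≤ 1 / 8 := fun p z hz =>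
    (happ.du.bound p z hz).trans hκ
  have hdv : ∀ p, ∀ z ∈ strip δ, ‖deriv (v p) z‖ ≤ 1 / 8 := fun p z hz =>
    (happ.dv.bound p z hz).trans hκ
  obtain ⟨hx, hy⟩ := im_bounds hN hδN.le happ.hu happ.hv hdu hdv
  obtain ⟨E₁, hE₁, hE₁A, hE₁d⟩ := error_family hg₁ hN hβ happ.hu happ.hv happ.hu happ.cont₁
    happ.real₁ hx hy happ.err₁
  obtain ⟨E₂, hE₂, hE₂A, hE₂d⟩ := error_family hg₂ hN hβ happ.hu happ.hv happ.hv happ.cont₂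
    happ.real₂ hx hy happ.err₂
  -- partial derivatives along the curve
  have hG : ∀ {g : P → ℤ × ℤ → ℂ}, Coefs (m + 1) (2 * Real.pi * ε₀) g →
      Ana δ (1 / 16) (cmp g N u v) := fun hg =>
    (Ana.cmp hg hN happ.hu happ.hv hx hy).mono le_rfl hε₀
  have hG1x := hG hg₁.d1
  have hG1y := hG hg₁.d2
  have hG2x := hG hg₂.d1
  have hG2y := hG hg₂.d2
  obtain ⟨a, ha, haA⟩ : ∃ a : P → ℂ → ℂ, (∀ p z, a p z = 1 + deriv (u p) z) ∧ Ana δ (9 / 8) a :=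
    ⟨_, fun _ _ => rfl, (Ana.one.add happ.du).mono le_rfl (by linarith)⟩
  obtain ⟨b, hb, hbA⟩ : ∃ b : P → ℂ → ℂ, (∀ p z, b p z = deriv (v p) z) ∧ Ana δ (1 / 8) b :=
    ⟨_, fun _ _ => rfl, happ.dv.mono le_rfl hκ⟩
  have hanear : ∀ p, ∀ z ∈ strip δ, ‖a p z - 1‖ ≤ 1 / 8 := fun p z hz => by
    rw [ha, add_sub_cancel_left]; exact hdu p z hz
  obtain ⟨Ra, hRa, hRaA⟩ : ∃ f : P → ℂ → ℂ, (∀ p z, f p z = a p (z + β p)) ∧ Ana δ (9 / 8) f :=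
    ⟨_, fun _ _ => rfl, haA.sh hβ⟩
  obtain ⟨Rb, hRb, hRbA⟩ : ∃ f : P → ℂ → ℂ, (∀ p z, f p z = b p (z + β p)) ∧ Ana δ (1 / 8) f :=
    ⟨_, fun _ _ => rfl, hbA.sh hβ⟩
  obtain ⟨RV, hRV, hRVA⟩ : ∃ f : P → ℂ → ℂ, (∀ p z, f p z = V p (z + β p)) ∧ Ana δ (1 / 8) f :=
    ⟨_, fun _ _ => rfl, (happ.hV.mono le_rfl hκ).sh hβ⟩
  have hRanear : ∀ p, ∀ z ∈ strip δ, ‖Ra p z - 1‖ ≤ 1 / 8 := fun p z hz => by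
    rw [hRa]; exact hanear p _ (add_real_mem_strip hz _)
  obtain ⟨ia, hia, hiaA⟩ : ∃ f : P → ℂ → ℂ, (∀ p z, f p z = (a p z)⁻¹) ∧ Ana δ (8 / 7) f :=
    ⟨_, fun _ _ => rfl, (haA.inv (by norm_num : (0 : ℝ) < 7 / 8)
      fun p z hz => (inv_near_one (hanear p z hz)).1).mono le_rfl (by norm_num)⟩
  obtain ⟨iRa, hiRa, hiRaA⟩ : ∃ f : P → ℂ → ℂ, (∀ p z, f p z = (Ra p z)⁻¹) ∧ Ana δ (8 / 7) f :=
    ⟨_, fun _ _ => rfl, (hRaA.inv (by norm_num : (0 : ℝ) < 7 / 8)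
      fun p z hz => (inv_near_one (hRanear p z hz)).1).mono le_rfl (by norm_num)⟩
  set t := s + 2 with ht
  set e₁ := ε / η ^ t with he₁
  have hε_e₁ : ε ≤ e₁ := by
    rw [he₁, le_div_iff₀ (by positivity)]
    exact mul_le_of_le_one_right hε (pow_le_one₀ hη0.le hη1)
  have he₁0 : 0 ≤ e₁ := by positivity
  have he₁e : e = e₁ / η ^ t := by rw [he, he₁, div_div, ← pow_add, two_mul]
  have he₁_e : e₁ ≤ e := by
    rw [he₁e, le_div_iff₀ (by positivity)]
    exact mul_le_of_le_one_right he₁0 (pow_le_one₀ hη0.le hη1)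
  have he0 : 0 ≤ e := he₁0.trans he₁_e
  have hεη : ε / η ≤ e₁ := by
    rw [he₁]
    gcongr
    exact pow_le_of_le_one hη0.le hη1 (by omega)
  -- the mean correction of the second equation
  obtain ⟨F, hF, hFA⟩ : ∃ f : P → ℂ → ℂ, (∀ p z, f p z = Ra p z * E₂ p z - Rb p z * E₁ p z) ∧
      Ana δ (9 / 8 * ε + 1 / 8 * ε) f :=
    ⟨_, fun _ _ => rfl, (hRaA.mul hE₂A).sub (hRbA.mul hE₁A)⟩
  have hc2n : ∀ p, ‖mean F p‖ ≤ 5 / 4 * ε := fun p => (hFA.norm_mean_le hδ p).trans (by linarith)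
  have hc2c := hFA.continuous_mean hδ
  have hc2r := hFA.mean_im
  have hc2A : Ana δ (5 / 4 * ε) (fun p _ => mean F p) := Ana.const hc2c hc2n hc2r
  have hmeanRa : ∀ p, mean Ra p = 1 := by
    intro p
    have h1 : mean Ra p = mean a p := by
      have : Ra = sh β a := by ext p z; exact hRa p z
      rw [this, haA.mean_sh]
    have h2 : a = fun p z => 1 + deriv (u p) z := by ext p z; exact ha p z
    rw [h1, h2, Ana.one.mean_add happ.du hδ, happ.hu.mean_deriv hδ]
    simp [mean]
  obtain ⟨Q₂, hQ₂, hQ₂A⟩ : ∃ f : P → ℂ → ℂ, (∀ p z, f p z = mean F p * Ra p z - F p z) ∧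
      Ana δ (3 * ε) f :=
    ⟨_, fun _ _ => rfl, ((hc2A.mul hRaA).sub hFA).mono le_rfl (by linarith)⟩
  have hQ₂m : ∀ p, mean Q₂ p = 0 := by
    intro p
    have h2 : Q₂ = fun p z => mean F p * Ra p z - F p z := by ext p z; exact hQ₂ p z
    rw [h2, (hc2A.mul hRaA).mean_sub hFA hδ, mean_const_mul, hmeanRa]
    ring
  obtain ⟨hw2aA, hw2aeq⟩ := hQ₂A.linv hδ hη0 hγ hβ hD
  have hw2aA' : Ana (δ - η) (3 * A * e₁) (Linv β Q₂) := by
    refine hw2aA.mono le_rfl ?_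
    rw [he₁]
    have : CL γ s * (3 * ε) / η ^ t = 3 * CL γ s * (ε / η ^ t) := by ring
    rw [this]
    gcongr
    linarith
  clear hw2aA
  -- the torsion-free coupling and the mean correction of the first equation
  obtain ⟨S, hS, hSA⟩ : ∃ f : P → ℂ → ℂ,
      (∀ p z, f p z = cmp (D2 g₁) N u v p z * ia p z * iRa p z) ∧ Ana δ (1 / 8) f :=
    ⟨_, fun _ _ => rfl, ((hG1y.mul hiaA).mul hiRaA).mono le_rfl (by norm_num)⟩
  have hδη : 0 < δ - η := by rw [hη]; linarith
  have hlt : δ - η ≤ δ := by linarith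
  have hSw : Ana (δ - η) (1 / 8 * (3 * A * e₁)) (fun p z => S p z * Linv β Q₂ p z) :=
    (hSA.mono hlt le_rfl).mul hw2aA'
  have hSV : Ana δ (1 / 8 * (1 / 8)) (fun p z => S p z * RV p z) := hSA.mul hRVA
  have hEi : Ana δ (ε * (8 / 7)) (fun p z => E₁ p z * iRa p z) := hE₁A.mul hiRaA
  have hiRa1 : Ana δ (1 / 7) (fun p z => iRa p z - 1) := (hiRaA.sub Ana.one).of_bound
    fun p z hz => by rw [hiRa]; exact (inv_near_one (hRanear p z hz)).2.2
  set den : P → ℂ := fun p => mean iRa p - mean (fun p z => S p z * RV p z) p with hden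
  set num : P → ℂ := fun p => mean (fun p z => E₁ p z * iRa p z) p -
    mean (fun p z => S p z * Linv β Q₂ p z) p with hnum
  have hdenlow : ∀ p, 1 / 2 ≤ ‖den p‖ := by
    intro p
    have h1 := hiRa1.norm_mean_le hδ p
    rw [hiRaA.mean_sub Ana.one hδ] at h1
    have h1' : mean (fun (_ : P) (_ : ℂ) => (1 : ℂ)) p = 1 := by simp [mean]
    rw [h1'] at h1
    have h2 := hSV.norm_mean_le hδ p
    have h3 : (1 : ℂ) = den p - (mean iRa p - 1) + mean (fun p z => S p z * RV p z) p := by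
      rw [hden]; ring
    have h4 : (1 : ℝ) ≤ ‖den p‖ + ‖mean iRa p - 1‖ + ‖mean (fun p z => S p z * RV p z) p‖ := by
      have h5 := norm_add_le (den p - (mean iRa p - 1)) (mean (fun p z => S p z * RV p z) p)
      have h6 := norm_sub_le (den p) (mean iRa p - 1)
      rw [← h3, norm_one] at h5
      linarith
    norm_num at h1 h2 h4 ⊢
    linarith
  have hden0 : ∀ p, den p ≠ 0 := fun p => norm_pos_iff.mp (by linarith [hdenlow p])
  have hAe : 0 ≤ A * e₁ := by positivity
  have hεA : ε ≤ A * e₁ := hε_e₁.trans (le_mul_of_one_le_left he₁0 hA1)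
  obtain ⟨c1, hc1, hc1n, hc1c, hc1r⟩ : ∃ c1 : P → ℂ, (∀ p, c1 p * den p = num p) ∧
      (∀ p, ‖c1 p‖ ≤ 4 * A * e₁) ∧ Continuous c1 ∧ ∀ p, (c1 p).im = 0 := by
    refine ⟨fun p => num p / den p, fun p => div_mul_cancel₀ _ (hden0 p), fun p => ?_, ?_,
      fun p => ?_⟩
    · have h1 : ‖num p‖ ≤ 2 * (A * e₁) := by
        refine (norm_sub_le _ _).trans ((add_le_add (hEi.norm_mean_le hδ p)
          (hSw.norm_mean_le hδη p)).trans ?_)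
        linarith
      rw [norm_div, div_le_iff₀ (by linarith [hdenlow p])]
      nlinarith [hdenlow p]
    · exact ((hEi.continuous_mean hδ).sub (hSw.continuous_mean hδη)).div
        ((hiRaA.continuous_mean hδ).sub (hSV.continuous_mean hδ)) hden0
    · have h1 : (num p).im = 0 := by
        rw [hnum, sub_im, hEi.mean_im, hSw.mean_im, sub_zero]
      have h2 : (den p).im = 0 := by
        rw [hden, sub_im, hiRaA.mean_im, hSV.mean_im, sub_zero]
      rw [div_im, h1, h2]; simp
  have hc1A : Ana δ (4 * A * e₁) (fun p _ => c1 p) := Ana.const hc1c hc1n hc1r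
  obtain ⟨w₂, hw₂, hw₂A⟩ : ∃ f : P → ℂ → ℂ,
      (∀ p z, f p z = Linv β Q₂ p z - c1 p * RV p z) ∧ Ana (δ - η) (4 * A * e₁) f :=
    ⟨_, fun _ _ => rfl, (hw2aA'.sub ((hc1A.mul hRVA).mono hlt le_rfl)).mono le_rfl (by linarith)⟩
  obtain ⟨Q₁, hQ₁, hQ₁A⟩ : ∃ f : P → ℂ → ℂ,
      (∀ p z, f p z = S p z * w₂ p z + (c1 p * iRa p z - E₁ p z * iRa p z)) ∧
      Ana (δ - η) (7 * A * e₁) f :=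
    ⟨_, fun _ _ => rfl, (((hSA.mono hlt le_rfl).mul hw₂A).add
      (((hc1A.mul hiRaA).sub hEi).mono hlt le_rfl)).mono le_rfl (by linarith)⟩
  have hQ₁m : ∀ p, mean Q₁ p = 0 := by
    intro p
    have h2 : Q₁ = fun p z => (S p z * Linv β Q₂ p z - c1 p * (S p z * RV p z)) +
        (c1 p * iRa p z - E₁ p z * iRa p z) := by
      ext p z; rw [hQ₁, hw₂]; ring
    have hcSV : Ana (δ - η) _ (fun p z => c1 p * (S p z * RV p z)) :=
      (hc1A.mul hSV).mono hlt le_rfl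
    have hci : Ana (δ - η) _ (fun p z => c1 p * iRa p z) := (hc1A.mul hiRaA).mono hlt le_rfl
    have hEi' := hEi.mono hlt le_rfl
    rw [h2, (hSw.sub hcSV).mean_add (hci.sub hEi') hδη, hSw.mean_sub hcSV hδη,
      hci.mean_sub hEi' hδη, mean_const_mul, mean_const_mul]
    have := hc1 p
    simp only [hden, hnum] at this
    linear_combination this
  obtain ⟨hw₁A, hw₁eq⟩ := hQ₁A.linv hδη hη0 hγ hβ hD
  obtain ⟨w₁, hw₁A', hw₁L⟩ : ∃ f : P → ℂ → ℂ, Ana (δ - 2 * η) (7 * A ^ 2 * e) f ∧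
      ∀ p, ∀ z ∈ strip (δ - 2 * η), f p (z + β p) - f p z = Q₁ p z := by
    refine ⟨Linv β Q₁, hw₁A.mono (by linarith) ?_, fun p z hz => ?_⟩
    · rw [he₁e]
      have : CL γ s * (7 * A * e₁) / η ^ t = CL γ s * (7 * A * (e₁ / η ^ t)) := by ring
      rw [this, show 7 * A ^ 2 * (e₁ / η ^ t) = A * (7 * A * (e₁ / η ^ t)) by ring]
      gcongr
      linarith
    · rw [hw₁eq p z (strip_mono (by linarith) hz), hQ₁m, sub_zero]
  clear hw₁A hw₁eq
  have hA2e : A * e₁ ≤ A ^ 2 * e := by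
    calc A * e₁ ≤ A * e := by gcongr
      _ ≤ A * (A * e) := le_mul_of_one_le_left (by positivity) hA1
      _ = A ^ 2 * e := by ring
  have hlt2 : δ - 2 * η ≤ δ := by linarith
  have hlt21 : δ - 2 * η ≤ δ - η := by linarith
  have hδ2η : 0 < δ - 2 * η := by rw [hη]; linarith
  obtain ⟨h₁, hh₁, hh₁A⟩ : ∃ f : P → ℂ → ℂ, (∀ p z, f p z = a p z * w₁ p z) ∧
      Ana (δ - 2 * η) (8 * A ^ 2 * e) f :=
    ⟨_, fun _ _ => rfl, ((haA.mono hlt2 le_rfl).mul hw₁A').mono le_rfl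
      (by nlinarith [mul_nonneg (sq_nonneg A) he0])⟩
  obtain ⟨h₂, hh₂, hh₂A⟩ : ∃ f : P → ℂ → ℂ, (∀ p z, f p z = b p z * w₁ p z + w₂ p z * ia p z) ∧
      Ana (δ - 2 * η) (8 * A ^ 2 * e) f :=
    ⟨_, fun _ _ => rfl, (((hbA.mono hlt2 le_rfl).mul hw₁A').add
      ((hw₂A.mono hlt21 le_rfl).mul (hiaA.mono hlt2 le_rfl))).mono le_rfl
      (by nlinarith [mul_nonneg (sq_nonneg A) he0])⟩
  have hdh₂ := hh₂A.deriv hη0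
  have hδ3η : 0 < δ - 2 * η - η := by rw [hη]; linarith
  obtain ⟨hWA, hWeq⟩ := hdh₂.linv hδ3η hη0 hγ hβ hD
  -- identities along the curve
  have key : ∀ p, ∀ z ∈ strip (δ - 2 * η), a p z ≠ 0 ∧ Ra p z ≠ 0 ∧
      Ra p z - a p z = cmp (D1 g₁) N u v p z * a p z + cmp (D2 g₁) N u v p z * b p z +
        deriv (E₁ p) z ∧
      Rb p z - b p z = cmp (D1 g₂) N u v p z * a p z + cmp (D2 g₂) N u v p z * b p z +
        deriv (E₂ p) z ∧
      w₁ p (z + β p) - w₁ p z = cmp (D2 g₁) N u v p z * (a p z)⁻¹ * (Ra p z)⁻¹ * w₂ p z +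
        (c1 p - E₁ p z) * (Ra p z)⁻¹ ∧
      w₂ p (z + β p) - w₂ p z =
        -(Ra p z * (E₂ p z - mean F p) - Rb p z * (E₁ p z - c1 p)) := by
    intro p z hz
    have hzδ : z ∈ strip δ := strip_mono hlt2 hz
    refine ⟨(inv_near_one (hanear p z hzδ)).2.1, (inv_near_one (hRanear p z hzδ)).2.1, ?_, ?_, ?_,
      ?_⟩
    · rw [hRa, ha, ha, hb, ← hE₁d p z hzδ]; ring
    · rw [hRb, hb, hb, ha, ← hE₂d p z hzδ]
    · rw [hw₁L p z hz, hQ₁, hS, hia, hiRa]; ring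
    · have h1 := hw2aeq p z (strip_mono hlt21 hz)
      rw [hQ₂m, sub_zero, hQ₂, hF] at h1
      have h2 : RV p (z + β p) - RV p z = Rb p z := by
        rw [hRV, hRV, hRb, hb]
        exact happ.eqV p _ (add_real_mem_strip hzδ _)
      rw [hw₂, hw₂]
      linear_combination h1 - c1 p * h2
  have hquart : δ / 4 ≤ δ - 2 * η := by rw [hη]; linarith
  have hE' : ∀ {E : P → ℂ → ℂ}, Ana δ ε E → ∀ p, ∀ z ∈ strip (δ - 2 * η),
      ‖deriv (E p) z‖ ≤ e₁ := fun hE p z hz =>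
    (hE.norm_deriv_le hη0 p (strip_mono (by linarith) hz)).trans hεη
  have hT : ∀ {g : P → ℤ × ℤ → ℂ}, Coefs (m + 2) ε₀ g → ∀ p, ∀ z ∈ strip (δ - 2 * η),
      ‖trig g N p (z + u p z + h₁ p z) (v p z + h₂ p z) - cmp g N u v p z -
        cmp (D1 g) N u v p z * h₁ p z - cmp (D2 g) N u v p z * h₂ p z‖ ≤ (8 * A ^ 2 * e) ^ 2 := by
    intro g hg p z hz
    have hzδ : z ∈ strip δ := strip_mono hlt2 hz
    refine (hg.taylor hN p (hx p z hzδ) (hy p z hzδ) (hh₁A.bound p z hz) (hh₂A.bound p z hz)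
      hr).trans ?_
    exact mul_le_of_le_one_left (by positivity) hε₀'
  have hA4 : A ^ 2 * e ^ 2 ≤ A ^ 4 * e ^ 2 := by
    gcongr
    norm_num
  have hξ0 : ∀ p : P, 0 ≤ ξ := fun p =>
    (norm_nonneg _).trans (hξ p 0 (by simpa using real_mem_strip (by linarith : 0 < δ / 4) 0))
  refine ⟨h₁, h₂, _, c1, mean F, hh₁A, hh₂A, hWA.mono (by linarith) ?_, ?_, hc1c, hc2c, hc1r, hc2r,
    ?_, ?_, ?_, ?_⟩
  · gcongr
    linarith
  · intro p z hz
    rw [hWeq p z (strip_mono (by linarith) hz), hh₂A.mean_deriv hδ2η, sub_zero]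
  · intro p
    refine (hc1n p).trans ?_
    gcongr
  · intro p
    refine (hc2n p).trans ?_
    have := mul_le_mul_of_nonneg_left he₁_e (by linarith : 0 ≤ A)
    linarith
  · intro p z hz
    have hz' := strip_mono hquart hz
    have hzδ := strip_mono hlt2 hz'
    obtain ⟨ha0, hRa0, k1, k2, k3, k4⟩ := key p z hz'
    have id1 := newton_identity_fst ha0 hRa0 k1 k3
    have e1 : (u p (z + β p) + h₁ p (z + β p)) - (u p z + h₁ p z) -
        trig g₁ N p (z + u p z + h₁ p z) (v p z + h₂ p z) - (Λ₁ p + c1 p) =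
        deriv (E₁ p) z * w₁ p z - (trig g₁ N p (z + u p z + h₁ p z) (v p z + h₂ p z) -
          cmp g₁ N u v p z - cmp (D1 g₁) N u v p z * h₁ p z - cmp (D2 g₁) N u v p z * h₂ p z) := by
      rw [← id1, hE₁, hh₁, hh₁, hh₂, ← hRa, hia]; ring
    rw [e1]
    refine (norm_sub_le _ _).trans ((add_le_add (?_ : _ ≤ e * (7 * A ^ 2 * e))
      (hT hg₁ p z hz')).trans ?_)
    · rw [norm_mul]
      exact mul_le_mul ((hE' hE₁A p z hz').trans he₁_e) (hw₁A'.bound p z hz') (norm_nonneg _) he0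
    · have : 0 ≤ A * e * ξ := by have := hξ0 p; positivity
      have h4 : (8 * A ^ 2 * e) ^ 2 = 64 * (A ^ 4 * e ^ 2) := by ring
      have h5 : 0 ≤ A ^ 4 * e ^ 2 := by positivity
      linarith
  · intro p z hz
    have hz' := strip_mono hquart hz
    have hzδ := strip_mono hlt2 hz'
    obtain ⟨ha0, hRa0, k1, k2, k3, k4⟩ := key p z hz'
    have id2 := newton_identity_snd ha0 hRa0 k1 k2 k3 k4
    set B := (a p z)⁻¹ * (Ra p z)⁻¹ * (-(a p z * ((1 + cmp (D1 g₁) N u v p z) *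
      (1 + cmp (D2 g₂) N u v p z) - cmp (D2 g₁) N u v p z * cmp (D1 g₂) N u v p z - 1)) -
      deriv (E₁ p) z * (1 + cmp (D2 g₂) N u v p z) +
        cmp (D2 g₁) N u v p z * deriv (E₂ p) z) with hB
    have e1 : (v p (z + β p) + h₂ p (z + β p)) - (v p z + h₂ p z) -
        trig g₂ N p (z + u p z + h₁ p z) (v p z + h₂ p z) - (Λ₂ p + mean F p) =
        deriv (E₂ p) z * w₁ p z + w₂ p z * B -
          (trig g₂ N p (z + u p z + h₁ p z) (v p z + h₂ p z) -
          cmp g₂ N u v p z - cmp (D1 g₂) N u v p z * h₁ p z - cmp (D2 g₂) N u v p z * h₂ p z) := by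
      rw [← id2, hE₂, hh₁, hh₂, hh₂, ← hRb, hia, hia, ← hRa]; ring
    have hBn : ‖B‖ ≤ 2 * ξ + 2 * e₁ := by
      have b1 : ‖(a p z)⁻¹‖ ≤ 8 / 7 := by rw [← hia]; exact hiaA.bound p z hzδ
      have b2 : ‖(Ra p z)⁻¹‖ ≤ 8 / 7 := by rw [← hiRa]; exact hiRaA.bound p z hzδ
      have b3 := mul_le_mul (haA.bound p z hzδ) (hξ p z hz) (norm_nonneg _) (by norm_num)
      have b4 : ‖1 + cmp (D2 g₂) N u v p z‖ ≤ 17 / 16 :=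
        (norm_add_le _ _).trans (by rw [norm_one]; linarith [hG2y.bound p z hzδ])
      have b5 := mul_le_mul (hE' hE₁A p z hz') b4 (norm_nonneg _) he₁0
      have b6 := mul_le_mul (hG1y.bound p z hzδ) (hE' hE₂A p z hz') (norm_nonneg _) (by norm_num)
      rw [← norm_mul] at b3 b5 b6
      have b7 := mul_le_mul b1 b2 (norm_nonneg _) (by norm_num)
      rw [← norm_mul] at b7
      rw [hB, norm_mul]
      refine (mul_le_mul b7 (((norm_add_le _ _).trans (add_le_add (norm_sub_le _ _) le_rfl)).trans
        (add_le_add (add_le_add ((norm_neg _).le.trans b3) b5) b6)) (norm_nonneg _)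
        (by norm_num)).trans ?_
      have := hξ0 p
      linarith
    rw [e1]
    refine (norm_sub_le _ _).trans ((add_le_add ((norm_add_le _ _).trans (add_le_add
      (?_ : _ ≤ e * (7 * A ^ 2 * e)) (?_ : _ ≤ 4 * A * e * (2 * ξ + 2 * e))))
      (hT hg₂ p z hz')).trans ?_)
    · rw [norm_mul]
      exact mul_le_mul ((hE' hE₂A p z hz').trans he₁_e) (hw₁A'.bound p z hz') (norm_nonneg _) he0
    · rw [norm_mul]
      have hw2b := hw₂A.bound p z (strip_mono hlt21 hz')
      have := hξ0 p
      refine mul_le_mul (hw2b.trans ?_) (hBn.trans ?_) (norm_nonneg _) (by positivity)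
      · gcongr
      · linarith
    · have h3 : A * e ^ 2 ≤ A ^ 4 * e ^ 2 := by
        gcongr
        exact le_self_pow₀ hA1 (by norm_num)
      have h4 : (8 * A ^ 2 * e) ^ 2 = 64 * (A ^ 4 * e ^ 2) := by ring
      have h5 : 0 ≤ A ^ 4 * e ^ 2 := by positivity
      linarith

end HermanKAM

namespace HermanKAM

open Complex Set Filter Topology

variable {P : Type*} [TopologicalSpace P]

/-- Sum of a double Fourier series. -/
noncomputable def fsum (g : P → ℤ × ℤ → ℂ) (p : P) (x y : ℝ) : ℂ := ∑' k, g p k * ec2 k x y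

lemma det_perturb {a b c d a' b' c' d' : ℂ} {θ : ℝ} (hθ : θ ≤ 1 / 16) (ha : ‖a‖ ≤ 1 / 16)
    (hb : ‖b‖ ≤ 1 / 16) (hc : ‖c‖ ≤ 1 / 16) (hd : ‖d‖ ≤ 1 / 16) (ha' : ‖a' - a‖ ≤ θ)
    (hb' : ‖b' - b‖ ≤ θ) (hc' : ‖c' - c‖ ≤ θ) (hd' : ‖d' - d‖ ≤ θ)
    (h : (1 + a') * (1 + d') - b' * c' = 1) : ‖(1 + a) * (1 + d) - b * c - 1‖ ≤ 4 * θ := by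
  have hθ0 : 0 ≤ θ := (norm_nonneg _).trans ha'
  have e : (1 + a) * (1 + d) - b * c - 1 = -((a' - a) * (1 + d)) - (1 + a) * (d' - d) -
      (a' - a) * (d' - d) + (b' - b) * c + b * (c' - c) + (b' - b) * (c' - c) := by
    linear_combination h
  have h1 : ‖1 + d‖ ≤ 17 / 16 := (norm_add_le _ _).trans (by rw [norm_one]; linarith)
  have h2 : ‖1 + a‖ ≤ 17 / 16 := (norm_add_le _ _).trans (by rw [norm_one]; linarith)
  have m1 := mul_le_mul ha' h1 (norm_nonneg _) hθ0
  have m2 := mul_le_mul h2 hd' (norm_nonneg _) (by norm_num)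
  have m3 := mul_le_mul ha' (hd'.trans hθ) (norm_nonneg _) hθ0
  have m4 := mul_le_mul hb' hc (norm_nonneg _) hθ0
  have m5 := mul_le_mul hb hc' (norm_nonneg _) (by norm_num)
  have m6 := mul_le_mul hb' (hc'.trans hθ) (norm_nonneg _) hθ0
  rw [← norm_mul] at m1 m2 m3 m4 m5 m6
  rw [e]
  refine (norm_add_le _ _).trans ((add_le_add ((norm_add_le _ _).trans (add_le_add
    ((norm_add_le _ _).trans (add_le_add ((norm_sub_le _ _).trans (add_le_add ((norm_sub_le _ _).trans
    (add_le_add ((norm_neg _).le.trans m1) m2)) m3)) m4)) m5)) m6).trans ?_)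
  linarith

/-- The Jacobian defect of a map whose Jacobian is one on the real domain. -/
lemma defect_bound [FirstCountableTopology P] {m' N : ℕ} {ε₀ δ κ ε : ℝ}
    {g₁ g₂ : P → ℤ × ℤ → ℂ} {u v V : P → ℂ → ℂ} {β : P → ℝ} {Λ₁ Λ₂ : P → ℂ}
    (hg₁ : Coefs (2 * m' + 1) ε₀ g₁) (hg₂ : Coefs (2 * m' + 1) ε₀ g₂) (hN : 0 < N)
    (hδN : δ = 1 / N) (hδ1 : δ ≤ 1) (hκ : κ ≤ 1 / 8) (hε₀ : Ce * (2 * Real.pi * ε₀) ≤ 1 / 16)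
    (hdet : ∀ p, ∀ x y : ℝ, |y| ≤ 1 / 8 → (1 + fsum (D1 g₁) p x y) * (1 + fsum (D2 g₂) p x y) -
      fsum (D2 g₁) p x y * fsum (D1 g₂) p x y = 1)
    (happ : Approx β g₁ g₂ N δ κ ε u v V Λ₁ Λ₂) (p : P) {z : ℂ} (hz : z ∈ strip (δ / 4)) :
    ‖(1 + cmp (D1 g₁) N u v p z) * (1 + cmp (D2 g₂) N u v p z) -
      cmp (D2 g₁) N u v p z * cmp (D1 g₂) N u v p z - 1‖ ≤
      (1 + zetaTwo) * δ ^ m' * 2 / δ ^ 2 := by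
  have hN' : (0 : ℝ) < N := by exact_mod_cast hN
  have hδ : 0 < δ := by rw [hδN]; positivity
  have hdu : ∀ p, ∀ z ∈ strip δ, ‖deriv (u p) z‖ ≤ 1 / 8 := fun p z hz =>
    (happ.du.bound p z hz).trans hκ
  have hdv : ∀ p, ∀ z ∈ strip δ, ‖deriv (v p) z‖ ≤ 1 / 8 := fun p z hz =>
    (happ.dv.bound p z hz).trans hκ
  obtain ⟨hx, hy⟩ := im_bounds hN hδN.le happ.hu happ.hv hdu hdv
  have h11 := Ana.cmp hg₁.d1 hN happ.hu happ.hv hx hy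
  have h12 := Ana.cmp hg₁.d2 hN happ.hu happ.hv hx hy
  have h21 := Ana.cmp hg₂.d1 hN happ.hu happ.hv hx hy
  have h22 := Ana.cmp hg₂.d2 hN happ.hu happ.hv hx hy
  have hC0 : 0 ≤ Ce * (2 * Real.pi * ε₀) := by
    have := Ce_pos; have := hg₁.nonneg; positivity
  have hX : Ana δ (2 ^ 2) (fun p z => (1 + cmp (D1 g₁) N u v p z) * (1 + cmp (D2 g₂) N u v p z) -
      cmp (D2 g₁) N u v p z * cmp (D1 g₂) N u v p z - 1) := by
    refine (((((Ana.one.add h11).mul (Ana.one.add h22)).sub (h12.mul h21)).sub Ana.one)).mono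
      le_rfl ?_
    nlinarith
  refine hX.interpolate (a := δ ^ m') hδ hδ1 (by norm_num) (by positivity) (fun p x => ?_) hz
  have hxs : (x : ℂ) ∈ strip δ := real_mem_strip hδ x
  have hu1 : u p x = ((u p x).re : ℂ) := Complex.ext rfl (by simp [happ.hu.real p x])
  have hv1 : v p x = ((v p x).re : ℂ) := Complex.ext rfl (by simp [happ.hv.real p x])
  have hvb : |(v p x).re| ≤ 1 / 8 :=
    (Complex.abs_re_le_norm _).trans ((happ.hv.bound p x hxs).trans (by linarith))
  have hCe : 2 * Real.pi * ε₀ ≤ Ce * (2 * Real.pi * ε₀) :=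
    le_mul_of_one_le_left (by have := hg₁.nonneg; positivity) one_le_Ce
  have happr : ∀ {g : P → ℤ × ℤ → ℂ}, Coefs (2 * m') (2 * Real.pi * ε₀) g →
      ‖fsum g p (x + (u p x).re) (v p x).re - cmp g N u v p x‖ ≤ 1 / 16 * (δ ^ m') ^ 2 := by
    intro g hg
    have h1 := hg.norm_tsum_sub_trig_le hN p (x + (u p x).re) (v p x).re
    have h2 : cmp g N u v p x = trig g N p ((x + (u p x).re : ℝ) : ℂ) ((v p x).re : ℂ) := by
      rw [cmp, ← hv1, ofReal_add, ← hu1]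
    rw [h2, fsum]
    refine h1.trans ?_
    rw [← pow_mul, mul_comm m' 2, hδN, div_pow, one_pow, ← mul_div_assoc, mul_one]
    gcongr
    linarith
  have hδm : δ ^ m' ≤ 1 := pow_le_one₀ hδ.le hδ1
  have := det_perturb (θ := 1 / 16 * (δ ^ m') ^ 2)
    (mul_le_of_le_one_right (by norm_num) (pow_le_one₀ (by positivity) hδm))
    ((h11.bound p x hxs).trans hε₀) ((h12.bound p x hxs).trans hε₀)
    ((h21.bound p x hxs).trans hε₀) ((h22.bound p x hxs).trans hε₀)
    (happr hg₁.d1) (happr hg₁.d2) (happr hg₂.d1) (happr hg₂.d2) (hdet p _ _ hvb)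
  refine this.trans ?_
  have : 0 ≤ (δ ^ m') ^ 2 := by positivity
  linarith


set_option maxHeartbeats 800000 in
/-- One step of the iteration: from truncation order `N` to `8 * N`. -/
theorem iteration_step [FirstCountableTopology P] {t N s : ℕ} {ε₀ γ A K : ℝ}
    {g₁ g₂ : P → ℤ × ℤ → ℂ} {u v V : P → ℂ → ℂ} {β : P → ℝ} {Λ₁ Λ₂ : P → ℂ} (hts : t = s + 2)
    (hg₁ : Coefs (4 * t + 7) ε₀ g₁) (hg₂ : Coefs (4 * t + 7) ε₀ g₂) (hN : 0 < N)
    (hβ : Continuous β) (hγ : 0 < γ) (hD : ∀ p, Dio γ s (β p))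
    (hA : A = 1 + CL γ s) (hε₀ : Ce * (2 * Real.pi * ε₀) ≤ 1 / 16)
    (hε₀' : Ce * (4 * Real.pi ^ 2) * ε₀ ≤ 1)
    (hdet : ∀ p, ∀ x y : ℝ, |y| ≤ 1 / 8 → (1 + fsum (D1 g₁) p x y) * (1 + fsum (D2 g₂) p x y) -
      fsum (D2 g₁) p x y * fsum (D1 g₂) p x y = 1)
    (hK1 : 2 * 8 ^ (4 * t + 2) * (79 * A ^ 4 * 16 ^ (4 * t) +
      16 * A * 16 ^ (2 * t) * (1 + zetaTwo) + 1) ≤ K)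
    (hK2 : 8 * A ^ 3 * 16 ^ (3 * t + 2) ≤ K) (hKN : K * (1 / N) ≤ 1)
    (happ : Approx β g₁ g₂ N (1 / N) (1 / 8 - 1 / N) ((1 / N) ^ (4 * t + 2)) u v V Λ₁ Λ₂) :
    ∃ (u' v' V' : P → ℂ → ℂ) (Λ₁' Λ₂' : P → ℂ),
      Approx β g₁ g₂ (8 * N) (1 / (8 * N : ℕ)) (1 / 8 - 1 / (8 * N : ℕ))
        ((1 / (8 * N : ℕ)) ^ (4 * t + 2)) u' v' V' Λ₁' Λ₂' ∧
      (∀ p, ∀ x : ℝ, ‖u' p x - u p x‖ ≤ 1 / N) ∧ (∀ p, ∀ x : ℝ, ‖v' p x - v p x‖ ≤ 1 / N) ∧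
      (∀ p, ‖Λ₁' p - Λ₁ p‖ ≤ 1 / N) ∧ (∀ p, ‖Λ₂' p - Λ₂ p‖ ≤ 1 / N) := by
  have hN' : (0 : ℝ) < N := by exact_mod_cast hN
  obtain ⟨δ, hδN⟩ : ∃ δ : ℝ, δ = 1 / N := ⟨_, rfl⟩
  have hδ : 0 < δ := by rw [hδN]; positivity
  have hδ1 : δ ≤ 1 := by
    rw [hδN, div_le_one hN']; exact_mod_cast hN
  have hδ8 : 1 / ((8 * N : ℕ) : ℝ) = δ / 8 := by
    rw [hδN]; push_cast; field_simp
  rw [hδ8, ← hδN]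
  rw [← hδN] at happ hKN
  have hCL := CL_nonneg hγ s
  have hA1 : 1 ≤ A := by linarith
  have hz0 : 0 ≤ zetaTwo := zetaTwo_nonneg
  obtain ⟨η, hη⟩ : ∃ η : ℝ, η = δ / 16 := ⟨_, rfl⟩
  have hη0 : 0 < η := by rw [hη]; positivity
  obtain ⟨e, he⟩ : ∃ e : ℝ, e = δ ^ (4 * t + 2) / η ^ (2 * (s + 2)) := ⟨_, rfl⟩
  have he' : e = 16 ^ (2 * t) * δ ^ (2 * t + 2) := by
    rw [he, hη, ← hts, div_pow, div_div_eq_mul_div, div_eq_iff (by positivity)]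
    ring
  have he0 : 0 ≤ e := by rw [he']; positivity
  -- consequences of smallness of `δ`
  have hsmall : 8 * A ^ 3 * 16 ^ (3 * t + 2) * δ ≤ 1 :=
    (mul_le_mul_of_nonneg_right hK2 hδ.le).trans hKN
  have hdpow : ∀ j, δ ^ j ≤ 1 := fun j => pow_le_one₀ hδ.le hδ1
  have hW : A * (8 * A ^ 2 * e / η) / η ^ (s + 2) ≤ 1 / 16 * δ := by
    have : A * (8 * A ^ 2 * e / η) / η ^ (s + 2) = (8 * A ^ 3 * 16 ^ (3 * t + 2) * δ) / 16 *
        δ * δ ^ (t - 1) := by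
      obtain ⟨r, rfl⟩ : ∃ r, t = r + 1 := ⟨s + 1, by omega⟩
      rw [← hts, he', hη, div_pow, add_tsub_cancel_right]
      field_simp
      ring
    rw [this]
    have := hdpow (t - 1)
    calc _ ≤ 1 / 16 * δ * 1 := by gcongr
      _ = _ := by ring
  have hηt : ∀ j, η ^ j ≤ 1 := fun j => pow_le_one₀ hη0.le (by rw [hη]; linarith)
  have hdh : 8 * A ^ 2 * e / η ≤ 1 / 16 * δ := by
    refine le_trans ?_ hW
    rw [le_div_iff₀ (by positivity)]
    calc 8 * A ^ 2 * e / η * η ^ (s + 2) ≤ 8 * A ^ 2 * e / η * 1 := by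
          gcongr; exact hηt _
      _ = 1 * (8 * A ^ 2 * e / η) := by ring
      _ ≤ _ := by gcongr
  have hh : 8 * A ^ 2 * e ≤ 1 / 256 * δ ^ 2 := by
    rw [div_le_iff₀ hη0, hη] at hdh
    linarith
  have hhδ : 8 * A ^ 2 * e ≤ 1 / 256 * δ := by
    refine hh.trans ?_
    rw [sq]
    have := mul_le_mul_of_nonneg_left hδ1 hδ.le
    linarith
  have hc : 4 * A * e ≤ δ := by
    have : A * e ≤ A ^ 2 * e := by
      gcongr; exact le_self_pow₀ hA1 (by norm_num)
    nlinarith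
  have hr : 8 * A ^ 2 * e * (4 * Real.pi * N) ≤ 1 := by
    have h1 : δ * N = 1 := by rw [hδN]; field_simp
    calc 8 * A ^ 2 * e * (4 * Real.pi * N) ≤ 1 / 256 * δ * (4 * 4 * N) := by
          gcongr
          exact Real.pi_le_four
      _ = 1 / 16 * (δ * N) := by ring
      _ ≤ 1 := by rw [h1]; norm_num
  have hκ : (1 : ℝ) / 8 - δ ≤ 1 / 8 := by linarith
  have hg₁' : Coefs (2 * (2 * t + 3) + 1) ε₀ g₁ := by convert hg₁ using 1; ring
  have hg₂' : Coefs (2 * (2 * t + 3) + 1) ε₀ g₂ := by convert hg₂ using 1; ring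
  have hξ := fun p z hz => defect_bound hg₁' hg₂' hN hδN hδ1 hκ hε₀ hdet happ p (z := z) hz
  obtain ⟨h₁, h₂, W, c1, c2, hh₁, hh₂, hWA, hWe, hc1, hc2, hc1r, hc2r, hc1n, hc2n, he₁, he₂⟩ :=
    newton_step (m := 4 * t + 5) hg₁ hg₂ hN hδN hη hδ1 hκ hβ hγ hD hA hε₀ hε₀' happ (by positivity)
      he hr hξ
  have herr : 79 * A ^ 4 * e ^ 2 + 8 * A * e * ((1 + zetaTwo) * δ ^ (2 * t + 3) * 2 / δ ^ 2) +
      Ce * (ε₀ / (N : ℝ) ^ (4 * t + 7)) ≤ (δ / 8) ^ (4 * t + 2) := by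
    have h1 : Ce * (ε₀ / (N : ℝ) ^ (4 * t + 7)) ≤ δ ^ (4 * t + 3) := by
      have h2 : Ce * ε₀ ≤ 1 := by
        have h3 := hg₁.nonneg
        have h4 := Ce_pos
        have h5 := Real.pi_gt_three
        have h6 : 0 ≤ Ce * ε₀ := by positivity
        nlinarith
      calc Ce * (ε₀ / (N : ℝ) ^ (4 * t + 7)) = Ce * ε₀ * δ ^ (4 * t + 7) := by
            rw [hδN, div_pow, one_pow]; ring
        _ ≤ 1 * δ ^ (4 * t + 7) := by gcongr
        _ = δ ^ (4 * t + 3) * δ ^ 4 := by ring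
        _ ≤ δ ^ (4 * t + 3) * 1 := by gcongr; exact hdpow 4
        _ = _ := mul_one _
    have h2 : e ^ 2 ≤ 16 ^ (4 * t) * δ ^ (4 * t + 3) := by
      calc e ^ 2 = 16 ^ (4 * t) * δ ^ (4 * t + 3) * δ := by rw [he']; ring
        _ ≤ 16 ^ (4 * t) * δ ^ (4 * t + 3) * 1 := by gcongr
        _ = _ := mul_one _
    have h3 : e * ((1 + zetaTwo) * δ ^ (2 * t + 3) * 2 / δ ^ 2) =
        16 ^ (2 * t) * (1 + zetaTwo) * 2 * δ ^ (4 * t + 3) := by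
      rw [he']; field_simp; ring
    have h4 : 79 * A ^ 4 * e ^ 2 ≤ 79 * A ^ 4 * (16 ^ (4 * t) * δ ^ (4 * t + 3)) := by gcongr
    have h5 : 2 * 8 ^ (4 * t + 2) * (79 * A ^ 4 * 16 ^ (4 * t) +
      16 * A * 16 ^ (2 * t) * (1 + zetaTwo) + 1) * δ ≤ 1 :=
      (mul_le_mul_of_nonneg_right hK1 hδ.le).trans hKN
    rw [div_pow, le_div_iff₀ (by positivity)]
    calc _ ≤ (79 * A ^ 4 * (16 ^ (4 * t) * δ ^ (4 * t + 3)) + 8 * A * (16 ^ (2 * t) *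
          (1 + zetaTwo) * 2 * δ ^ (4 * t + 3)) + δ ^ (4 * t + 3)) * 8 ^ (4 * t + 2) := by
          rw [mul_assoc (8 * A), h3]; gcongr
      _ = 1 / 2 * (2 * 8 ^ (4 * t + 2) * (79 * A ^ 4 * 16 ^ (4 * t) +
          16 * A * 16 ^ (2 * t) * (1 + zetaTwo) + 1) * δ) * δ ^ (4 * t + 2) := by ring
      _ ≤ 1 / 2 * 1 * δ ^ (4 * t + 2) := by gcongr
      _ ≤ _ := by
        have : 0 < δ ^ (4 * t + 2) := by positivity
        linarith
  have hhδ2 : 8 * A ^ 2 * e ≤ 7 / 8 * δ := hhδ.trans (by linarith)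
  have hdhδ : 8 * A ^ 2 * e / η ≤ 7 / 8 * δ := hdh.trans (by linarith)
  have hWδ : A * (8 * A ^ 2 * e / η) / η ^ (s + 2) ≤ 7 / 8 * δ := hW.trans (by linarith)
  have s1 : δ / 8 ≤ δ - 2 * η := by rw [hη]; linarith
  have s2 : δ / 8 ≤ δ - 2 * η - η := by rw [hη]; linarith
  have s3 : δ / 8 ≤ δ - 4 * η := by rw [hη]; linarith
  have s4 : δ / 8 ≤ δ := by linarith
  have hderiv : ∀ {w h : P → ℂ → ℂ} {C C' : ℝ}, Ana δ C w → Ana (δ - 2 * η) C' h →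
      ∀ p, ∀ z ∈ strip (δ / 8), deriv (fun z => w p z + h p z) z = deriv (w p) z + deriv (h p) z :=
    fun hw hh p z hz => ((hw.hasDerivAt p (strip_mono s4 hz)).add
      (hh.hasDerivAt p (strip_mono s1 hz))).deriv
  have hdA : ∀ {w h : P → ℂ → ℂ} {C : ℝ}, Ana δ C w → Ana δ (1 / 8 - δ) (fun p z => deriv (w p) z) →
      Ana (δ - 2 * η) (8 * A ^ 2 * e) h → Ana (δ / 8) (1 / 8 - δ / 8)
        (fun p z => deriv (fun z => w p z + h p z) z) := by
    intro w h C hw hdw hh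
    have e1 := ((hw.mono s4 le_rfl).add (hh.mono s1 le_rfl))
    have e2 := (hdw.mono s4 le_rfl).add ((hh.deriv hη0).mono s2 le_rfl)
    refine ⟨fun p => (e2.diff p).congr (hderiv hw hh p), fun z hz => ?_, fun p z => ?_,
      fun p z hz => ?_, fun p x => ?_⟩
    · exact (e2.cont z hz).congr fun p => (hderiv hw hh p z hz).symm
    · have : (fun z => w p z + h p z) = fun z => w p (z + 1) + h p (z + 1) := by
        ext z; exact (e1.per p z).symm
      conv_rhs => rw [this]
      rw [deriv_comp_add_const (f := fun z => w p z + h p z)]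
    · rw [hderiv hw hh p z hz]
      refine (e2.bound p z hz).trans ?_
      linarith
    · have hx := real_mem_strip (by positivity : 0 < δ / 8) x
      rw [hderiv hw hh p x hx]
      exact e2.real p x
  have hu' : Ana (δ / 8) (1 / 8 - δ / 8) (fun p z => u p z + h₁ p z) :=
    ((happ.hu.mono s4 le_rfl).add (hh₁.mono s1 le_rfl)).mono le_rfl (by linarith)
  have hv' : Ana (δ / 8) (1 / 8 - δ / 8) (fun p z => v p z + h₂ p z) :=
    ((happ.hv.mono s4 le_rfl).add (hh₂.mono s1 le_rfl)).mono le_rfl (by linarith)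
  have hdu' := hdA happ.hu happ.du hh₁
  have hdv' := hdA happ.hv happ.dv hh₂
  have h8N : 0 < 8 * N := by omega
  obtain ⟨hx, hy⟩ := im_bounds h8N hδ8.symm.le hu' hv'
    (fun p z hz => (hdu'.bound p z hz).trans (by linarith))
    (fun p z hz => (hdv'.bound p z hz).trans (by linarith))
  have hswitch : ∀ {g : P → ℤ × ℤ → ℂ}, Coefs (4 * t + 7) ε₀ g → ∀ p, ∀ z ∈ strip (δ / 8), ∀ a l : ℂ,
      ‖a - trig g N p (z + u p z + h₁ p z) (v p z + h₂ p z) - l‖ ≤ 79 * A ^ 4 * e ^ 2 +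
        8 * A * e * ((1 + zetaTwo) * δ ^ (2 * t + 3) * 2 / δ ^ 2) →
      ‖a - cmp g (8 * N) (fun p z => u p z + h₁ p z) (fun p z => v p z + h₂ p z) p z - l‖ ≤
        (δ / 8) ^ (4 * t + 2) := by
    intro g hg p z hz a l h
    have h1 := hg.norm_trig_sub_trig_le hN (by omega : N ≤ 8 * N) p (hx p z hz) (hy p z hz)
    rw [← add_assoc] at h1
    rw [cmp, ← add_assoc]
    have : a - trig g (8 * N) p (z + u p z + h₁ p z) (v p z + h₂ p z) - l =
        (a - trig g N p (z + u p z + h₁ p z) (v p z + h₂ p z) - l) -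
        (trig g (8 * N) p (z + u p z + h₁ p z) (v p z + h₂ p z) -
          trig g N p (z + u p z + h₁ p z) (v p z + h₂ p z)) := by ring
    rw [this]
    exact (norm_sub_le _ _).trans ((add_le_add h h1).trans herr)
  have s5 : δ / 8 ≤ δ / 4 := by linarith
  refine ⟨fun p z => u p z + h₁ p z, fun p z => v p z + h₂ p z, fun p z => V p z + W p z,
    fun p => Λ₁ p + c1 p, fun p => Λ₂ p + c2 p, ⟨hu', hv', ?_, hdu', hdv', ?_, happ.cont₁.add hc1,
    happ.cont₂.add hc2, ?_, ?_, ?_, ?_⟩, ?_, ?_, ?_, ?_⟩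
  · exact ((happ.hV.mono s4 le_rfl).add (hWA.mono s3 le_rfl)).mono le_rfl (by linarith)
  · intro p z hz
    have e1 := happ.eqV p z (strip_mono s4 hz)
    have e2 := hWe p z (strip_mono s3 hz)
    simp only [hderiv happ.hv hh₂ p z hz]
    linear_combination e1 + e2
  · intro p; rw [add_im, happ.real₁, hc1r, add_zero]
  · intro p; rw [add_im, happ.real₂, hc2r, add_zero]
  · exact fun p z hz => hswitch hg₁ p z hz _ _ (he₁ p z (strip_mono s5 hz))
  · exact fun p z hz => hswitch hg₂ p z hz _ _ (he₂ p z (strip_mono s5 hz))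
  · intro p x
    rw [add_sub_cancel_left]
    exact (hh₁.bound p x (real_mem_strip (by linarith) x)).trans (by linarith)
  · intro p x
    rw [add_sub_cancel_left]
    exact (hh₂.bound p x (real_mem_strip (by linarith) x)).trans (by linarith)
  · intro p
    rw [add_sub_cancel_left]
    exact (hc1n p).trans hc
  · intro p
    rw [add_sub_cancel_left]
    exact (hc2n p).trans hc

end HermanKAM

namespace HermanKAM

open Complex Set Filter Topology

variable {P : Type*} [TopologicalSpace P]

lemma exists_lim_of_geometric {a : ℕ → ℂ} {C : ℝ} (h : ∀ n, ‖a (n + 1) - a n‖ ≤ C / 2 / 2 ^ n) :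
    ∃ l, Tendsto a atTop (𝓝 l) ∧ ∀ n, ‖a n - l‖ ≤ C / 2 ^ n := by
  have hc : ∀ n, dist (a n) (a (n + 1)) ≤ C / 2 / 2 ^ n := fun n => by
    rw [dist_comm, dist_eq_norm]; exact h n
  obtain ⟨l, hl⟩ := cauchySeq_tendsto_of_complete (cauchySeq_of_le_geometric_two hc)
  refine ⟨l, hl, fun n => ?_⟩
  rw [← dist_eq_norm]
  exact dist_le_of_le_geometric_two_of_tendsto hc hl n

lemma Coefs.continuous_fsum {m : ℕ} {ε : ℝ} {g : P → ℤ × ℤ → ℂ} (hg : Coefs m ε g) (p : P) :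
    Continuous fun q : ℝ × ℝ => fsum g p q.1 q.2 := hg.continuous_tsum p

lemma Coefs.tendsto_fsum {m : ℕ} {ε : ℝ} {g : P → ℤ × ℤ → ℂ} (hg : Coefs m ε g) (p : P)
    {x y : ℕ → ℝ} {a b : ℝ} (hx : Tendsto x atTop (𝓝 a)) (hy : Tendsto y atTop (𝓝 b)) :
    Tendsto (fun n => fsum g p (x n) (y n)) atTop (𝓝 (fsum g p a b)) := by
  have h1 : Tendsto (fun q : ℝ × ℝ => fsum g p q.1 q.2) (𝓝 (a, b)) (𝓝 (fsum g p a b)) :=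
    (hg.continuous_fsum p).continuousAt
  have h2 : Tendsto (fun n => (x n, y n)) atTop (𝓝 (a, b)) := hx.prodMk_nhds hy
  have h3 := h1.comp h2
  simp only [Function.comp_def] at h3
  exact h3

/-- Admissible data of the iteration at truncation order `N`. -/
def IsState (β : P → ℝ) (g₁ g₂ : P → ℤ × ℤ → ℂ) (μ N : ℕ)
    (x : (P → ℂ → ℂ) × (P → ℂ → ℂ) × (P → ℂ → ℂ) × (P → ℂ) × (P → ℂ)) : Prop :=
  Approx β g₁ g₂ N (1 / N) (1 / 8 - 1 / N) ((1 / N) ^ μ) x.1 x.2.1 x.2.2.1 x.2.2.2.1 x.2.2.2.2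

set_option maxHeartbeats 800000 in
/-- Smallness of the perturbation implies the existence of translated invariant curves. -/
theorem exists_translated_curve [FirstCountableTopology P] (s : ℕ) {γ : ℝ} (hγ : 0 < γ) :
    ∃ ε₀ > 0, ∀ {β : P → ℝ} {g₁ g₂ : P → ℤ × ℤ → ℂ}, Continuous β → (∀ p, Dio γ s (β p)) →
    Coefs (4 * (s + 2) + 7) ε₀ g₁ → Coefs (4 * (s + 2) + 7) ε₀ g₂ →
    (∀ p, ∀ x y : ℝ, |y| ≤ 1 / 8 → (1 + fsum (D1 g₁) p x y) * (1 + fsum (D2 g₂) p x y) -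
      fsum (D2 g₁) p x y * fsum (D1 g₂) p x y = 1) →
    ∃ (u v : P → ℝ → ℝ) (Λ₁ Λ₂ : P → ℝ), Continuous Λ₁ ∧ Continuous Λ₂ ∧
      (∀ p, LipschitzWith (1 / 8) (u p)) ∧ (∀ p, LipschitzWith (1 / 8) (v p)) ∧
      (∀ p x, u p (x + 1) = u p x) ∧ (∀ p x, v p (x + 1) = v p x) ∧
      (∀ p x, |u p x| ≤ 1 / 8) ∧ (∀ p x, |v p x| ≤ 1 / 8) ∧
      (∀ p x, u p (x + β p) - u p x = (fsum g₁ p (x + u p x) (v p x)).re + Λ₁ p) ∧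
      (∀ p x, v p (x + β p) - v p x = (fsum g₂ p (x + u p x) (v p x)).re + Λ₂ p) := by
  obtain ⟨t, ht⟩ : ∃ t, t = s + 2 := ⟨_, rfl⟩
  obtain ⟨A, hA⟩ : ∃ A : ℝ, A = 1 + CL γ s := ⟨_, rfl⟩
  obtain ⟨K, hK1, hK2, hK8⟩ : ∃ K : ℝ, 2 * 8 ^ (4 * t + 2) * (79 * A ^ 4 * 16 ^ (4 * t) +
      16 * A * 16 ^ (2 * t) * (1 + zetaTwo) + 1) ≤ K ∧ 8 * A ^ 3 * 16 ^ (3 * t + 2) ≤ K ∧ 8 ≤ K :=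
    ⟨max _ (max _ _), le_max_left _ _, (le_max_left _ _).trans (le_max_right _ _),
      (le_max_right _ _).trans (le_max_right _ _)⟩
  obtain ⟨N₀, hN₀⟩ := exists_nat_ge K
  have hN₀8 : (8 : ℝ) ≤ N₀ := hK8.trans hN₀
  have hN₀' : 0 < N₀ := by
    rcases Nat.eq_zero_or_pos N₀ with h | h
    · rw [h] at hN₀8; norm_num at hN₀8
    · exact h
  have hN₀r : (0 : ℝ) < N₀ := by exact_mod_cast hN₀'
  have hCe := Ce_pos
  have hC1 := one_le_Ce
  refine ⟨(1 / N₀) ^ (4 * t + 2) / (1000 * Ce), by positivity, ?_⟩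
  intro β g₁ g₂ hβ hD hg₁ hg₂ hdet
  rw [← ht] at hg₁ hg₂
  set ε₀ : ℝ := (1 / N₀) ^ (4 * t + 2) / (1000 * Ce) with hε₀
  have hp1 : (1 / (N₀ : ℝ)) ^ (4 * t + 2) ≤ 1 := by
    refine pow_le_one₀ (by positivity) ?_
    rw [div_le_one hN₀r]; linarith
  have hCε : Ce * ε₀ = (1 / N₀) ^ (4 * t + 2) / 1000 := by
    rw [hε₀]; field_simp
  have hCε0 : 0 ≤ Ce * ε₀ := by rw [hCε]; positivity
  have hpi := Real.pi_pos
  have hpi4 := Real.pi_le_four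
  have h1 : Ce * (2 * Real.pi * ε₀) ≤ 1 / 16 := by
    have : Ce * (2 * Real.pi * ε₀) = 2 * Real.pi * (Ce * ε₀) := by ring
    rw [this]
    nlinarith
  have h2 : Ce * (4 * Real.pi ^ 2) * ε₀ ≤ 1 := by
    have : Ce * (4 * Real.pi ^ 2) * ε₀ = 4 * Real.pi ^ 2 * (Ce * ε₀) := by ring
    rw [this]
    nlinarith
  obtain ⟨Ns, hNs⟩ : ∃ Ns : ℕ → ℕ, Ns = fun n => 8 ^ n * N₀ := ⟨_, rfl⟩
  have hNs_pos : ∀ n, 0 < Ns n := fun n => by rw [hNs]; positivity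
  have hNs_succ : ∀ n, Ns (n + 1) = 8 * Ns n := fun n => by rw [hNs]; simp only; ring
  have hNs_ge : ∀ n, N₀ ≤ Ns n := fun n => by
    rw [hNs]; exact Nat.le_mul_of_pos_left _ (by positivity)
  have hstep : ∀ n x, IsState β g₁ g₂ (4 * t + 2) (Ns n) x → ∃ y, IsState β g₁ g₂ (4 * t + 2)
      (Ns (n + 1)) y ∧ (∀ p, ∀ r : ℝ, ‖y.1 p r - x.1 p r‖ ≤ 1 / Ns n) ∧
      (∀ p, ∀ r : ℝ, ‖y.2.1 p r - x.2.1 p r‖ ≤ 1 / Ns n) ∧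
      (∀ p, ‖y.2.2.2.1 p - x.2.2.2.1 p‖ ≤ 1 / Ns n) ∧
      (∀ p, ‖y.2.2.2.2 p - x.2.2.2.2 p‖ ≤ 1 / Ns n) := by
    rintro n ⟨u, v, V, Λ₁, Λ₂⟩ hx
    have hKN : K * (1 / Ns n) ≤ 1 := by
      have : (0 : ℝ) < Ns n := by exact_mod_cast hNs_pos n
      have h3 : (N₀ : ℝ) ≤ Ns n := by exact_mod_cast hNs_ge n
      rw [mul_one_div, div_le_one this]
      linarith
    obtain ⟨u', v', V', Λ₁', Λ₂', h, hu, hv, hl1, hl2⟩ := iteration_step ht hg₁ hg₂ (hNs_pos n) hβ hγ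
      hD hA h1 h2 hdet hK1 hK2 hKN hx
    rw [hNs_succ]
    exact ⟨(u', v', V', Λ₁', Λ₂'), h, hu, hv, hl1, hl2⟩
  have hbegin : IsState β g₁ g₂ (4 * t + 2) (Ns 0)
      (fun _ _ => 0, fun _ _ => 0, fun _ _ => 0, fun _ => 0, fun _ => 0) := by
    have hN0 : Ns 0 = N₀ := by rw [hNs]; simp
    have hκ : (0 : ℝ) ≤ 1 / 8 - 1 / N₀ := by
      rw [sub_nonneg]; exact one_div_le_one_div_of_le (by norm_num) hN₀8
    have hz : Ana (1 / (N₀ : ℝ)) (1 / 8 - 1 / N₀) (fun (_ : P) (_ : ℂ) => (0 : ℂ)) :=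
      Ana.const continuous_const (fun _ => by simpa using hκ) (by simp)
    rw [hN0]
    have hcmp : ∀ {g : P → ℤ × ℤ → ℂ}, Coefs (4 * t + 7) ε₀ g → ∀ p, ∀ z ∈ strip (1 / (N₀ : ℝ)),
        ‖(0 : ℂ) - 0 - cmp g N₀ (fun _ _ => 0) (fun _ _ => 0) p z - 0‖ ≤ (1 / N₀) ^ (4 * t + 2) := by
      intro g hg p z hz
      have hz' : |z.im| < 1 / N₀ := hz
      have h3 : (1 : ℝ) / N₀ ≤ 2 / N₀ := by gcongr; norm_num
      have h4 := hg.norm_trig_le hN₀' p (x := z + 0) (y := 0)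
        (by rw [add_zero]; exact hz'.le.trans h3) (by rw [zero_im, abs_zero]; positivity)
      rw [sub_zero, sub_zero, zero_sub, norm_neg]
      refine h4.trans ?_
      rw [hCε]
      have : 0 ≤ (1 / (N₀ : ℝ)) ^ (4 * t + 2) := by positivity
      linarith
    refine ⟨hz, hz, hz, ?_, ?_, ?_, continuous_const, continuous_const, ?_, ?_, hcmp hg₁, hcmp hg₂⟩
    · simpa using hz
    · simpa using hz
    · simp
    · simp
    · simp
  have hne : Nonempty ((P → ℂ → ℂ) × (P → ℂ → ℂ) × (P → ℂ → ℂ) × (P → ℂ) × (P → ℂ)) :=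
    ⟨(fun _ _ => 0, fun _ _ => 0, fun _ _ => 0, fun _ => 0, fun _ => 0)⟩
  clear hK1 hK2 hK8 hN₀ hp1 hCε hdet
  choose! F hF using hstep
  obtain ⟨X, hX0, hXs⟩ : ∃ X : ℕ → (P → ℂ → ℂ) × (P → ℂ → ℂ) × (P → ℂ → ℂ) × (P → ℂ) × (P → ℂ),
      X 0 = (fun _ _ => 0, fun _ _ => 0, fun _ _ => 0, fun _ => 0, fun _ => 0) ∧
      ∀ n, X (n + 1) = F n (X n) := ⟨fun n => Nat.rec
        (fun _ _ => 0, fun _ _ => 0, fun _ _ => 0, fun _ => 0, fun _ => 0) F n, rfl, fun _ => rfl⟩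
  have hX : ∀ n, IsState β g₁ g₂ (4 * t + 2) (Ns n) (X n) := by
    intro n
    induction n with
    | zero => rw [hX0]; exact hbegin
    | succ n ih => rw [hXs]; exact (hF n _ ih).1
  have hNle : ∀ n, (1 : ℝ) / Ns n ≤ 2 / 2 / 2 ^ n := by
    intro n
    rw [div_self two_ne_zero, hNs]
    push_cast
    have h3 : (2 : ℝ) ^ n ≤ 8 ^ n := by gcongr; norm_num
    refine one_div_le_one_div_of_le (by positivity) (h3.trans ?_)
    exact le_mul_of_one_le_right (by positivity) (by linarith)
  have hcu : ∀ p, ∀ x : ℝ, ∃ l, Tendsto (fun n => (X n).1 p x) atTop (𝓝 l) ∧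
      ∀ n, ‖(X n).1 p x - l‖ ≤ 2 / 2 ^ n := fun p x => exists_lim_of_geometric fun n => by
    rw [hXs]; exact ((hF n _ (hX n)).2.1 p x).trans (hNle n)
  have hcv : ∀ p, ∀ x : ℝ, ∃ l, Tendsto (fun n => (X n).2.1 p x) atTop (𝓝 l) ∧
      ∀ n, ‖(X n).2.1 p x - l‖ ≤ 2 / 2 ^ n := fun p x => exists_lim_of_geometric fun n => by
    rw [hXs]; exact ((hF n _ (hX n)).2.2.1 p x).trans (hNle n)
  have hcl1 : ∀ p, ∃ l, Tendsto (fun n => (X n).2.2.2.1 p) atTop (𝓝 l) ∧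
      ∀ n, ‖(X n).2.2.2.1 p - l‖ ≤ 2 / 2 ^ n := fun p => exists_lim_of_geometric fun n => by
    rw [hXs]; exact ((hF n _ (hX n)).2.2.2.1 p).trans (hNle n)
  have hcl2 : ∀ p, ∃ l, Tendsto (fun n => (X n).2.2.2.2 p) atTop (𝓝 l) ∧
      ∀ n, ‖(X n).2.2.2.2 p - l‖ ≤ 2 / 2 ^ n := fun p => exists_lim_of_geometric fun n => by
    rw [hXs]; exact ((hF n _ (hX n)).2.2.2.2 p).trans (hNle n)
  choose U hU hUn using hcu
  choose V hV hVn using hcv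
  choose L1 hL1 hL1n using hcl1
  choose L2 hL2 hL2n using hcl2
  have hre : ∀ {f : ℕ → ℂ} {l : ℂ}, Tendsto f atTop (𝓝 l) →
      Tendsto (fun n => (f n).re) atTop (𝓝 l.re) := fun h =>
    (Complex.continuous_re.tendsto _).comp h
  have hNpos : ∀ n, (0 : ℝ) < 1 / (Ns n : ℝ) := fun n => by
    have : (0 : ℝ) < Ns n := by exact_mod_cast hNs_pos n
    positivity
  have hmem : ∀ n, ∀ x : ℝ, (x : ℂ) ∈ strip (1 / (Ns n : ℝ)) := fun n x =>
    real_mem_strip (hNpos n) x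
  have hN18 : ∀ n, (1 : ℝ) / 8 - 1 / (Ns n : ℝ) ≤ 1 / 8 := fun n => by linarith [hNpos n]
  have hpow0 : Tendsto (fun n : ℕ => (2 : ℝ) / 2 ^ n) atTop (𝓝 0) := by
    have := (tendsto_pow_atTop_nhds_zero_of_lt_one (r := (1 / 2 : ℝ)) (by norm_num)
      (by norm_num)).const_mul 2
    simpa [div_eq_mul_inv] using this
  have hN0 : Tendsto (fun n => (1 : ℝ) / Ns n) atTop (𝓝 0) :=
    squeeze_zero (fun n => (hNpos n).le) hNle (by simpa [div_right_comm, div_self] using hpow0.div_const 2)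
  have hcont : ∀ {f : ℕ → P → ℂ} {l : P → ℂ}, (∀ n, Continuous (f n)) →
      (∀ p n, ‖f n p - l p‖ ≤ 2 / 2 ^ n) → Continuous fun p => (l p).re := by
    intro f l hf hl
    refine Complex.continuous_re.comp (?_ : Continuous l)
    have : TendstoUniformly f l atTop := by
      rw [Metric.tendstoUniformly_iff]
      intro ε hε
      filter_upwards [hpow0.eventually (gt_mem_nhds hε)] with n hn p
      rw [dist_comm, dist_eq_norm]
      exact (hl p n).trans_lt hn
    exact this.continuous (Frequently.of_forall hf)
  have hlip : ∀ {f : ℕ → ℝ → ℂ} {l : ℝ → ℂ}, (∀ x, Tendsto (fun n => f n x) atTop (𝓝 (l x))) →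
      (∀ n, ∀ x y : ℝ, ‖f n x - f n y‖ ≤ 1 / 8 * ‖(x : ℂ) - y‖) →
      LipschitzWith (1 / 8) fun x => (l x).re := by
    intro f l hf hl
    refine LipschitzWith.of_dist_le_mul fun x y => ?_
    rw [Real.dist_eq, ← sub_re]
    refine (Complex.abs_re_le_norm _).trans ?_
    refine le_of_tendsto ((hf x).sub (hf y)).norm (Eventually.of_forall fun n => (hl n x y).trans ?_)
    rw [← ofReal_sub, norm_real, Real.dist_eq, Real.norm_eq_abs]
    simp
  have heq : ∀ {g : P → ℤ × ℤ → ℂ} {w : ℕ → P → ℂ → ℂ} {l : ℕ → P → ℂ} {W : P → ℝ → ℂ} {L : P → ℂ},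
      Coefs (4 * t + 7) ε₀ g → (∀ p x, Tendsto (fun n => w n p (x : ℝ)) atTop (𝓝 (W p x))) →
      (∀ p, Tendsto (fun n => l n p) atTop (𝓝 (L p))) →
      (∀ n p, ∀ z ∈ strip (1 / (Ns n : ℝ)), ‖w n p (z + β p) - w n p z -
        cmp g (Ns n) (X n).1 (X n).2.1 p z - l n p‖ ≤ (1 / Ns n) ^ (4 * t + 2)) →
      ∀ p x, (W p (x + β p)).re - (W p x).re =
        (fsum g p (x + (U p x).re) (V p x).re).re + (L p).re := by
    intro g w l W L hg hw hl herr p x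
    have t1 := ((hw p (x + β p)).sub (hw p x)).sub (hl p)
    have t2 : Tendsto (fun n => fsum g p (x + ((X n).1 p x).re) ((X n).2.1 p x).re) atTop
        (𝓝 (fsum g p (x + (U p x).re) (V p x).re)) := by
      exact hg.tendsto_fsum p ((hre (hU p x)).const_add x) (hre (hV p x))
    have hcmp : ∀ n, cmp g (Ns n) (X n).1 (X n).2.1 p x =
        trig g (Ns n) p ((x + ((X n).1 p x).re : ℝ) : ℂ) (((X n).2.1 p x).re : ℂ) := by
      intro n
      have hu1 : (X n).1 p x = (((X n).1 p x).re : ℂ) :=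
        Complex.ext rfl (by simp [(hX n).hu.real p x])
      have hv1 : (X n).2.1 p x = (((X n).2.1 p x).re : ℂ) :=
        Complex.ext rfl (by simp [(hX n).hv.real p x])
      rw [cmp, ← hv1, ofReal_add, ← hu1]
    have t3 : Tendsto (fun n => (w n p ((x + β p : ℝ) : ℂ) - w n p x - l n p) -
        fsum g p (x + ((X n).1 p x).re) ((X n).2.1 p x).re) atTop (𝓝 0) := by
      have hN1 : ∀ n, (1 : ℝ) / Ns n ≤ 1 := fun n => by
        have h3 : (1 : ℝ) ≤ Ns n := by exact_mod_cast hNs_pos n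
        rw [div_le_one (by linarith)]; exact h3
      have hε₀0 : 0 ≤ ε₀ := hg.nonneg
      have hb : ∀ n, ‖(w n p ((x + β p : ℝ) : ℂ) - w n p x - l n p) -
          fsum g p (x + ((X n).1 p x).re) ((X n).2.1 p x).re‖ ≤ (1 + ε₀) * (1 / Ns n) := by
        intro n
        have e1 := herr n p x (hmem n x)
        have e2 := hg.norm_tsum_sub_trig_le (hNs_pos n) p (x + ((X n).1 p x).re) ((X n).2.1 p x).re
        rw [← hcmp] at e2
        have e3 : ε₀ / (Ns n : ℝ) ^ (4 * t + 7) = ε₀ * (1 / Ns n) ^ (4 * t + 7) := by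
          rw [div_pow, one_pow]; ring
        have e4 : ∀ j, j ≠ 0 → ((1 : ℝ) / Ns n) ^ j ≤ 1 / Ns n := fun j hj =>
          pow_le_of_le_one (hNpos n).le (hN1 n) hj
        have e5 := mul_le_mul_of_nonneg_left (e4 (4 * t + 7) (by omega)) hε₀0
        have e6 : (w n p ((x + β p : ℝ) : ℂ) - w n p x - l n p) -
            fsum g p (x + ((X n).1 p x).re) ((X n).2.1 p x).re =
            (w n p (x + β p) - w n p x - cmp g (Ns n) (X n).1 (X n).2.1 p x - l n p) -
            (∑' k, g p k * ec2 k ((x + ((X n).1 p x).re : ℝ) : ℂ) (((X n).2.1 p x).re : ℂ) -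
              cmp g (Ns n) (X n).1 (X n).2.1 p x) := by
          rw [fsum]; push_cast; ring
        rw [e6]
        refine (norm_sub_le _ _).trans ((add_le_add e1 e2).trans ?_)
        have := e4 (4 * t + 2) (by omega)
        rw [e3]
        exact (add_le_add this e5).trans (by rw [add_mul, one_mul])
      exact squeeze_zero_norm hb (by simpa using hN0.const_mul (1 + ε₀))
    have := tendsto_nhds_unique (t1.sub t2) t3
    have := congrArg Complex.re this
    simp only [sub_re, zero_re] at this
    linear_combination this
  refine ⟨fun p x => (U p x).re, fun p x => (V p x).re, fun p => (L1 p).re, fun p => (L2 p).re,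
    hcont (fun n => (hX n).cont₁) hL1n, hcont (fun n => (hX n).cont₂) hL2n, fun p => ?_, fun p => ?_,
    fun p x => ?_, fun p x => ?_, fun p x => ?_, fun p x => ?_, ?_, ?_⟩
  · exact hlip (fun x => hU p x) fun n x y => (hX n).hu.lipschitz p
      (fun z hz => ((hX n).du.bound p z hz).trans (hN18 n)) (hmem n y) (hmem n x)
  · exact hlip (fun x => hV p x) fun n x y => (hX n).hv.lipschitz p
      (fun z hz => ((hX n).dv.bound p z hz).trans (hN18 n)) (hmem n y) (hmem n x)
  · refine congrArg Complex.re (tendsto_nhds_unique (hU p (x + 1)) ((hU p x).congr fun n => ?_))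
    push_cast
    exact ((hX n).hu.per p x).symm
  · refine congrArg Complex.re (tendsto_nhds_unique (hV p (x + 1)) ((hV p x).congr fun n => ?_))
    push_cast
    exact ((hX n).hv.per p x).symm
  · exact (Complex.abs_re_le_norm _).trans (le_of_tendsto (hU p x).norm (Eventually.of_forall
      fun n => ((hX n).hu.bound p x (hmem n x)).trans (hN18 n)))
  · exact (Complex.abs_re_le_norm _).trans (le_of_tendsto (hV p x).norm (Eventually.of_forall
      fun n => ((hX n).hv.bound p x (hmem n x)).trans (hN18 n)))
  · exact heq hg₁ hU hL1 fun n => (hX n).err₁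
  · exact heq hg₂ hV hL2 fun n => (hX n).err₂

end HermanKAM

namespace HermanKAM

/-- Rational multiples close to a Diophantine number are uniformly Diophantine. -/
theorem exists_uniform_dio {ρ c : ℝ} {T : ℕ} (hc : 0 < c)
    (H : ∀ q p : ℤ, q ≠ 0 → c / |(q : ℝ)| ^ T ≤ |q * ρ - p|) :
    ∃ γ > 0, ∃ s : ℕ, ∀ (N : ℕ) (a : ℤ), 2 ≤ N → |a - (N : ℤ)| ≤ 1 → Dio γ s (ρ * a / N) := by
  obtain ⟨C, hC1, hCρ⟩ : ∃ C : ℝ, 1 ≤ C ∧ 2 * |ρ| / c ≤ C :=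
    ⟨max 1 _, le_max_left _ _, le_max_right _ _⟩
  refine ⟨c / (2 * (2 ^ T * C ^ (T + 1))), by positivity, T + (T + 1) * (T + 1), ?_⟩
  intro N a hN ha k l hk
  have hNr : (2 : ℝ) ≤ N := by exact_mod_cast hN
  have hk1 : (1 : ℝ) ≤ |(k : ℝ)| := by
    have := Int.one_le_abs hk
    exact_mod_cast this
  have ha' : 1 ≤ a ∧ a ≤ N + 1 := by
    rw [abs_le] at ha; omega
  have ha0 : a ≠ 0 := by omega
  have hkT : 0 < |(k : ℝ)| ^ T := by positivity
  have hlow : c / (2 * (2 ^ T * C ^ (T + 1))) / |(k : ℝ)| ^ (T + (T + 1) * (T + 1)) ≤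
      c / 2 / |(k : ℝ)| ^ T := by
    gcongr
    · have h1 : (1 : ℝ) ≤ 2 ^ T := one_le_pow₀ (by norm_num)
      have h2 : (1 : ℝ) ≤ C ^ (T + 1) := one_le_pow₀ hC1
      nlinarith
    · omega
  by_cases hcase : C * |(k : ℝ)| ^ (T + 1) ≤ N
  · refine hlow.trans ?_
    have h1 := H k l hk
    have h2 : |k * ρ - l| ≤ |k * (ρ * a / N) - l| + |(k : ℝ)| * |ρ| / N := by
      have e : (k : ℝ) * ρ - l = (k * (ρ * a / N) - l) + k * ρ * ((N - a) / N) := by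
        field_simp; ring
      have h3 : |((N : ℝ) - a) / N| ≤ 1 / N := by
        rw [abs_div, abs_of_nonneg (by positivity : (0 : ℝ) ≤ N)]
        gcongr
        rw [abs_sub_comm]
        exact_mod_cast ha
      rw [e]
      refine (abs_add_le _ _).trans ?_
      rw [abs_mul, abs_mul]
      calc _ ≤ |k * (ρ * a / N) - l| + |(k : ℝ)| * |ρ| * (1 / N) := by gcongr
        _ = _ := by ring
    have h4 : |(k : ℝ)| * |ρ| / N ≤ c / 2 / |(k : ℝ)| ^ T := by
      have h5 : 2 * |ρ| ≤ C * c := by rwa [div_le_iff₀ hc] at hCρ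
      rw [div_le_div_iff₀ (by linarith) hkT]
      calc |(k : ℝ)| * |ρ| * |(k : ℝ)| ^ T = (2 * |ρ|) / 2 * |(k : ℝ)| ^ (T + 1) := by ring
        _ ≤ (C * c) / 2 * |(k : ℝ)| ^ (T + 1) := by gcongr
        _ = c / 2 * (C * |(k : ℝ)| ^ (T + 1)) := by ring
        _ ≤ _ := by gcongr
    have h6 : c / |(k : ℝ)| ^ T = c / 2 / |(k : ℝ)| ^ T + c / 2 / |(k : ℝ)| ^ T := by ring
    linarith
  · push Not at hcase
    have h1 := H (k * a) (l * N) (mul_ne_zero hk ha0)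
    have e : (k : ℝ) * (ρ * a / N) - l = (((k * a : ℤ) : ℝ) * ρ - ((l * N : ℤ) : ℝ)) / N := by
      push_cast; field_simp
    rw [e, abs_div, abs_of_nonneg (by positivity : (0 : ℝ) ≤ N), le_div_iff₀ (by linarith)]
    refine le_trans ?_ h1
    have h2 : |((k * a : ℤ) : ℝ)| ≤ |(k : ℝ)| * (2 * N) := by
      push_cast
      rw [abs_mul]
      gcongr
      rw [abs_of_nonneg (by exact_mod_cast (by omega : 0 ≤ a))]
      have : (a : ℝ) ≤ N + 1 := by exact_mod_cast ha'.2
      linarith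
    have h3 : 0 < |((k * a : ℤ) : ℝ)| := by
      rw [abs_pos]; exact_mod_cast mul_ne_zero hk ha0
    calc c / (2 * (2 ^ T * C ^ (T + 1))) / |(k : ℝ)| ^ (T + (T + 1) * (T + 1)) * N
        ≤ c / (|(k : ℝ)| * (2 * N)) ^ T := by
          rw [div_div, div_mul_eq_mul_div, div_le_div_iff₀ (by positivity) (by positivity)]
          calc c * N * (|(k : ℝ)| * (2 * N)) ^ T = c * |(k : ℝ)| ^ T * 2 ^ T * (N : ℝ) ^ (T + 1) := by
                ring
            _ ≤ c * |(k : ℝ)| ^ T * 2 ^ T * (C * |(k : ℝ)| ^ (T + 1)) ^ (T + 1) := by gcongr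
            _ = c * (2 ^ T * C ^ (T + 1) * |(k : ℝ)| ^ (T + (T + 1) * (T + 1))) := by ring
            _ ≤ c * (2 * (2 ^ T * C ^ (T + 1)) * |(k : ℝ)| ^ (T + (T + 1) * (T + 1))) := by
              have : 0 ≤ 2 ^ T * C ^ (T + 1) := by positivity
              refine mul_le_mul_of_nonneg_left (mul_le_mul_of_nonneg_right ?_ (by positivity)) hc.le
              linarith
      _ ≤ _ := by gcongr

/-- Diophantine conditions in terms of quotients and real exponents. -/
lemma exists_pow_dio {ρ : ℝ} (h : ∃ c > (0 : ℝ), ∃ τ > (0 : ℝ), ∀ p q : ℤ, q ≠ 0 →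
      c / |(q : ℝ)| ^ ((2 : ℝ) + τ) ≤ |ρ - p / q|) :
    ∃ c > (0 : ℝ), ∃ T : ℕ, ∀ q p : ℤ, q ≠ 0 → c / |(q : ℝ)| ^ T ≤ |q * ρ - p| := by
  obtain ⟨c, hc, τ, hτ, h⟩ := h
  obtain ⟨T, hT⟩ := exists_nat_ge (2 + τ)
  refine ⟨c, hc, T, fun q p hq => ?_⟩
  have hq1 : (1 : ℝ) ≤ |(q : ℝ)| := by
    have := Int.one_le_abs hq
    exact_mod_cast this
  have hq0 : (q : ℝ) ≠ 0 := by exact_mod_cast hq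
  have e : (q : ℝ) * ρ - p = q * (ρ - p / q) := by field_simp
  rw [e, abs_mul]
  calc c / |(q : ℝ)| ^ T ≤ c / |(q : ℝ)| ^ ((2 : ℝ) + τ) := by
        have : |(q : ℝ)| ^ ((2 : ℝ) + τ) ≤ |(q : ℝ)| ^ T := by
          rw [← Real.rpow_natCast]
          exact Real.rpow_le_rpow_of_exponent_le hq1 hT
        gcongr
    _ ≤ |ρ - p / q| := h p q hq
    _ ≤ |(q : ℝ)| * |ρ - p / q| := le_mul_of_one_le_left (abs_nonneg _) hq1

end HermanKAM

namespace HermanKAM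

open Complex Set Filter Topology

/-- Smooth one-parameter families of functions on the two-torus. -/
structure TorusFamily (F : ℝ × ℝ × ℝ → ℂ) : Prop where
  smooth : ContDiff ℝ (⊤ : ℕ∞) F
  perx : ∀ c x y, F (c, x + 1, y) = F (c, x, y)
  pery : ∀ c x y, F (c, x, y + 1) = F (c, x, y)

/-- Partial derivative in the first angle. -/
noncomputable def partialX (F : ℝ × ℝ × ℝ → ℂ) (z : ℝ × ℝ × ℝ) : ℂ := fderiv ℝ F z (0, 1, 0)

/-- Partial derivative in the second angle. -/
noncomputable def partialY (F : ℝ × ℝ × ℝ → ℂ) (z : ℝ × ℝ × ℝ) : ℂ := fderiv ℝ F z (0, 0, 1)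

/-- Fourier coefficients of a family of functions on the two-torus. -/
noncomputable def coef2 (F : ℝ × ℝ × ℝ → ℂ) (c : ℝ) (k : ℤ × ℤ) : ℂ :=
  ∫ y in (0 : ℝ)..1, (∫ x in (0 : ℝ)..1, F (c, x, y) * ec (-(k.1 * x))) * ec (-(k.2 * y))

lemma integral_deriv_mul_ec {h h' : ℝ → ℂ} (hd : ∀ x, HasDerivAt h (h' x) x)
    (hc : Continuous h') (hp : h 1 = h 0) (k : ℤ) :
    ∫ x in (0 : ℝ)..1, h' x * ec (-(k * x)) =
      2 * Real.pi * I * k * ∫ x in (0 : ℝ)..1, h x * ec (-(k * x)) := by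
  have he : ∀ x : ℝ, HasDerivAt (fun x : ℝ => ec (-(k * x)))
      (-(2 * Real.pi * I * k) * ec (-(k * x))) x := by
    intro x
    have h1 : HasDerivAt (fun x : ℝ => -((k : ℂ) * x)) (-((k : ℂ) * 1)) x :=
      ((HasDerivAt.ofReal_comp (hasDerivAt_id x)).const_mul (k : ℂ)).neg
    have h2 := (hasDerivAt_ec (-((k : ℂ) * x))).comp x h1
    have e : (2 * Real.pi * I * ec (-((k : ℂ) * x))) * -((k : ℂ) * 1) =
      -(2 * Real.pi * I * k) * ec (-(k * x)) := by ring
    rwa [e] at h2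
  have hcont : Continuous h := continuous_iff_continuousAt.2 fun x => (hd x).continuousAt
  have hec : Continuous fun x : ℝ => ec (-(k * x)) :=
    continuous_iff_continuousAt.2 fun x => (he x).continuousAt
  have := intervalIntegral.integral_mul_deriv_eq_deriv_mul (a := 0) (b := 1)
    (fun x _ => he x) (fun x _ => hd x)
    ((continuous_const.mul hec).intervalIntegrable _ _) (hc.intervalIntegrable _ _)
  have h0 : ec (-((k : ℂ) * (1 : ℝ))) = 1 := by
    have := ec_int (-k)
    push_cast at this ⊢
    simpa using this
  have h00 : ec (-((k : ℂ) * (0 : ℝ))) = 1 := by simp [ec_zero]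
  rw [h0, h00, hp, sub_self, zero_sub, ← intervalIntegral.integral_neg] at this
  simp_rw [mul_comm (h' _)]
  rw [this, ← intervalIntegral.integral_const_mul]
  congr 1
  ext x
  ring

lemma norm_intervalIntegral_mul_ec_le {h : ℝ → ℂ} {C : ℝ} (hC : ∀ x ∈ Icc (0 : ℝ) 1, ‖h x‖ ≤ C)
    (k : ℤ) : ‖∫ x in (0 : ℝ)..1, h x * ec (-(k * x))‖ ≤ C := by
  have := intervalIntegral.norm_integral_le_of_norm_le_const (a := (0 : ℝ)) (b := 1)
    (f := fun x : ℝ => h x * ec (-(k * x))) (C := C) fun x hx => by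
      rw [uIoc_of_le zero_le_one] at hx
      rw [norm_mul, norm_ec]
      simpa using hC x ⟨hx.1.le, hx.2⟩
  simpa using this

namespace TorusFamily

variable {F : ℝ × ℝ × ℝ → ℂ}

lemma continuous (h : TorusFamily F) : Continuous F := h.smooth.continuous

lemma hasFDerivAt (h : TorusFamily F) (z : ℝ × ℝ × ℝ) : HasFDerivAt F (fderiv ℝ F z) z :=
  (h.smooth.differentiable (by simp) z).hasFDerivAt

lemma fderiv_perx (h : TorusFamily F) (c x y : ℝ) :
    fderiv ℝ F (c, x + 1, y) = fderiv ℝ F (c, x, y) := by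
  have h1 : (fun z : ℝ × ℝ × ℝ => F (z + (0, 1, 0))) = F := by
    ext ⟨c, x, y⟩
    simpa using h.perx c x y
  have := fderiv_comp_add_right (𝕜 := ℝ) (f := F) (x := (c, x, y)) (0, 1, 0)
  rw [h1] at this
  simpa using this.symm

lemma fderiv_pery (h : TorusFamily F) (c x y : ℝ) :
    fderiv ℝ F (c, x, y + 1) = fderiv ℝ F (c, x, y) := by
  have h1 : (fun z : ℝ × ℝ × ℝ => F (z + (0, 0, 1))) = F := by
    ext ⟨c, x, y⟩
    simpa using h.pery c x y
  have := fderiv_comp_add_right (𝕜 := ℝ) (f := F) (x := (c, x, y)) (0, 0, 1)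
  rw [h1] at this
  simpa using this.symm

lemma partialX (h : TorusFamily F) : TorusFamily (HermanKAM.partialX F) where
  smooth := (h.smooth.fderiv_right (m := (⊤ : ℕ∞)) (by simp)).clm_apply contDiff_const
  perx c x y := by simp only [HermanKAM.partialX, h.fderiv_perx]
  pery c x y := by simp only [HermanKAM.partialX, h.fderiv_pery]

lemma partialY (h : TorusFamily F) : TorusFamily (HermanKAM.partialY F) where
  smooth := (h.smooth.fderiv_right (m := (⊤ : ℕ∞)) (by simp)).clm_apply contDiff_const
  perx c x y := by simp only [HermanKAM.partialY, h.fderiv_perx]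
  pery c x y := by simp only [HermanKAM.partialY, h.fderiv_pery]

lemma hasDerivAt_x (h : TorusFamily F) (c x y : ℝ) :
    HasDerivAt (fun x => F (c, x, y)) (HermanKAM.partialX F (c, x, y)) x := by
  have h1 : HasDerivAt (fun x : ℝ => ((c, x, y) : ℝ × ℝ × ℝ)) (0, 1, 0) x :=
    (hasDerivAt_const x c).prodMk ((hasDerivAt_id x).prodMk (hasDerivAt_const x y))
  exact (h.hasFDerivAt (c, x, y)).comp_hasDerivAt x h1

lemma hasDerivAt_y (h : TorusFamily F) (c x y : ℝ) :
    HasDerivAt (fun y => F (c, x, y)) (HermanKAM.partialY F (c, x, y)) y := by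
  have h1 : HasDerivAt (fun y : ℝ => ((c, x, y) : ℝ × ℝ × ℝ)) (0, 0, 1) y :=
    (hasDerivAt_const y c).prodMk ((hasDerivAt_const y x).prodMk (hasDerivAt_id y))
  exact (h.hasFDerivAt (c, x, y)).comp_hasDerivAt y h1

lemma partialX_zero (h : TorusFamily F) (h0 : ∀ x y, F (0, x, y) = 0) (x y : ℝ) :
    HermanKAM.partialX F (0, x, y) = 0 := by
  have h1 := h.hasDerivAt_x 0 x y
  simp only [h0] at h1
  exact h1.unique (hasDerivAt_const x 0)

lemma partialY_zero (h : TorusFamily F) (h0 : ∀ x y, F (0, x, y) = 0) (x y : ℝ) :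
    HermanKAM.partialY F (0, x, y) = 0 := by
  have h1 := h.hasDerivAt_y 0 x y
  simp only [h0] at h1
  exact h1.unique (hasDerivAt_const y 0)

lemma coef2_swap (h : TorusFamily F) (c : ℝ) (k : ℤ × ℤ) :
    coef2 F c k = ∫ x in (0 : ℝ)..1, (∫ y in (0 : ℝ)..1, F (c, x, y) * ec (-(k.2 * y))) *
      ec (-(k.1 * x)) := by
  have hF := h.continuous
  have he := continuous_ec
  unfold coef2
  simp_rw [← intervalIntegral.integral_mul_const]
  rw [intervalIntegral_intervalIntegral_swap]
  · simp_rw [mul_right_comm]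
  · refine (Continuous.continuousOn ?_).integrableOn_compact
      (isCompact_uIcc.prod isCompact_uIcc) |>.mono_set
      (prod_mono uIoc_subset_uIcc uIoc_subset_uIcc)
    simp only [Function.uncurry_def]
    fun_prop

lemma coef2_partialX (h : TorusFamily F) (c : ℝ) (k : ℤ × ℤ) :
    coef2 (HermanKAM.partialX F) c k = 2 * Real.pi * I * k.1 * coef2 F c k := by
  have hF := h.partialX.continuous
  unfold coef2
  rw [← intervalIntegral.integral_const_mul]
  refine intervalIntegral.integral_congr fun y _ => ?_
  rw [integral_deriv_mul_ec (h := fun x => F (c, x, y)) (fun x => h.hasDerivAt_x c x y)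
    (by fun_prop) (by simpa using h.perx c 0 y)]
  ring

lemma coef2_partialY (h : TorusFamily F) (c : ℝ) (k : ℤ × ℤ) :
    coef2 (HermanKAM.partialY F) c k = 2 * Real.pi * I * k.2 * coef2 F c k := by
  have hF := h.partialY.continuous
  rw [h.coef2_swap, h.partialY.coef2_swap, ← intervalIntegral.integral_const_mul]
  refine intervalIntegral.integral_congr fun x _ => ?_
  rw [integral_deriv_mul_ec (h := fun y => F (c, x, y)) (fun y => h.hasDerivAt_y c x y)
    (by fun_prop) (by simpa using h.pery c x 0)]
  ring

lemma norm_coef2_le {C : ℝ} {c : ℝ}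
    (hC : ∀ x ∈ Icc (0 : ℝ) 1, ∀ y ∈ Icc (0 : ℝ) 1, ‖F (c, x, y)‖ ≤ C) (k : ℤ × ℤ) :
    ‖coef2 F c k‖ ≤ C :=
  norm_intervalIntegral_mul_ec_le (fun y hy =>
    norm_intervalIntegral_mul_ec_le (fun x hx => hC x hx y hy) k.1) k.2

lemma continuous_coef2 (h : TorusFamily F) (k : ℤ × ℤ) : Continuous fun c => coef2 F c k := by
  have hF := h.continuous
  have he := continuous_ec
  unfold coef2
  fun_prop

lemma coef2_neg (hr : ∀ z, (starRingEnd ℂ) (F z) = F z) (c : ℝ) (k : ℤ × ℤ) :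
    coef2 F c (-k) = (starRingEnd ℂ) (coef2 F c k) := by
  unfold coef2
  simp only [intervalIntegral.integral_of_le zero_le_one]
  rw [← integral_conj]
  congr 1
  ext y
  rw [map_mul, ← integral_conj]
  simp [map_mul, conj_ec, hr]

lemma iterX (h : TorusFamily F) (n : ℕ) : TorusFamily (HermanKAM.partialX^[n] F) := by
  induction n with
  | zero => exact h
  | succ n ih => rw [Function.iterate_succ_apply']; exact ih.partialX

lemma iterY (h : TorusFamily F) (n : ℕ) : TorusFamily (HermanKAM.partialY^[n] F) := by
  induction n with
  | zero => exact h
  | succ n ih => rw [Function.iterate_succ_apply']; exact ih.partialY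

lemma coef2_iterX (h : TorusFamily F) (n : ℕ) (c : ℝ) (k : ℤ × ℤ) :
    coef2 (HermanKAM.partialX^[n] F) c k = (2 * Real.pi * I * k.1) ^ n * coef2 F c k := by
  induction n with
  | zero => simp
  | succ n ih =>
    rw [Function.iterate_succ_apply', (h.iterX n).coef2_partialX, ih]
    ring

lemma coef2_iterY (h : TorusFamily F) (n : ℕ) (c : ℝ) (k : ℤ × ℤ) :
    coef2 (HermanKAM.partialY^[n] F) c k = (2 * Real.pi * I * k.2) ^ n * coef2 F c k := by
  induction n with
  | zero => simp
  | succ n ih =>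
    rw [Function.iterate_succ_apply', (h.iterY n).coef2_partialY, ih]
    ring

lemma iterX_zero (h : TorusFamily F) (h0 : ∀ x y, F (0, x, y) = 0) (n : ℕ) :
    ∀ x y, HermanKAM.partialX^[n] F (0, x, y) = 0 := by
  induction n with
  | zero => exact h0
  | succ n ih => rw [Function.iterate_succ_apply']; exact (h.iterX n).partialX_zero ih

lemma iterY_zero (h : TorusFamily F) (h0 : ∀ x y, F (0, x, y) = 0) (n : ℕ) :
    ∀ x y, HermanKAM.partialY^[n] F (0, x, y) = 0 := by
  induction n with
  | zero => exact h0
  | succ n ih => rw [Function.iterate_succ_apply']; exact (h.iterY n).partialY_zero ih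

lemma eventually_small (h : TorusFamily F) (h0 : ∀ x y, F (0, x, y) = 0) {η : ℝ} (hη : 0 < η) :
    ∀ᶠ c in 𝓝 (0 : ℝ), ∀ x ∈ Icc (0 : ℝ) 1, ∀ y ∈ Icc (0 : ℝ) 1, ‖F (c, x, y)‖ ≤ η := by
  have hF := h.continuous
  have hK : IsCompact (Icc (0 : ℝ) 1 ×ˢ Icc (0 : ℝ) 1) := isCompact_Icc.prod isCompact_Icc
  have : ∀ᶠ c in 𝓝 (0 : ℝ), ∀ q ∈ Icc (0 : ℝ) 1 ×ˢ Icc (0 : ℝ) 1, ‖F (c, q.1, q.2)‖ < η := by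
    refine hK.eventually_forall_of_forall_eventually fun q _ => ?_
    have hc : Continuous fun z : ℝ × ℝ × ℝ => ‖F (z.1, z.2.1, z.2.2)‖ := by fun_prop
    exact hc.continuousAt.eventually_lt continuousAt_const (by simpa [h0] using hη)
  filter_upwards [this] with c hc x hx y hy using (hc (x, y) ⟨hx, hy⟩).le

end TorusFamily

/-- A summable weight on `ℤ × ℤ`. -/
noncomputable def dec (k : ℤ × ℤ) : ℝ :=
  1 / (1 + |(k.1 : ℝ)|) ^ 2 * (1 / (1 + |(k.2 : ℝ)|) ^ 2)

lemma summable_one_div_one_add_abs_sq : Summable fun k : ℤ => 1 / (1 + |(k : ℝ)|) ^ 2 := by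
  have h : Summable fun n : ℕ => 1 / (1 + (n : ℝ)) ^ 2 := by
    have := (summable_nat_add_iff 1).2 (Real.summable_one_div_nat_pow.2 one_lt_two)
    refine this.congr fun n => ?_
    push_cast
    ring
  refine Summable.of_nat_of_neg ?_ ?_ <;> simpa using h

lemma dec_nonneg (k : ℤ × ℤ) : 0 ≤ dec k := by unfold dec; positivity

lemma summable_dec : Summable dec :=
  summable_one_div_one_add_abs_sq.mul_of_nonneg summable_one_div_one_add_abs_sq
    (fun _ => by positivity) (fun _ => by positivity)

lemma tsum_dec_pos : 0 < ∑' k, dec k :=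
  summable_dec.tsum_pos dec_nonneg 0 (by simp [dec])

lemma one_le_dec_mul_wt (k : ℤ × ℤ) : 1 ≤ dec k * wt k ^ 4 := by
  have h1 := abs_nonneg (k.1 : ℝ)
  have h2 := abs_nonneg (k.2 : ℝ)
  unfold dec wt
  rw [div_mul_div_comm, one_mul, div_mul_eq_mul_div, one_mul, one_le_div (by positivity),
    ← mul_pow]
  calc ((1 + |(k.1 : ℝ)|) * (1 + |(k.2 : ℝ)|)) ^ 2
      ≤ ((1 + |(k.1 : ℝ)| + |(k.2 : ℝ)|) ^ 2) ^ 2 := by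
        gcongr
        nlinarith [mul_nonneg h1 h2]
    _ = _ := by ring

lemma wt_pow_le (k : ℤ × ℤ) (M : ℕ) :
    wt k ^ M ≤ 3 ^ M * (1 + |(k.1 : ℝ)| ^ M + |(k.2 : ℝ)| ^ M) := by
  have h1 := abs_nonneg (k.1 : ℝ)
  have h2 := abs_nonneg (k.2 : ℝ)
  set t := max 1 (max |(k.1 : ℝ)| |(k.2 : ℝ)|) with ht
  have h3 : wt k ≤ 3 * t := by
    have := le_max_left 1 (max |(k.1 : ℝ)| |(k.2 : ℝ)|)
    have := (le_max_left |(k.1 : ℝ)| |(k.2 : ℝ)|).trans (le_max_right 1 _)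
    have := (le_max_right |(k.1 : ℝ)| |(k.2 : ℝ)|).trans (le_max_right 1 _)
    unfold wt
    linarith
  have h4 : t ^ M ≤ 1 + |(k.1 : ℝ)| ^ M + |(k.2 : ℝ)| ^ M := by
    have := pow_nonneg h1 M
    have := pow_nonneg h2 M
    rcases max_choice 1 (max |(k.1 : ℝ)| |(k.2 : ℝ)|) with h | h
    · rw [ht, h, one_pow]; linarith
    · rw [ht, h]
      rcases max_choice |(k.1 : ℝ)| |(k.2 : ℝ)| with h | h <;> rw [h] <;> linarith
  calc wt k ^ M ≤ (3 * t) ^ M := by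
        have := one_le_wt k
        gcongr
    _ = 3 ^ M * t ^ M := by ring
    _ ≤ _ := by gcongr

namespace TorusFamily

variable {F : ℝ × ℝ × ℝ → ℂ}

lemma wt_mul_norm_coef2_le (h : TorusFamily F) {η c : ℝ} {M : ℕ}
    (h0 : ∀ x ∈ Icc (0 : ℝ) 1, ∀ y ∈ Icc (0 : ℝ) 1, ‖F (c, x, y)‖ ≤ η)
    (hX : ∀ x ∈ Icc (0 : ℝ) 1, ∀ y ∈ Icc (0 : ℝ) 1, ‖HermanKAM.partialX^[M] F (c, x, y)‖ ≤ η)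
    (hY : ∀ x ∈ Icc (0 : ℝ) 1, ∀ y ∈ Icc (0 : ℝ) 1, ‖HermanKAM.partialY^[M] F (c, x, y)‖ ≤ η)
    (k : ℤ × ℤ) : ‖coef2 F c k‖ * wt k ^ M ≤ 3 ^ (M + 1) * η := by
  have h1 := norm_coef2_le h0 k
  have h2 := norm_coef2_le hX k
  have h3 := norm_coef2_le hY k
  rw [h.coef2_iterX, norm_mul, norm_pow, norm_two_pi_I_mul_int, mul_pow] at h2
  rw [h.coef2_iterY, norm_mul, norm_pow, norm_two_pi_I_mul_int, mul_pow] at h3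
  have hpi : 1 ≤ (2 * Real.pi) ^ M := one_le_pow₀ (by linarith [Real.pi_gt_three])
  have h4 : |(k.1 : ℝ)| ^ M * ‖coef2 F c k‖ ≤ η := by
    refine le_trans ?_ h2
    rw [mul_assoc]
    exact le_mul_of_one_le_left (by positivity) hpi
  have h5 : |(k.2 : ℝ)| ^ M * ‖coef2 F c k‖ ≤ η := by
    refine le_trans ?_ h3
    rw [mul_assoc]
    exact le_mul_of_one_le_left (by positivity) hpi
  calc ‖coef2 F c k‖ * wt k ^ M
      ≤ ‖coef2 F c k‖ * (3 ^ M * (1 + |(k.1 : ℝ)| ^ M + |(k.2 : ℝ)| ^ M)) := by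
        gcongr
        exact wt_pow_le k M
    _ = 3 ^ M * (‖coef2 F c k‖ + |(k.1 : ℝ)| ^ M * ‖coef2 F c k‖ +
        |(k.2 : ℝ)| ^ M * ‖coef2 F c k‖) := by ring
    _ ≤ 3 ^ M * (η + η + η) := by gcongr
    _ = _ := by ring

/-- The coefficients of a family vanishing at `c = 0` are small for small `c`. -/
lemma exists_coefs (h : TorusFamily F) (hr : ∀ z, (starRingEnd ℂ) (F z) = F z)
    (h0 : ∀ x y, F (0, x, y) = 0) (m : ℕ) {ε : ℝ} (hε : 0 < ε) :
    ∀ᶠ c₁ in 𝓝[>] (0 : ℝ), ∀ {P : Type} [TopologicalSpace P] {σ : P → ℝ}, Continuous σ →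
      (∀ p, |σ p| ≤ c₁) → Coefs m ε (fun p => coef2 F (σ p)) := by
  set η := ε / (3 ^ (m + 5) * ∑' k, dec k) with hη
  have hS := tsum_dec_pos
  have hηpos : 0 < η := by positivity
  obtain ⟨r, hr0, hball⟩ := Metric.eventually_nhds_iff.1 ((h.eventually_small h0 hηpos).and
    (((h.iterX (m + 4)).eventually_small (h.iterX_zero h0 _) hηpos).and
      ((h.iterY (m + 4)).eventually_small (h.iterY_zero h0 _) hηpos)))
  filter_upwards [Ioo_mem_nhdsGT hr0] with c₁ hc₁ P _ σ hσ hσc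
  refine ⟨fun k => (h.continuous_coef2 k).comp hσ, fun p k => coef2_neg hr _ k,
    fun k => 3 ^ (m + 5) * η * dec k, ?_, fun k => ?_, fun p k => ?_⟩
  · have hsum := summable_dec.hasSum.mul_left (3 ^ (m + 5) * η)
    have e : 3 ^ (m + 5) * η * ∑' k, dec k = ε := by
      rw [hη]
      field_simp
    rwa [e] at hsum
  · have := dec_nonneg k
    positivity
  · obtain ⟨e1, e2, e3⟩ := hball (y := σ p) (by simpa using (hσc p).trans_lt hc₁.2)
    have := h.wt_mul_norm_coef2_le e1 e2 e3 k
    have hw : 0 < wt k := one_pos.trans_le (one_le_wt k)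
    calc ‖coef2 F (σ p) k‖ * wt k ^ m
        ≤ ‖coef2 F (σ p) k‖ * wt k ^ m * (dec k * wt k ^ 4) :=
          le_mul_of_one_le_right (by positivity) (one_le_dec_mul_wt k)
      _ = ‖coef2 F (σ p) k‖ * wt k ^ (m + 4) * dec k := by ring
      _ ≤ 3 ^ (m + 5) * η * dec k := by
          gcongr
          exact dec_nonneg k

/-- Fourier inversion on the two-torus. -/
lemma hasSum_coef2 (h : TorusFamily F) {c : ℝ} (hs : Summable fun k => ‖coef2 F c k‖) (x y : ℝ) :
    HasSum (fun k : ℤ × ℤ => coef2 F c k * ec2 k x y) (F (c, x, y)) := by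
  have hF := h.continuous
  have he := continuous_ec
  set a : ℝ → ℤ → ℂ := fun y k => ∫ x in (0 : ℝ)..1, F (c, x, y) * ec (-(k * x)) with ha
  have hac : ∀ k, Continuous fun y => a y k := by
    intro k
    simp only [ha]
    fun_prop
  have hap : ∀ k, Function.Periodic (fun y => a y k) 1 := by
    intro k y
    simp only [ha, h.pery]
  have hcoef : ∀ k l : ℤ, coef2 F c (k, l) = ∫ y in (0 : ℝ)..1, a y k * ec (-(l * y)) :=
    fun k l => rfl
  have hrow : ∀ k : ℤ, Summable fun l : ℤ => coef2 F c (k, l) := fun k =>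
    (hs.prod_factor k).of_norm
  have hA : ∀ k : ℤ, HasSum (fun l : ℤ => coef2 F c (k, l) * ec (l * y)) (a y k) := fun k =>
    hasSum_fourier_real (hac k) (hap k) (hrow k) y
  have hnorm : Summable fun k : ℤ × ℤ => ‖coef2 F c k * ec2 k x y‖ := by
    refine hs.congr fun k => ?_
    rw [norm_mul, norm_ec2_real, mul_one]
  have hasum : Summable fun k : ℤ => a y k := by
    have h1 : Summable fun k : ℤ × ℤ => ‖coef2 F c k * ec (k.2 * y)‖ := by
      refine hs.congr fun k => ?_
      rw [norm_mul, norm_ec]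
      simp
    have h2 := h1.of_norm.prod
    refine h2.congr fun k => ?_
    exact (hA k).tsum_eq
  have hB : HasSum (fun k : ℤ => a y k * ec (k * x)) (F (c, x, y)) :=
    hasSum_fourier_real (h := fun x => F (c, x, y)) (by fun_prop) (fun x => h.perx c x y)
      hasum x
  have hsum := hnorm.of_norm
  have h3 : HasSum (fun k : ℤ => a y k * ec (k * x)) (∑' k : ℤ × ℤ, coef2 F c k * ec2 k x y) := by
    refine hsum.hasSum.prod_fiberwise fun k => ?_
    have h4 := (hA k).mul_right (ec (k * x))
    refine h4.congr_fun fun l => ?_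
    simp only [ec2, ec_add]
    ring
  rw [hB.unique h3]
  exact hsum.hasSum

end TorusFamily

lemma fsum_coef2 {P : Type} {F : ℝ × ℝ × ℝ → ℂ} (h : TorusFamily F) {σ : P → ℝ} {p : P}
    (hs : Summable fun k => ‖coef2 F (σ p) k‖) (x y : ℝ) :
    fsum (fun p => coef2 F (σ p)) p x y = F (σ p, x, y) :=
  (h.hasSum_coef2 hs x y).tsum_eq

lemma D1_coef2 {P : Type} {F : ℝ × ℝ × ℝ → ℂ} (h : TorusFamily F) (σ : P → ℝ) :
    D1 (fun p => coef2 F (σ p)) = fun p => coef2 (partialX F) (σ p) := by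
  ext p k
  rw [D1, h.coef2_partialX]

lemma D2_coef2 {P : Type} {F : ℝ × ℝ × ℝ → ℂ} (h : TorusFamily F) (σ : P → ℝ) :
    D2 (fun p => coef2 F (σ p)) = fun p => coef2 (partialY F) (σ p) := by
  ext p k
  rw [D2, h.coef2_partialY]

end HermanKAM

namespace HermanKAM

open Complex Set Filter Topology

section ParametricIntegral

universe w

variable {E : Type w} [NormedAddCommGroup E] [NormedSpace ℝ E] [FiniteDimensional ℝ E]

lemma hasFDerivAt_integral_unit {V : Type w} [NormedAddCommGroup V] [NormedSpace ℝ V]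
    [CompleteSpace V] {K : E × ℝ → V} (hK : ContDiff ℝ 1 K) (e : E) :
    HasFDerivAt (fun e => ∫ t in (0 : ℝ)..1, K (e, t))
      (∫ t in (0 : ℝ)..1, (fderiv ℝ K (e, t)).comp (ContinuousLinearMap.inl ℝ E ℝ)) e := by
  have : ProperSpace E := FiniteDimensional.proper ℝ E
  have hK0 := hK.continuous
  have hK1 : Continuous (fderiv ℝ K) := hK.continuous_fderiv (by simp)
  have hK2 : Continuous fun z : E × ℝ => (fderiv ℝ K z).comp (ContinuousLinearMap.inl ℝ E ℝ) := by
    fun_prop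
  obtain ⟨C, hC⟩ := ((isCompact_closedBall e 1).prod (isCompact_Icc (a := (0 : ℝ)) (b := 1))
    ).exists_bound_of_continuousOn hK2.continuousOn
  refine intervalIntegral.hasFDerivAt_integral_of_dominated_of_fderiv_le (𝕜 := ℝ)
    (F := fun e t => K (e, t))
    (F' := fun e t => (fderiv ℝ K (e, t)).comp (ContinuousLinearMap.inl ℝ E ℝ))
    (bound := fun _ => C)
    (Metric.closedBall_mem_nhds e one_pos) ?_ ?_ ?_ ?_ ?_ ?_
  · exact Eventually.of_forall fun e =>
      (hK0.comp (by fun_prop : Continuous fun t : ℝ => (e, t))).aestronglyMeasurable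
  · exact (hK0.comp (by fun_prop : Continuous fun t : ℝ => (e, t))).intervalIntegrable _ _
  · exact (hK2.comp (by fun_prop : Continuous fun t : ℝ => (e, t))).aestronglyMeasurable
  · refine Eventually.of_forall fun t ht e' he' => hC (e', t) ⟨he', ?_⟩
    rw [uIoc_of_le zero_le_one] at ht
    exact ⟨ht.1.le, ht.2⟩
  · exact intervalIntegrable_const
  · refine Eventually.of_forall fun t _ e' _ => ?_
    exact ((hK.differentiable (by simp) (e', t)).hasFDerivAt).comp e'
      (hasFDerivAt_prodMk_left e' t)

lemma contDiff_integral_unit_nat (n : ℕ) : ∀ {V : Type w} [NormedAddCommGroup V] [NormedSpace ℝ V]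
    [CompleteSpace V] {K : E × ℝ → V}, ContDiff ℝ (⊤ : ℕ∞) K →
      ContDiff ℝ n fun e => ∫ t in (0 : ℝ)..1, K (e, t) := by
  induction n with
  | zero =>
    intro V _ _ _ K hK
    have := hK.continuous
    refine contDiff_zero.2 ?_
    fun_prop
  | succ n ih =>
    intro V _ _ _ K hK
    have h1 : ContDiff ℝ (⊤ : ℕ∞) fun z : E × ℝ =>
        (fderiv ℝ K z).comp (ContinuousLinearMap.inl ℝ E ℝ) :=
      (hK.fderiv_right (m := (⊤ : ℕ∞)) (by simp)).clm_comp contDiff_const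
    exact contDiff_succ_iff_hasFDerivAt.2
      ⟨_, ih h1, fun e => hasFDerivAt_integral_unit (hK.of_le (by simp)) e⟩

lemma contDiff_integral_unit {V : Type w} [NormedAddCommGroup V] [NormedSpace ℝ V]
    [CompleteSpace V] {K : E × ℝ → V} (hK : ContDiff ℝ (⊤ : ℕ∞) K) :
    ContDiff ℝ (⊤ : ℕ∞) fun e => ∫ t in (0 : ℝ)..1, K (e, t) :=
  contDiff_infty.2 fun n => contDiff_integral_unit_nat n hK

end ParametricIntegral

/-- Smooth rescaling of a map fixing the origin. -/
lemma exists_rescaling {f : ℂ → ℂ} (hf : ContDiff ℝ (⊤ : ℕ∞) f) (hf0 : f 0 = 0) :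
    ∃ G : ℝ × ℂ → ℂ, ContDiff ℝ (⊤ : ℕ∞) G ∧ (∀ c z, c * G (c, z) = f (c * z)) ∧
      ∀ z, G (0, z) = fderiv ℝ f 0 z := by
  refine ⟨fun e => ∫ t in (0 : ℝ)..1, fderiv ℝ f ((t * e.1 : ℝ) * e.2) e.2, ?_, ?_, ?_⟩
  · have : ContDiff ℝ (⊤ : ℕ∞) fun q : (ℝ × ℂ) × ℝ =>
        fderiv ℝ f ((q.2 * q.1.1 : ℝ) * q.1.2) q.1.2 := by
      refine ContDiff.clm_apply ?_ (by fun_prop)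
      refine (hf.fderiv_right (m := (⊤ : ℕ∞)) (by simp)).comp ?_
      refine ContDiff.mul ?_ (by fun_prop)
      exact Complex.ofRealCLM.contDiff.comp
        (contDiff_snd.mul (contDiff_fst.comp contDiff_fst))
    exact contDiff_integral_unit this
  · intro c z
    have hf1 : Continuous (fderiv ℝ f) := hf.continuous_fderiv (by simp)
    have hd : ∀ t : ℝ, HasDerivAt (fun t : ℝ => f ((t * c : ℝ) * z))
        (c * fderiv ℝ f ((t * c : ℝ) * z) z) t := by
      intro t
      have h1 : HasDerivAt (fun t : ℝ => ((t * c : ℝ) : ℂ) * z) (((1 * c : ℝ) : ℂ) * z) t :=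
        (HasDerivAt.ofReal_comp ((hasDerivAt_id t).mul_const c)).mul_const z
      have h2 := ((hf.differentiable (by simp) ((t * c : ℝ) * z)).hasFDerivAt).comp_hasDerivAt t h1
      have h3 : fderiv ℝ f ((t * c : ℝ) * z) (((1 * c : ℝ) : ℂ) * z) =
          c * fderiv ℝ f ((t * c : ℝ) * z) z := by
        rw [one_mul, ← Complex.real_smul (x := c) (z := z), map_smul, Complex.real_smul]
      rwa [h3] at h2
    have := intervalIntegral.integral_eq_sub_of_hasDerivAt (a := 0) (b := 1) (fun t _ => hd t)
      (Continuous.intervalIntegrable (by fun_prop) _ _)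
    rw [intervalIntegral.integral_const_mul] at this
    rw [this]
    simp [hf0]
  · intro z
    simp

/-- A smooth periodic function equal to the identity near the interval `[-1/8, 1/8]`. -/
lemma exists_periodic_coordinate : ∃ R : ℝ → ℝ, ContDiff ℝ (⊤ : ℕ∞) R ∧
    (∀ y, R (y + 1) = R y) ∧ (∀ y, |R y| ≤ 1 / 4) ∧ ∀ y, |y| ≤ 1 / 8 → ∀ᶠ z in 𝓝 y, R z = z := by
  let b : ContDiffBump (0 : ℝ) := ⟨3 / 4, 7 / 8, by norm_num, by norm_num⟩
  have hk : ContDiff ℝ (⊤ : ℕ∞) fun s : ℝ => b s * Real.arcsin s := by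
    refine contDiff_iff_contDiffAt.2 fun s => ?_
    by_cases hs : |s| < 1
    · refine b.contDiff.contDiffAt.mul (Real.contDiffAt_arcsin ?_ ?_)
      · rintro rfl; norm_num at hs
      · rintro rfl; norm_num at hs
    · have : (fun s : ℝ => b s * Real.arcsin s) =ᶠ[𝓝 s] fun _ => 0 := by
        have : ∀ᶠ t in 𝓝 s, (7 / 8 : ℝ) < |t| :=
          continuousAt_const.eventually_lt continuous_abs.continuousAt (by push Not at hs; linarith)
        filter_upwards [this] with t ht
        rw [b.zero_of_le_dist (by simpa [Real.dist_eq] using ht.le), zero_mul]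
      exact contDiffAt_const.congr_of_eventuallyEq this
  have hpi := Real.pi_pos
  refine ⟨fun y => b (Real.sin (2 * Real.pi * y)) * Real.arcsin (Real.sin (2 * Real.pi * y)) /
    (2 * Real.pi), ?_, ?_, ?_, ?_⟩
  · exact (hk.comp (by fun_prop : ContDiff ℝ (⊤ : ℕ∞) fun y : ℝ =>
      Real.sin (2 * Real.pi * y))).div_const _
  · intro y
    simp only [mul_add, mul_one, Real.sin_add_two_pi]
  · intro y
    rw [abs_div, abs_mul, abs_of_pos (by positivity : 0 < 2 * Real.pi), div_le_iff₀ (by positivity),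
      abs_of_nonneg b.nonneg]
    have h1 := b.le_one (x := Real.sin (2 * Real.pi * y))
    have h2 : |Real.arcsin (Real.sin (2 * Real.pi * y))| ≤ Real.pi / 2 :=
      abs_le.2 ⟨Real.neg_pi_div_two_le_arcsin _, Real.arcsin_le_pi_div_two _⟩
    have := abs_nonneg (Real.arcsin (Real.sin (2 * Real.pi * y)))
    nlinarith [b.nonneg (x := Real.sin (2 * Real.pi * y))]
  · intro y hy
    have h1 : |Real.sin (2 * Real.pi * y)| < 3 / 4 := by
      have h3 : |Real.sin (2 * Real.pi * y)| ≤ Real.sin (Real.pi / 4) := by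
        rw [abs_le] at hy
        rw [abs_le, ← Real.sin_neg]
        constructor <;> refine Real.sin_le_sin_of_le_of_le_pi_div_two ?_ ?_ ?_ <;> nlinarith
      rw [Real.sin_pi_div_four] at h3
      nlinarith [Real.sqrt_nonneg 2, Real.sq_sqrt (zero_le_two : (0 : ℝ) ≤ 2)]
    have h2 : ∀ᶠ z in 𝓝 y, |Real.sin (2 * Real.pi * z)| < 3 / 4 :=
      (by fun_prop : Continuous fun z : ℝ => |Real.sin (2 * Real.pi * z)|).continuousAt.eventually_lt
        continuousAt_const h1
    have h3 : ∀ᶠ z in 𝓝 y, |z| < 1 / 4 :=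
      continuous_abs.continuousAt.eventually_lt continuousAt_const (by linarith)
    filter_upwards [h2, h3] with z hz hz'
    rw [b.one_of_mem_closedBall (by simpa using hz.le), one_mul, Real.arcsin_sin]
    · field_simp
    · rw [abs_lt] at hz'; nlinarith
    · rw [abs_lt] at hz'; nlinarith

end HermanKAM

namespace HermanKAM

open Complex Set Filter Topology

/-- The symplectic form on the complex plane. -/
noncomputable def symp (a b : ℂ) : ℝ := a.re * b.im - a.im * b.re

lemma symp_map (L : ℂ →L[ℝ] ℂ) (a b : ℂ) : symp (L a) (L b) = symp (L 1) (L I) * symp a b := by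
  have h : ∀ a : ℂ, L a = a.re * L 1 + a.im * L I := by
    intro a
    conv_lhs => rw [show a = a.re • (1 : ℂ) + a.im • I by
      rw [Complex.real_smul, Complex.real_smul, mul_one, Complex.re_add_im]]
    rw [map_add, map_smul, map_smul, Complex.real_smul, Complex.real_smul]
  rw [h a, h b]
  simp only [symp, add_re, add_im, mul_re, mul_im, ofReal_re, ofReal_im]
  ring

lemma symp_mul_mul (a b z : ℂ) : symp (a * z) (b * z) = normSq z * symp a b := by
  simp only [symp, mul_re, mul_im, normSq_apply]
  ring

/-- Area-normalised polar coordinates scaled by `c`. -/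
noncomputable def polar (c x y : ℝ) : ℂ := c * (Real.sqrt (1 + y) : ℂ) * ec x

lemma normSq_polar (c x : ℝ) {y : ℝ} (hy : 0 ≤ 1 + y) : normSq (polar c x y) = c ^ 2 * (1 + y) := by
  rw [polar, normSq_mul, normSq_mul, normSq_ofReal, normSq_ofReal, Real.mul_self_sqrt hy,
    normSq_eq_norm_sq (ec x), norm_ec]
  simp only [ofReal_im, mul_zero, Real.exp_zero]
  ring

lemma hasDerivAt_polar (c : ℝ) {a b : ℝ → ℝ} {a' b' t : ℝ} (ha : HasDerivAt a a' t)
    (hb : HasDerivAt b b' t) (hpos : 0 < 1 + b t) :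
    HasDerivAt (fun t => polar c (a t) (b t))
      ((2 * Real.pi * I * a' + (b' / (2 * (1 + b t)) : ℝ)) * polar c (a t) (b t)) t := by
  have h1 := ((hb.const_add 1).sqrt hpos.ne').ofReal_comp
  have h2 := (hasDerivAt_ec (a t : ℂ)).comp t ha.ofReal_comp
  have h3 := (h1.const_mul (c : ℂ)).mul h2
  refine HasDerivAt.congr_deriv h3 ?_
  have hs : (Real.sqrt (1 + b t) : ℂ) ≠ 0 := by
    exact_mod_cast (Real.sqrt_pos.2 hpos).ne'
  have hs2 : ((1 + b t : ℝ) : ℂ) = (Real.sqrt (1 + b t) : ℂ) ^ 2 := by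
    rw [← ofReal_pow, Real.sq_sqrt hpos.le]
  simp only [polar, Function.comp_apply, ofReal_div, ofReal_mul, hs2, ofReal_ofNat]
  field_simp
  ring

lemma contDiff_ec_ofReal {E : Type*} [NormedAddCommGroup E] [NormedSpace ℝ E] {a : E → ℝ}
    (ha : ContDiff ℝ (⊤ : ℕ∞) a) : ContDiff ℝ (⊤ : ℕ∞) fun e => ec (a e) :=
  ContDiff.cexp (contDiff_const.mul (Complex.ofRealCLM.contDiff.comp ha))

/-- In polar coordinates, an area-preserving map with an elliptic fixed point is a small
perturbation of a rotation near the fixed point. -/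
lemma exists_polar_map {f : ℂ → ℂ} (hf : ContDiff ℝ (⊤ : ℕ∞) f) (hf0 : f 0 = 0) {ρ : ℝ}
    (hD : ∀ z, fderiv ℝ f 0 z = ec ρ * z) :
    ∃ (p q : ℝ × ℝ × ℝ → ℝ) (R : ℝ → ℝ) (c₀ : ℝ), 0 < c₀ ∧
      ContDiff ℝ (⊤ : ℕ∞) p ∧ ContDiff ℝ (⊤ : ℕ∞) q ∧
      (∀ c x y, p (c, x + 1, y) = p (c, x, y)) ∧ (∀ c x y, p (c, x, y + 1) = p (c, x, y)) ∧
      (∀ c x y, q (c, x + 1, y) = q (c, x, y)) ∧ (∀ c x y, q (c, x, y + 1) = q (c, x, y)) ∧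
      (∀ x y, p (0, x, y) = 0) ∧ (∀ x y, q (0, x, y) = 0) ∧
      (∀ y, |y| ≤ 1 / 8 → ∀ᶠ z in 𝓝 y, R z = z) ∧ (∀ y, |R y| ≤ 1 / 4) ∧
      ∀ c x y, 0 < 1 + R y + q (c, x, y) ∧ f (polar (c₀ * Real.sin c) x (R y)) =
        polar (c₀ * Real.sin c) (x + ρ + p (c, x, y)) (R y + q (c, x, y)) := by
  obtain ⟨G, hG, hGf, hG0⟩ := exists_rescaling hf hf0
  obtain ⟨R, hR, hRper, hRb, hRid⟩ := exists_periodic_coordinate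
  have hρ := ec_ne_zero ρ
  have hsmall : ∀ᶠ c in 𝓝 (0 : ℝ), ∀ z ∈ Metric.closedBall (0 : ℂ) 2,
      ‖G (c, z) - ec ρ * z‖ < 1 / 4 := by
    refine (isCompact_closedBall (0 : ℂ) 2).eventually_forall_of_forall_eventually fun z _ => ?_
    have hc : Continuous fun w : ℝ × ℂ => ‖G (w.1, w.2) - ec ρ * w.2‖ := by
      have := hG.continuous
      fun_prop
    exact hc.continuousAt.eventually_lt continuousAt_const (by simp [hG0, hD])
  obtain ⟨c₀, hc₀, hball⟩ := Metric.eventually_nhds_iff.1 hsmall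
  have hR1 : ∀ y, 3 / 4 ≤ 1 + R y := fun y => by linarith [(abs_le.1 (hRb y)).1]
  have hR2 : ∀ y, 1 + R y ≤ 5 / 4 := fun y => by linarith [(abs_le.1 (hRb y)).2]
  set Z : ℝ × ℝ × ℝ → ℂ := fun w => (Real.sqrt (1 + R w.2.2) : ℂ) * ec w.2.1 with hZ
  have hZn : ∀ w, ‖Z w‖ = Real.sqrt (1 + R w.2.2) := by
    intro w
    rw [hZ, norm_mul, norm_ec, Complex.norm_real, Real.norm_of_nonneg (Real.sqrt_nonneg _)]
    simp
  have hZ1 : ∀ w, 1 / 2 ≤ ‖Z w‖ := fun w => by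
    rw [hZn]
    exact Real.le_sqrt_of_sq_le (by linarith [hR1 w.2.2])
  have hZ2 : ∀ w, ‖Z w‖ ≤ 2 := fun w => by
    rw [hZn]
    exact Real.sqrt_le_iff.2 ⟨by norm_num, by linarith [hR2 w.2.2]⟩
  have hZ0 : ∀ w, Z w ≠ 0 := fun w => norm_pos_iff.1 (by linarith [hZ1 w])
  have hRw : ContDiff ℝ (⊤ : ℕ∞) fun w : ℝ × ℝ × ℝ => R w.2.2 :=
    hR.comp (contDiff_snd.comp contDiff_snd)
  have hZs : ContDiff ℝ (⊤ : ℕ∞) Z := by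
    refine ContDiff.mul ?_ (contDiff_ec_ofReal (by fun_prop))
    exact Complex.ofRealCLM.contDiff.comp
      ((contDiff_const.add hRw).sqrt fun w => by linarith [hR1 w.2.2])
  set c' : ℝ → ℝ := fun c => c₀ / 2 * Real.sin c with hc'
  have hc'b : ∀ c, |c' c| < c₀ := fun c => by
    rw [hc', abs_mul, abs_of_pos (by positivity)]
    have := Real.abs_sin_le_one c
    nlinarith
  set H : ℝ × ℝ × ℝ → ℂ := fun w => G (c' w.1, Z w) / (ec ρ * Z w) with hH
  have hden : ∀ w, ec ρ * Z w ≠ 0 := fun w => mul_ne_zero hρ (hZ0 w)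
  have hHs : ContDiff ℝ (⊤ : ℕ∞) H := by
    simp only [hH, div_eq_mul_inv]
    refine (hG.comp (ContDiff.prodMk ?_ hZs)).mul ((contDiff_const.mul hZs).inv hden)
    exact contDiff_const.mul (Real.contDiff_sin.comp contDiff_fst)
  have hHn : ∀ w, ‖H w - 1‖ < 1 := fun w => by
    have h1 : H w - 1 = (G (c' w.1, Z w) - ec ρ * Z w) / (ec ρ * Z w) := by
      rw [sub_div, div_self (hden w)]
    have h2 := hball (y := c' w.1) (by simpa using hc'b w.1) (Z w) (by simpa using hZ2 w)
    have h3 := hZ1 w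
    rw [h1, norm_div, norm_mul, norm_ec, div_lt_one]
    · simp; linarith
    · simp; exact hZ0 w
  have hHslit : ∀ w, H w ∈ slitPlane := fun w => by
    have := Complex.mem_slitPlane_of_norm_lt_one (hHn w)
    rwa [add_sub_cancel] at this
  have hH0 : ∀ w, H w ≠ 0 := fun w => slitPlane_ne_zero (hHslit w)
  have hlog : ContDiff ℝ (⊤ : ℕ∞) fun w => Complex.log (H w) := by
    refine contDiff_iff_contDiffAt.2 fun w => ?_
    exact ((Complex.contDiffAt_log (n := (⊤ : ℕ∞)) (hHslit w)).restrict_scalars ℝ).comp w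
      hHs.contDiffAt
  have hZx : ∀ c x y, Z (c, x + 1, y) = Z (c, x, y) := fun c x y => by
    have := ec_int 1
    push_cast at this
    simp [hZ, ec_add, this]
  have hZy : ∀ c x y, Z (c, x, y + 1) = Z (c, x, y) := fun c x y => by
    simp [hZ, hRper]
  have hHx : ∀ c x y, H (c, x + 1, y) = H (c, x, y) := fun c x y => by simp [hH, hZx]
  have hHy : ∀ c x y, H (c, x, y + 1) = H (c, x, y) := fun c x y => by simp [hH, hZy]
  have hHz : ∀ x y, H (0, x, y) = 1 := fun x y => by
    simp only [hH, hc', Real.sin_zero, mul_zero, hG0, hD]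
    exact div_self (hden _)
  refine ⟨fun w => (Complex.log (H w)).im / (2 * Real.pi),
    fun w => (1 + R w.2.2) * (normSq (H w) - 1), R, c₀ / 2, by positivity, ?_, ?_, ?_, ?_, ?_, ?_,
    ?_, ?_, hRid, hRb, ?_⟩
  · exact (Complex.imCLM.contDiff.comp hlog).div_const _
  · refine (contDiff_const.add hRw).mul (ContDiff.sub ?_ contDiff_const)
    simp only [normSq_apply]
    have h1 : ContDiff ℝ (⊤ : ℕ∞) fun w => (H w).re := Complex.reCLM.contDiff.comp hHs
    have h2 : ContDiff ℝ (⊤ : ℕ∞) fun w => (H w).im := Complex.imCLM.contDiff.comp hHs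
    exact (h1.mul h1).add (h2.mul h2)
  · intro c x y; simp only [hHx]
  · intro c x y; simp only [hHy]
  · intro c x y; simp only [hHx]
  · intro c x y; simp only [hHy, hRper]
  · intro x y; simp [hHz]
  · intro x y; simp [hHz]
  · intro c x y
    have hsum : 1 + R y + (1 + R y) * (normSq (H (c, x, y)) - 1) =
        (1 + R y) * normSq (H (c, x, y)) := by ring
    have hpos : 0 < 1 + R y := by linarith [hR1 y]
    refine ⟨?_, ?_⟩
    · rw [hsum]
      exact mul_pos hpos (normSq_pos.2 (hH0 _))
    · have e1 : polar (c' c) x (R y) = c' c * Z (c, x, y) := by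
        rw [polar, hZ, mul_assoc]
      have e2 : G (c' c, Z (c, x, y)) = ec ρ * Z (c, x, y) * H (c, x, y) := by
        rw [hH]
        exact (mul_div_cancel₀ _ (hden _)).symm
      have e3 : (Real.sqrt (1 + R y + (1 + R y) * (normSq (H (c, x, y)) - 1)) : ℂ) =
          Real.sqrt (1 + R y) * ‖H (c, x, y)‖ := by
        rw [hsum, Real.sqrt_mul hpos.le, normSq_eq_norm_sq, Real.sqrt_sq (norm_nonneg _)]
        push_cast
        rfl
      have e4 : (‖H (c, x, y)‖ : ℂ) *
          ec ((Complex.log (H (c, x, y))).im / (2 * Real.pi) : ℝ) = H (c, x, y) := by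
        conv_rhs => rw [← Complex.norm_mul_exp_arg_mul_I (H (c, x, y))]
        rw [Complex.log_im, ec]
        congr 2
        have : (Real.pi : ℂ) ≠ 0 := by exact_mod_cast Real.pi_ne_zero
        push_cast
        field_simp
      show f (polar (c' c) x (R y)) = polar (c' c) _ _
      rw [e1, ← hGf, e2, polar, ← add_assoc, e3, ofReal_add, ofReal_add, ec_add, ec_add]
      conv_lhs => rw [← e4]
      simp only [hZ]
      ring

/-- Area preservation in polar coordinates. -/
lemma polar_det {f : ℂ → ℂ} (hf : ContDiff ℝ (⊤ : ℕ∞) f)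
    (hdet : ∀ z, symp (fderiv ℝ f z 1) (fderiv ℝ f z I) = 1)
    {p q : ℝ × ℝ → ℝ} (hp : Differentiable ℝ p) (hq : Differentiable ℝ q) {ρ c x y : ℝ}
    (hc : c ≠ 0) (hy : 0 < 1 + y) (hpos : 0 < 1 + y + q (x, y))
    (h : ∀ᶠ w in 𝓝 (x, y), f (polar c w.1 w.2) = polar c (w.1 + ρ + p w) (w.2 + q w)) :
    (1 + fderiv ℝ p (x, y) (1, 0)) * (1 + fderiv ℝ q (x, y) (0, 1)) -
      fderiv ℝ p (x, y) (0, 1) * fderiv ℝ q (x, y) (1, 0) = 1 := by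
  set A := polar c x y with hA
  set B := polar c (x + ρ + p (x, y)) (y + q (x, y)) with hB
  set L := fderiv ℝ f A with hL
  have hfd : HasFDerivAt f L A := (hf.differentiable (by simp) A).hasFDerivAt
  have hx1 : HasDerivAt (fun t : ℝ => (t, y)) ((1 : ℝ), (0 : ℝ)) x :=
    (hasDerivAt_id x).prodMk (hasDerivAt_const x y)
  have hy1 : HasDerivAt (fun t : ℝ => (x, t)) ((0 : ℝ), (1 : ℝ)) y :=
    (hasDerivAt_const y x).prodMk (hasDerivAt_id y)
  have hpx : HasDerivAt (fun t => p (t, y)) _ x := (hp (x, y)).hasFDerivAt.comp_hasDerivAt x hx1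
  have hpy : HasDerivAt (fun t => p (x, t)) _ y := (hp (x, y)).hasFDerivAt.comp_hasDerivAt y hy1
  have hqx : HasDerivAt (fun t => q (t, y)) _ x := (hq (x, y)).hasFDerivAt.comp_hasDerivAt x hx1
  have hqy : HasDerivAt (fun t => q (x, t)) _ y := (hq (x, y)).hasFDerivAt.comp_hasDerivAt y hy1
  have hpos' : 0 < 1 + (y + q (x, y)) := by linarith
  have l1 := hfd.comp_hasDerivAt x (hasDerivAt_polar c (hasDerivAt_id x) (hasDerivAt_const x y) hy)
  have l2 := hfd.comp_hasDerivAt y (hasDerivAt_polar c (hasDerivAt_const y x) (hasDerivAt_id y) hy)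
  have r1 := hasDerivAt_polar c (((hasDerivAt_id x).add_const ρ).add hpx) (hqx.const_add y) hpos'
  have r2 := hasDerivAt_polar c (hpy.const_add (x + ρ)) ((hasDerivAt_id y).add hqy) hpos'
  have t1 : Tendsto (fun t : ℝ => (t, y)) (𝓝 x) (𝓝 (x, y)) := hx1.continuousAt
  have t2 : Tendsto (fun t : ℝ => (x, t)) (𝓝 y) (𝓝 (x, y)) := hy1.continuousAt
  have u1 := l1.unique (r1.congr_of_eventuallyEq (t1.eventually h))
  have u2 := l2.unique (r2.congr_of_eventuallyEq (t2.eventually h))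
  have key := symp_map L ((2 * Real.pi * I * (1 : ℝ) + (0 / (2 * (1 + y)) : ℝ)) * A)
    ((2 * Real.pi * I * (0 : ℝ) + (1 / (2 * (1 + y)) : ℝ)) * A)
  rw [hL, hdet, ← hL, one_mul] at key
  simp only [id] at u1 u2
  rw [u1, u2] at key
  simp only [Pi.add_apply, id] at key
  rw [symp_mul_mul, symp_mul_mul, hA, normSq_polar _ _ hy.le, normSq_polar _ _ hpos'.le] at key
  simp only [symp, add_re, add_im, mul_re, mul_im, ofReal_re, ofReal_im, I_re, I_im, re_ofNat,
    im_ofNat, zero_div, mul_zero, mul_one, zero_mul, add_zero, zero_add, sub_zero, zero_sub] at key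
  have hpi := Real.pi_pos
  field_simp at key
  linarith

end HermanKAM

namespace HermanKAM

open Complex Set Filter Topology

lemma fderiv_ofReal_comp {p : ℝ × ℝ × ℝ → ℝ} (hp : ContDiff ℝ (⊤ : ℕ∞) p) (z v : ℝ × ℝ × ℝ) :
    fderiv ℝ (fun w => (p w : ℂ)) z v = (fderiv ℝ p z v : ℂ) := by
  have h : HasFDerivAt (fun w => (p w : ℂ)) (Complex.ofRealCLM.comp (fderiv ℝ p z)) z :=
    Complex.ofRealCLM.hasFDerivAt.comp z (hp.differentiable (by simp) z).hasFDerivAt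
  rw [h.fderiv]
  rfl

lemma fderiv_slice {p : ℝ × ℝ × ℝ → ℝ} (hp : Differentiable ℝ p) (c : ℝ) (w v : ℝ × ℝ) :
    fderiv ℝ (fun w : ℝ × ℝ => p (c, w)) w v = fderiv ℝ p (c, w) (0, v) := by
  have h : HasFDerivAt (fun w : ℝ × ℝ => p (c, w))
      ((fderiv ℝ p (c, w)).comp (ContinuousLinearMap.inr ℝ ℝ (ℝ × ℝ))) w :=
    (hp (c, w)).hasFDerivAt.comp w (hasFDerivAt_prodMk_right c w)
  rw [h.fderiv]
  rfl

/-- A cocycle `u (x + β) - u x` that is constant and bounded must vanish. -/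
lemma eq_zero_of_bounded_increment {u : ℝ → ℝ} {β L C : ℝ} (hu : ∀ x, |u x| ≤ C)
    (h : ∀ x, u (x + β) - u x = L) : L = 0 := by
  have hn : ∀ n : ℕ, u (n * β) - u 0 = n * L := by
    intro n
    induction n with
    | zero => simp
    | succ k ih =>
      have := h (k * β)
      rw [show (k : ℝ) * β + β = ((k + 1 : ℕ) : ℝ) * β by push_cast; ring] at this
      push_cast at this ⊢
      linarith
  by_contra hL
  obtain ⟨n, hn'⟩ := exists_nat_gt (2 * C / |L|)
  rw [div_lt_iff₀ (abs_pos.mpr hL)] at hn'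
  have h1 : |(n : ℝ) * L| ≤ 2 * C := by
    rw [← hn n]
    calc |u (n * β) - u 0| ≤ |u (n * β)| + |u 0| := abs_sub _ _
      _ ≤ 2 * C := by linarith [hu (n * β), hu 0]
  rw [abs_mul, Nat.abs_cast] at h1
  linarith

/-- Selection of a parameter where the frequency defect vanishes. -/
lemma exists_zero_defect {ρ γ c₁ : ℝ} {s : ℕ} (hρ : ρ ≠ 0) (hc₁ : 0 < c₁)
    (hD : ∀ (N : ℕ) (a : ℤ), 2 ≤ N → |a - (N : ℤ)| ≤ 1 → Dio γ s (ρ * a / N))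
    {Λ : ℝ × {β // Dio γ s β} → ℝ} (hΛ : Continuous Λ) (h0 : ∀ β, Λ (0, β) = 0) :
    ∃ c, 0 < c ∧ c ≤ c₁ ∧ ∃ β : {β // Dio γ s β}, ρ - β - Λ (c, β) = 0 := by
  have hρS : Dio γ s ρ := by
    have := hD 2 2 le_rfl (by norm_num)
    simpa using this
  set ℓ : ℝ × {β // Dio γ s β} → ℝ := fun z => ρ - z.2 - Λ z with hℓ
  have hℓc : Continuous ℓ := by fun_prop
  by_cases hz : ℓ (c₁, ⟨ρ, hρS⟩) = 0
  · exact ⟨c₁, hc₁, le_rfl, ⟨ρ, hρS⟩, hz⟩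
  obtain ⟨e, he, hsign⟩ : ∃ e : ℤ, |e| ≤ 1 ∧ 0 < (e : ℝ) * ρ * ℓ (c₁, ⟨ρ, hρS⟩) := by
    rcases lt_or_gt_of_ne (mul_ne_zero hρ hz) with h | h
    · exact ⟨-1, by norm_num, by push_cast; linarith⟩
    · exact ⟨1, by norm_num, by push_cast; linarith⟩
  let b : ℕ → {β // Dio γ s β} := fun n => ⟨ρ * ((n + 2 : ℕ) + e : ℤ) / (n + 2 : ℕ),
    hD (n + 2) _ (by omega) (by simpa using he)⟩
  have hbv : ∀ n, ((b n : ℝ)) = ρ + e * ρ * (1 / ((n : ℝ) + 2)) := by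
    intro n
    have : (n : ℝ) + 2 ≠ 0 := by positivity
    simp only [b]
    push_cast
    field_simp
  have ht2 : Tendsto (fun n : ℕ => 1 / ((n : ℝ) + 2)) atTop (𝓝 0) := by
    have h := (tendsto_one_div_add_atTop_nhds_zero_nat (𝕜 := ℝ)).comp (tendsto_add_atTop_nat 1)
    refine h.congr fun n => ?_
    simp only [Function.comp]
    push_cast
    ring_nf
  have hbt : Tendsto b atTop (𝓝 ⟨ρ, hρS⟩) := by
    rw [tendsto_subtype_rng]
    simp only [hbv]
    have := (ht2.const_mul (e * ρ)).const_add ρ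
    simpa using this
  have hlim : Tendsto (fun n => (e : ℝ) * ρ * ℓ (c₁, b n)) atTop
      (𝓝 ((e : ℝ) * ρ * ℓ (c₁, ⟨ρ, hρS⟩))) := by
    have h1 : Tendsto (fun n => (c₁, b n)) atTop (𝓝 (c₁, (⟨ρ, hρS⟩ : {β // Dio γ s β}))) :=
      tendsto_const_nhds.prodMk_nhds hbt
    exact ((hℓc.tendsto _).comp h1).const_mul _
  obtain ⟨n, hn⟩ := (hlim.eventually (lt_mem_nhds hsign)).exists
  have heρ : (e : ℝ) * ρ ≠ 0 := fun h => by simp [h] at hsign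
  have h00 : (e : ℝ) * ρ * ℓ (0, b n) < 0 := by
    have : (e : ℝ) * ρ * ℓ (0, b n) = -((e * ρ) ^ 2 * (1 / ((n : ℝ) + 2))) := by
      simp only [hℓ, h0, hbv]
      ring
    rw [this]
    have : 0 < ((e : ℝ) * ρ) ^ 2 := by positivity
    have : 0 < 1 / ((n : ℝ) + 2) := by positivity
    simp only [neg_lt_zero]
    positivity
  have hcont : ContinuousOn (fun c => (e : ℝ) * ρ * ℓ (c, b n)) (Icc 0 c₁) := by
    apply Continuous.continuousOn
    fun_prop
  obtain ⟨c, hc, hcz⟩ := intermediate_value_Icc hc₁.le hcont ⟨h00.le, hn.le⟩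
  refine ⟨c, lt_of_le_of_ne hc.1 ?_, hc.2, b n, ?_⟩
  · rintro rfl
    exact h00.ne hcz
  · exact (mul_eq_zero.mp hcz).resolve_left heρ

/-- Near an elliptic fixed point with Diophantine rotation number there are arbitrarily small
circles whose image is a vertical translate. -/
theorem exists_translated_circle {f : ℂ → ℂ} (hf : ContDiff ℝ (⊤ : ℕ∞) f) (hf0 : f 0 = 0) {ρ : ℝ}
    (hD : ∀ z, fderiv ℝ f 0 z = ec ρ * z)
    (hdet : ∀ z, symp (fderiv ℝ f z 1) (fderiv ℝ f z I) = 1)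
    {c : ℝ} {T : ℕ} (hc : 0 < c) (H : ∀ q p : ℤ, q ≠ 0 → c / |(q : ℝ)| ^ T ≤ |q * ρ - p|)
    {δ : ℝ} (hδ : 0 < δ) :
    ∃ (u v : ℝ → ℝ) (β Λ r : ℝ), 0 < r ∧ r ≤ δ ∧ LipschitzWith (1 / 8) u ∧
      LipschitzWith (1 / 8) v ∧ (∀ x, u (x + 1) = u x) ∧ (∀ x, v (x + 1) = v x) ∧
      (∀ x, |v x| ≤ 1 / 8) ∧
      ∀ x, 0 < 1 + (v (x + β) - Λ) ∧
        f (polar r (x + u x) (v x)) = polar r (x + β + u (x + β)) (v (x + β) - Λ) := by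
  have hρ : ρ ≠ 0 := by
    rintro rfl
    have := H 1 0 one_ne_zero
    simp at this
    linarith
  obtain ⟨γ, hγ, s, hS⟩ := exists_uniform_dio hc H
  obtain ⟨p, q, R, c₀, hc₀, hp, hq, hpx, hpy, hqx, hqy, hp0, hq0, hR, hR4, hpol⟩ :=
    exists_polar_map hf hf0 hD
  have hofR : ContDiff ℝ (⊤ : ℕ∞) (fun x : ℝ => (x : ℂ)) := Complex.ofRealCLM.contDiff
  have hF₁ : TorusFamily (fun z => (p z : ℂ)) :=
    ⟨hofR.comp hp, fun c x y => by simp only [hpx], fun c x y => by simp only [hpy]⟩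
  have hF₂ : TorusFamily (fun z => (q z : ℂ)) :=
    ⟨hofR.comp hq, fun c x y => by simp only [hqx], fun c x y => by simp only [hqy]⟩
  have hF₁0 : ∀ x y, ((p (0, x, y) : ℝ) : ℂ) = 0 := fun x y => by rw [hp0]; simp
  have hF₂0 : ∀ x y, ((q (0, x, y) : ℝ) : ℂ) = 0 := fun x y => by rw [hq0]; simp
  obtain ⟨ε₀, hε₀, hcurve⟩ := exists_translated_curve (P := ℝ × {β // Dio γ s β}) s hγ
  have hev1 : ∀ᶠ c₁ in 𝓝[>] (0 : ℝ), c₁ < 1 :=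
    nhdsWithin_le_nhds (eventually_lt_nhds one_pos)
  have hev2 : ∀ᶠ c₁ in 𝓝[>] (0 : ℝ), c₁ < δ / c₀ :=
    nhdsWithin_le_nhds (eventually_lt_nhds (div_pos hδ hc₀))
  have hev3 : ∀ᶠ c₁ in 𝓝[>] (0 : ℝ), 0 < c₁ := self_mem_nhdsWithin
  obtain ⟨c₁, hco₁, hco₂, hc₁1, hc₁δ, hc₁0⟩ := ((hF₁.exists_coefs (fun z => conj_ofReal _) hF₁0
    (4 * (s + 2) + 7) hε₀).and ((hF₂.exists_coefs (fun z => conj_ofReal _) hF₂0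
    (4 * (s + 2) + 7) hε₀).and (hev1.and (hev2.and hev3)))).exists
  let σ : ℝ × {β // Dio γ s β} → ℝ := fun z => max 0 (min z.1 c₁)
  have hσ : Continuous σ := by fun_prop
  have hσ0 : ∀ z, 0 ≤ σ z := fun z => le_max_left _ _
  have hσ1 : ∀ z, σ z ≤ c₁ := fun z => max_le hc₁0.le (min_le_right _ _)
  have hσa : ∀ z, |σ z| ≤ c₁ := fun z => by rw [abs_of_nonneg (hσ0 z)]; exact hσ1 z
  have hC₁ := hco₁ hσ hσa
  have hC₂ := hco₂ hσ hσa
  have hs1 := (hC₁.d1).summable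
  have hs1' := (hC₁.d2).summable
  have hs2 := (hC₂.d1).summable
  have hs2' := (hC₂.d2).summable
  obtain ⟨u, v, Λ₁, Λ₂, hΛ₁, hΛ₂, huL, hvL, hu1, hv1, hub, hvb, hueq, hveq⟩ :=
    hcurve (β := fun z => z.2) (by fun_prop) (fun z => z.2.2) hC₁ hC₂ (by
      intro z x y hy
      rw [D1_coef2 hF₁] at hs1 ⊢
      rw [D2_coef2 hF₁] at hs1' ⊢
      rw [D1_coef2 hF₂] at hs2 ⊢
      rw [D2_coef2 hF₂] at hs2' ⊢
      rw [fsum_coef2 hF₁.partialX (hs1 z), fsum_coef2 hF₁.partialY (hs1' z),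
        fsum_coef2 hF₂.partialX (hs2 z), fsum_coef2 hF₂.partialY (hs2' z)]
      rcases (hσ0 z).eq_or_lt with h0 | h0
      · rw [← h0, hF₁.partialX_zero hF₁0, hF₁.partialY_zero hF₁0, hF₂.partialX_zero hF₂0,
          hF₂.partialY_zero hF₂0]
        ring
      · have hsin : 0 < Real.sin (σ z) := Real.sin_pos_of_pos_of_lt_pi h0
          (by linarith [hσ1 z, Real.pi_gt_three])
        have hpd := hp.differentiable (by simp)
        have hqd := hq.differentiable (by simp)
        have hRy := (hR y hy).self_of_nhds
        have hy' := abs_le.mp hy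
        have key := polar_det (p := fun w => p (σ z, w)) (q := fun w => q (σ z, w)) (ρ := ρ)
          (c := c₀ * Real.sin (σ z)) (x := x) (y := y) hf hdet
          (by fun_prop) (by fun_prop) (by positivity) (by linarith)
          (by have := (hpol (σ z) x y).1; rwa [hRy] at this)
          (by
            have hev : ∀ᶠ w : ℝ × ℝ in 𝓝 (x, y), R w.2 = w.2 :=
              (continuous_snd.tendsto (x, y)).eventually (hR y hy)
            filter_upwards [hev] with w hw
            have := (hpol (σ z) w.1 w.2).2
            rwa [hw] at this)
        rw [fderiv_slice hpd, fderiv_slice hpd, fderiv_slice hqd, fderiv_slice hqd] at key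
        simp only [partialX, partialY, fderiv_ofReal_comp hp, fderiv_ofReal_comp hq]
        exact_mod_cast key)
  have hg₁ : ∀ z x y, (fsum (fun p_1 => coef2 (fun z => (p z : ℂ)) (σ p_1)) z x y).re
      = p (σ z, x, y) := fun z x y => by rw [fsum_coef2 hF₁ (hC₁.summable z), ofReal_re]
  have hg₂ : ∀ z x y, (fsum (fun p_1 => coef2 (fun z => (q z : ℂ)) (σ p_1)) z x y).re
      = q (σ z, x, y) := fun z x y => by rw [fsum_coef2 hF₂ (hC₂.summable z), ofReal_re]
  simp only [hg₁] at hueq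
  simp only [hg₂] at hveq
  have hΛ0 : ∀ β, Λ₁ (0, β) = 0 := by
    intro β
    have hσz : σ (0, β) = 0 := by simp [σ, hc₁0.le]
    refine eq_zero_of_bounded_increment (hub (0, β)) (β := β) fun x => ?_
    rw [hueq, hσz, hp0, zero_add]
  obtain ⟨c', hc'0, hc'1, β, hβ⟩ := exists_zero_defect hρ hc₁0 hS hΛ₁ hΛ0
  have hσc : σ (c', β) = c' := by simp [σ, hc'0.le, hc'1]
  have hsin : 0 < Real.sin c' := Real.sin_pos_of_pos_of_lt_pi hc'0 (by linarith [Real.pi_gt_three])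
  refine ⟨u (c', β), v (c', β), β, Λ₂ (c', β), c₀ * Real.sin c', by positivity, ?_, huL _, hvL _,
    hu1 _, hv1 _, hvb _, fun x => ?_⟩
  · calc c₀ * Real.sin c' ≤ c₀ * c' := by gcongr; exact Real.sin_le hc'0.le
      _ ≤ c₀ * (δ / c₀) := by gcongr; linarith
      _ = δ := by field_simp
  · have h := hpol c' (x + u (c', β) x) (v (c', β) x)
    have hRv := (hR _ (hvb (c', β) x)).self_of_nhds
    rw [hRv] at h
    have e1 := hueq (c', β) x
    have e2 := hveq (c', β) x
    rw [hσc] at e1 e2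
    rw [show v (c', β) x + q (c', x + u (c', β) x, v (c', β) x)
        = v (c', β) (x + β) - Λ₂ (c', β) by linarith,
      show x + u (c', β) x + ρ + p (c', x + u (c', β) x, v (c', β) x)
        = x + β + u (c', β) (x + β) by linarith,
      show 1 + v (c', β) x + q (c', x + u (c', β) x, v (c', β) x)
        = 1 + (v (c', β) (x + β) - Λ₂ (c', β)) by linarith] at h
    exact h

end HermanKAM

namespace HermanKAM

open Complex Set Filter Topology

/-- The gauge of the star-shaped domain with radial function `S`. -/
noncomputable def gaugeOf (S : Real.Angle → ℝ) (z : ℂ) : ℝ := ‖z‖ / S (z.arg : Real.Angle)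

section Gauge

variable {S : Real.Angle → ℝ}

lemma gaugeOf_zero : gaugeOf S 0 = 0 := by simp [gaugeOf]

lemma exists_pos_lower_bound (hS : Continuous S) (hpos : ∀ θ, 0 < S θ) :
    ∃ m > 0, ∀ θ, m ≤ S θ := by
  have : Fact (0 < 2 * Real.pi) := ⟨Real.two_pi_pos⟩
  have : CompactSpace Real.Angle := inferInstanceAs (CompactSpace (AddCircle (2 * Real.pi)))
  obtain ⟨θ, -, h⟩ := isCompact_univ.exists_isMinOn (Set.univ_nonempty (α := Real.Angle))
    hS.continuousOn
  exact ⟨S θ, hpos θ, fun θ' => h (mem_univ θ')⟩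

lemma continuous_gaugeOf (hS : Continuous S) (hpos : ∀ θ, 0 < S θ) : Continuous (gaugeOf S) := by
  rw [continuous_iff_continuousAt]
  intro z
  rcases eq_or_ne z 0 with rfl | hz
  · obtain ⟨m, hm, hmS⟩ := exists_pos_lower_bound hS hpos
    rw [ContinuousAt, gaugeOf_zero]
    have h : Tendsto (fun z : ℂ => ‖z‖ / m) (𝓝 0) (𝓝 0) := by
      have : Continuous fun z : ℂ => ‖z‖ / m := by fun_prop
      simpa using this.tendsto 0
    refine squeeze_zero (fun z => div_nonneg (norm_nonneg _) (hpos _).le) (fun z => ?_) h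
    exact div_le_div_of_nonneg_left (norm_nonneg _) hm (hmS _)
  · exact continuous_norm.continuousAt.div
      (hS.continuousAt.comp (continuousAt_arg_coe_angle hz)) (hpos _).ne'

lemma gaugeOf_smul {a : ℝ} (ha : 0 ≤ a) (z : ℂ) : gaugeOf S (a • z) = a * gaugeOf S z := by
  rcases ha.eq_or_lt with rfl | ha
  · simp [gaugeOf]
  · rw [gaugeOf, gaugeOf, norm_smul, Complex.real_smul, arg_real_mul z ha, Real.norm_of_nonneg ha.le]
    ring

lemma isPreconnected_gaugeOf_lt : IsPreconnected {z | gaugeOf S z < 1} := by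
  refine (StarConvex.isPathConnected (a := (0 : ℂ)) ?_ ?_).isConnected.isPreconnected
  · rw [starConvex_zero_iff]
    intro z hz a ha ha1
    simp only [mem_ofPred_eq] at hz ⊢
    rw [gaugeOf_smul ha]
    by_cases h : 0 ≤ gaugeOf S z
    · nlinarith
    · nlinarith [not_le.mp h]
  · simp [gaugeOf_zero]

lemma image_gaugeOf_subset {S' : Real.Angle → ℝ} (hS' : Continuous S') (hpos' : ∀ θ, 0 < S' θ)
    {f : ℂ → ℂ} (hf : Continuous f) (hf0 : f 0 = 0)
    (h : ∀ z, gaugeOf S' (f z) = 1 → gaugeOf S z = 1) {z : ℂ} (hz : gaugeOf S z < 1) :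
    gaugeOf S' (f z) < 1 := by
  have hc := continuous_gaugeOf hS' hpos'
  have hpre := (isPreconnected_gaugeOf_lt (S := S)).image f hf.continuousOn
  have h1 : IsOpen {z | gaugeOf S' z < 1} := isOpen_lt hc continuous_const
  have h2 : IsOpen {z | 1 < gaugeOf S' z} := isOpen_lt continuous_const hc
  refine hpre.subset_left_of_subset_union h1 h2 ?_ ?_ ?_ ⟨z, hz, rfl⟩
  · rw [Set.disjoint_left]
    intro a (ha : gaugeOf S' a < 1) (hb : 1 < gaugeOf S' a)
    exact lt_asymm ha hb
  · rintro _ ⟨w, hw, rfl⟩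
    rcases lt_trichotomy (gaugeOf S' (f w)) 1 with h' | h' | h'
    · exact Or.inl h'
    · exact absurd (h w h') hw.ne
    · exact Or.inr h'
  · exact ⟨0, ⟨0, by simp [gaugeOf_zero], hf0⟩, by simp [gaugeOf_zero]⟩

lemma isBounded_gaugeOf_le {M : ℝ} (hpos : ∀ θ, 0 < S θ) (hM : ∀ θ, S θ ≤ M) {z : ℂ}
    (hz : gaugeOf S z ≤ 1) : ‖z‖ ≤ M := by
  rw [gaugeOf, div_le_one (hpos _)] at hz
  exact hz.trans (hM _)

lemma measure_gaugeOf_lt {S' : Real.Angle → ℝ} (hS : Continuous S) (hS' : Continuous S')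
    (hpos : ∀ θ, 0 < S θ) (h : ∀ θ, S θ < S' θ) (μ : Measure ℂ) [μ.IsOpenPosMeasure]
    [IsFiniteMeasureOnCompacts μ] : μ {z | gaugeOf S z < 1} < μ {z | gaugeOf S' z < 1} := by
  have hpos' : ∀ θ, 0 < S' θ := fun θ => (hpos θ).trans (h θ)
  have hc := continuous_gaugeOf hS hpos
  have hc' := continuous_gaugeOf hS' hpos'
  have hle : ∀ z, gaugeOf S' z ≤ gaugeOf S z := fun z =>
    div_le_div_of_nonneg_left (norm_nonneg _) (hpos _) (h _).le
  set W := {z | 1 < gaugeOf S z} ∩ {z | gaugeOf S' z < 1} with hW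
  have hWo : IsOpen W := (isOpen_lt continuous_const hc).inter (isOpen_lt hc' continuous_const)
  have hWn : W.Nonempty := by
    refine ⟨((S 0 + S' 0) / 2 : ℝ), ?_, ?_⟩
    all_goals
      have h1 := hpos 0
      have h2 := h 0
      have h3 : 0 < (S 0 + S' 0) / 2 := by linarith
      simp only [mem_ofPred_eq, gaugeOf, arg_ofReal_of_nonneg h3.le, norm_real,
        Real.norm_of_nonneg h3.le, Real.Angle.coe_zero]
    · rw [one_lt_div h1]; linarith
    · rw [div_lt_one (by linarith)]; linarith
  have hdis : Disjoint {z | gaugeOf S z < 1} W := by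
    rw [Set.disjoint_left]
    intro a (ha : gaugeOf S a < 1) ⟨(hb : 1 < gaugeOf S a), _⟩
    exact lt_asymm ha hb
  have hfin : μ {z | gaugeOf S z < 1} ≠ ⊤ := by
    have : Fact (0 < 2 * Real.pi) := ⟨Real.two_pi_pos⟩
    have : CompactSpace Real.Angle := inferInstanceAs (CompactSpace (AddCircle (2 * Real.pi)))
    obtain ⟨θ, -, hθ⟩ := isCompact_univ.exists_isMaxOn (Set.univ_nonempty (α := Real.Angle))
      hS.continuousOn
    refine ((measure_mono fun z hz => ?_).trans_lt
      (isCompact_closedBall (0 : ℂ) (S θ)).measure_lt_top).ne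
    rw [mem_closedBall_zero_iff]
    exact isBounded_gaugeOf_le hpos (fun θ' => hθ (mem_univ θ')) (le_of_lt hz)
  calc μ {z | gaugeOf S z < 1} < μ {z | gaugeOf S z < 1} + μ W :=
        ENNReal.lt_add_right hfin (hWo.measure_pos μ hWn).ne'
    _ = μ ({z | gaugeOf S z < 1} ∪ W) := (measure_union hdis hWo.measurableSet).symm
    _ ≤ μ {z | gaugeOf S' z < 1} := by
        refine measure_mono (union_subset (fun z hz => (hle z).trans_lt hz) inter_subset_right)

end Gauge

/-- A continuous function of period one, seen as a function of the angle. -/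
lemma exists_angle_lift {ψ : ℝ → ℝ} (hψ : Continuous ψ) (h1 : ∀ t, ψ (t + 1) = ψ t) :
    ∃ Ψ : Real.Angle → ℝ, Continuous Ψ ∧ ∀ t : ℝ, Ψ ((2 * Real.pi * t : ℝ) : Real.Angle) = ψ t := by
  have hper : Function.Periodic (fun t => ψ (t / (2 * Real.pi))) (2 * Real.pi) := by
    intro t
    have := Real.pi_pos
    change ψ ((t + 2 * Real.pi) / (2 * Real.pi)) = ψ (t / (2 * Real.pi))
    rw [add_div, div_self (by positivity), h1]
  refine ⟨hper.lift, ?_, fun t => ?_⟩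
  · have : Continuous (fun t => ψ (t / (2 * Real.pi))) := by fun_prop
    exact continuous_coinduced_dom.mpr this
  · have := Real.pi_pos
    refine (hper.lift_coe _).trans ?_
    rw [mul_div_cancel_left₀ t (by positivity)]

lemma arg_ec_angle {a : ℝ} (ha : 0 < a) (t : ℝ) :
    ((a * ec t : ℂ).arg : Real.Angle) = ((2 * Real.pi * t : ℝ) : Real.Angle) := by
  rw [arg_real_mul _ ha, ec, show (2 * Real.pi * I * t : ℂ) = ((2 * Real.pi * t : ℝ) : ℂ) * I by
    push_cast; ring]
  rw [exp_mul_I, ← ofReal_cos, ← ofReal_sin]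
  have := Complex.arg_cos_add_sin_mul_I_coe_angle ((2 * Real.pi * t : ℝ) : Real.Angle)
  simpa using this

lemma gaugeOf_polar {Ψ : Real.Angle → ℝ} {r : ℝ} (hr : 0 < r) (t : ℝ)
    (hpos : 0 < 1 + Ψ ((2 * Real.pi * t : ℝ) : Real.Angle)) :
    gaugeOf (fun θ => r * Real.sqrt (1 + Ψ θ))
      (polar r t (Ψ ((2 * Real.pi * t : ℝ) : Real.Angle))) = 1 := by
  have h : 0 < r * Real.sqrt (1 + Ψ ((2 * Real.pi * t : ℝ) : Real.Angle)) := by positivity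
  rw [gaugeOf, polar, ← ofReal_mul, arg_ec_angle h, norm_mul, norm_ec, norm_real,
    Real.norm_of_nonneg h.le]
  simp [h.ne']

lemma eq_polar_of_gaugeOf {Ψ : Real.Angle → ℝ} {r : ℝ} (hr : 0 < r) (hpos : ∀ θ, 0 < 1 + Ψ θ)
    {z : ℂ} (hz : gaugeOf (fun θ => r * Real.sqrt (1 + Ψ θ)) z = 1) :
    ∃ t : ℝ, z = polar r t (Ψ ((2 * Real.pi * t : ℝ) : Real.Angle)) := by
  have hpi := Real.pi_pos
  have hθ : 2 * Real.pi * (z.arg / (2 * Real.pi)) = z.arg := by field_simp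
  refine ⟨z.arg / (2 * Real.pi), ?_⟩
  have h : 0 < r * Real.sqrt (1 + Ψ (z.arg : Real.Angle)) := mul_pos hr (Real.sqrt_pos.mpr (hpos _))
  rw [gaugeOf, div_eq_one_iff_eq h.ne'] at hz
  rw [hθ, polar, ← ofReal_mul, ← hz, ec]
  conv_lhs => rw [← norm_mul_exp_arg_mul_I z]
  congr 2
  have : (Real.pi : ℂ) ≠ 0 := by exact_mod_cast hpi.ne'
  push_cast
  field_simp

/-- A translated circle of an area-preserving homeomorphism bounds an invariant domain. -/
theorem exists_invariant_of_translated_circle {f g : ℂ → ℂ} (hf : Continuous f) (hg : Continuous g)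
    (hgf : Function.LeftInverse g f) (hfg : Function.RightInverse g f) (hf0 : f 0 = 0)
    (μ : Measure ℂ) [μ.IsOpenPosMeasure] [IsFiniteMeasureOnCompacts μ]
    (hμ : ∀ A, IsOpen A → μ (f '' A) = μ A)
    {u v : ℝ → ℝ} {β Λ r : ℝ} (hr : 0 < r) (hu : LipschitzWith (1 / 8) u)
    (hv : Continuous v) (hu1 : ∀ x, u (x + 1) = u x) (hv1 : ∀ x, v (x + 1) = v x)
    (hvb : ∀ x, |v x| ≤ 1 / 8)
    (h : ∀ x, 0 < 1 + (v (x + β) - Λ) ∧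
        f (polar r (x + u x) (v x)) = polar r (x + β + u (x + β)) (v (x + β) - Λ)) :
    ∃ K : Set ℂ, IsCompact K ∧ K ∈ 𝓝 0 ∧ K ⊆ Metric.closedBall 0 (2 * r) ∧ f '' K = K := by
  have hinc : ∀ x y, x ≤ y → (7 / 8 : ℝ) * (y - x) ≤ (y + u y) - (x + u x) := by
    intro x y hxy
    have := hu.dist_le_mul y x
    rw [Real.dist_eq, Real.dist_eq, abs_of_nonneg (sub_nonneg.mpr hxy)] at this
    push_cast at this
    linarith [(abs_le.mp this).1]
  have hmono : StrictMono fun x => x + u x := by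
    intro x y hxy
    have := hinc x y hxy.le
    simp only
    linarith
  have hcont : Continuous fun x => x + u x := continuous_id.add hu.continuous
  have hsurj : Function.Surjective fun x => x + u x := by
    refine hcont.surjective ?_ ?_
    · refine tendsto_atTop_mono' _ ?_ (tendsto_atTop_add_const_left _ (u 0)
        (tendsto_id.const_mul_atTop (show (0 : ℝ) < 7 / 8 by norm_num)))
      filter_upwards [eventually_ge_atTop 0] with x hx
      have := hinc 0 x hx
      simp only [id]
      linarith
    · refine tendsto_atBot_mono' _ ?_ (tendsto_atBot_add_const_left _ (u 0)
        (tendsto_id.const_mul_atBot (show (0 : ℝ) < 7 / 8 by norm_num)))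
      filter_upwards [eventually_le_atBot 0] with x hx
      have := hinc x 0 hx
      simp only [id]
      linarith
  let e := hmono.orderIsoOfSurjective _ hsurj
  have he : ∀ x, e x = x + u x := fun x => rfl
  have hes : ∀ x, e.symm (x + u x) = x := fun x => by rw [← he, e.symm_apply_apply]
  obtain ⟨Ψ, hΨ, hΨv⟩ := exists_angle_lift (ψ := fun t => v (e.symm t))
    (hv.comp e.symm.continuous) (by
      intro t
      obtain ⟨x, rfl⟩ := hsurj t
      simp only
      rw [show x + u x + 1 = (x + 1) + u (x + 1) by rw [hu1]; ring, hes, hes, hv1])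
  have hΨx : ∀ x, Ψ ((2 * Real.pi * (x + u x) : ℝ) : Real.Angle) = v x := by
    intro x
    rw [hΨv, hes]
  have hang : ∀ θ : Real.Angle, ∃ x, θ = ((2 * Real.pi * (x + u x) : ℝ) : Real.Angle) := by
    intro θ
    induction θ using Real.Angle.induction_on with
    | _ t =>
      obtain ⟨x, hx⟩ := hsurj (t / (2 * Real.pi))
      refine ⟨x, ?_⟩
      simp only at hx
      rw [hx]
      congr 1
      have := Real.pi_pos
      field_simp
  have hΨ1 : ∀ θ, |Ψ θ| ≤ 1 / 8 := by
    intro θ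
    obtain ⟨x, rfl⟩ := hang θ
    rw [hΨx]
    exact hvb x
  have hpos₁ : ∀ θ, 0 < 1 + Ψ θ := fun θ => by linarith [(abs_le.mp (hΨ1 θ)).1]
  have hpos₂ : ∀ θ, 0 < 1 + (Ψ θ - Λ) := by
    intro θ
    obtain ⟨x, rfl⟩ := hang θ
    rw [hΨx]
    have := (h (x - β)).1
    rwa [sub_add_cancel] at this
  set S₁ : Real.Angle → ℝ := fun θ => r * Real.sqrt (1 + Ψ θ) with hS₁
  set S₂ : Real.Angle → ℝ := fun θ => r * Real.sqrt (1 + (Ψ θ - Λ)) with hS₂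
  have hS₁c : Continuous S₁ := by fun_prop
  have hS₂c : Continuous S₂ := by fun_prop
  have hS₁p : ∀ θ, 0 < S₁ θ := fun θ => mul_pos hr (Real.sqrt_pos.mpr (hpos₁ θ))
  have hS₂p : ∀ θ, 0 < S₂ θ := fun θ => mul_pos hr (Real.sqrt_pos.mpr (hpos₂ θ))
  have himg : ∀ z, gaugeOf S₁ z = 1 → gaugeOf S₂ (f z) = 1 := by
    intro z hz
    obtain ⟨t, rfl⟩ := eq_polar_of_gaugeOf hr hpos₁ hz
    obtain ⟨x, rfl⟩ := hsurj t
    simp only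
    rw [hΨx, (h x).2, ← hΨx (x + β)]
    exact gaugeOf_polar (Ψ := fun θ => Ψ θ - Λ) hr _ (hpos₂ _)
  have hpre : ∀ z, gaugeOf S₂ z = 1 → gaugeOf S₁ (g z) = 1 := by
    intro z hz
    obtain ⟨t, ht⟩ := eq_polar_of_gaugeOf (Ψ := fun θ => Ψ θ - Λ) hr hpos₂ hz
    obtain ⟨x, rfl⟩ := hsurj t
    simp only at ht
    have hx := (h (x - β)).2
    rw [sub_add_cancel, ← hΨx x, ← ht] at hx
    rw [← hx, hgf, ← hΨx]
    exact gaugeOf_polar hr _ (hpos₁ _)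
  have hg0 : g 0 = 0 := by rw [← hf0, hgf, hf0]
  have hlt : ∀ z, gaugeOf S₁ z < 1 → gaugeOf S₂ (f z) < 1 := fun z hz =>
    image_gaugeOf_subset hS₂c hS₂p hf hf0 (fun z hz => by simpa [hgf z] using hpre _ hz) hz
  have hlt' : ∀ z, gaugeOf S₂ z < 1 → gaugeOf S₁ (g z) < 1 := fun z hz =>
    image_gaugeOf_subset hS₁c hS₁p hg hg0 (fun z hz => by simpa [hfg z] using himg _ hz) hz
  have hD : f '' {z | gaugeOf S₁ z < 1} = {z | gaugeOf S₂ z < 1} := by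
    ext z
    constructor
    · rintro ⟨w, hw, rfl⟩
      exact hlt w hw
    · exact fun hz => ⟨g z, hlt' z hz, hfg z⟩
  have hvol := hμ {z | gaugeOf S₁ z < 1}
    (isOpen_lt (continuous_gaugeOf hS₁c hS₁p) continuous_const)
  rw [hD] at hvol
  have hΛ : Λ = 0 := by
    rcases lt_trichotomy Λ 0 with hΛ | hΛ | hΛ
    · refine absurd hvol (measure_gaugeOf_lt hS₁c hS₂c hS₁p (fun θ => ?_) μ).ne'
      exact mul_lt_mul_of_pos_left (Real.sqrt_lt_sqrt (hpos₁ θ).le (by linarith)) hr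
    · exact hΛ
    · refine absurd hvol (measure_gaugeOf_lt hS₂c hS₁c hS₂p (fun θ => ?_) μ).ne
      exact mul_lt_mul_of_pos_left (Real.sqrt_lt_sqrt (hpos₂ θ).le (by linarith)) hr
  have hSS : S₂ = S₁ := by simp only [hS₁, hS₂, hΛ, sub_zero]
  rw [hSS] at himg hpre hlt hlt'
  have hbd : {z | gaugeOf S₁ z ≤ 1} ⊆ Metric.closedBall 0 (2 * r) := by
    intro z hz
    rw [mem_closedBall_zero_iff]
    refine isBounded_gaugeOf_le hS₁p (fun θ => ?_) hz
    have : Real.sqrt (1 + Ψ θ) ≤ 2 := by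
      rw [Real.sqrt_le_left (by norm_num)]
      linarith [(abs_le.mp (hΨ1 θ)).2]
    simp only [hS₁]
    nlinarith
  refine ⟨{z | gaugeOf S₁ z ≤ 1}, ?_, ?_, hbd, ?_⟩
  · exact (isCompact_closedBall 0 (2 * r)).of_isClosed_subset
      (isClosed_le (continuous_gaugeOf hS₁c hS₁p) continuous_const) hbd
  · refine mem_of_superset ((isOpen_lt (continuous_gaugeOf hS₁c hS₁p) continuous_const).mem_nhds
      (?_ : gaugeOf S₁ 0 < 1)) fun z (hz : gaugeOf S₁ z < 1) => hz.le
    simp [gaugeOf_zero]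
  · ext z
    constructor
    · rintro ⟨w, hw, rfl⟩
      rcases (show gaugeOf S₁ w ≤ 1 from hw).lt_or_eq with hw | hw
      · exact (hlt w hw).le
      · exact (himg w hw).le
    · intro hz
      refine ⟨g z, ?_, hfg z⟩
      rcases (show gaugeOf S₁ z ≤ 1 from hz).lt_or_eq with hz | hz
      · exact (hlt' z hz).le
      · exact (hpre z hz).le

end HermanKAM

namespace HermanKAM

open Complex Set Filter Topology

lemma det_eq_symp (L : ℂ →L[ℝ] ℂ) : L.det = symp (L 1) (L I) := by
  have : L.det = LinearMap.det (L : ℂ →ₗ[ℝ] ℂ) := rfl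
  rw [this, ← LinearMap.det_toMatrix basisOneI, Matrix.det_fin_two]
  simp only [LinearMap.toMatrix_apply, coe_basisOneI, coe_basisOneI_repr, symp,
    Matrix.cons_val_zero, Matrix.cons_val_one, ContinuousLinearMap.coe_coe]
  ring

/-- A smooth homeomorphism preserving a Haar measure has Jacobian of modulus one. -/
lemma abs_det_eq_one_of_preserving {f : ℂ → ℂ} (hf : ContDiff ℝ (⊤ : ℕ∞) f) (μ : Measure ℂ)
    [μ.IsAddHaarMeasure] (hμ : ∀ A, IsOpen A → μ (f '' A) = μ A) (z : ℂ) :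
    |(fderiv ℝ f z).det| = 1 := by
  have hstrict : HasStrictFDerivAt f (fderiv ℝ f z) z :=
    hf.contDiffAt.hasStrictFDerivAt (by simp)
  have hball : ∀ δ : NNReal, 0 < δ → ∃ ε > 0, ApproximatesLinearOn f (fderiv ℝ f z)
      (Metric.ball z ε) δ := by
    intro δ hδ
    obtain ⟨s, hs, h⟩ := hstrict.approximates_deriv_on_nhds (Or.inr hδ)
    obtain ⟨ε, hε, hεs⟩ := Metric.mem_nhds_iff.mp hs
    exact ⟨ε, hε, h.mono_set hεs⟩
  have hfin : ∀ ε, μ (Metric.ball z ε) ≠ ⊤ := fun ε => Metric.isBounded_ball.measure_lt_top.ne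
  have hpos : ∀ ε, 0 < ε → μ (Metric.ball z ε) ≠ 0 := fun ε hε =>
    (Metric.measure_ball_pos μ z hε).ne'
  have hself : ∀ᶠ δ : NNReal in 𝓝[>] 0, 0 < δ := self_mem_nhdsWithin
  rcases lt_trichotomy |(fderiv ℝ f z).det| 1 with h | h | h
  · exfalso
    obtain ⟨m, hm1, hm2⟩ := exists_between h
    have hm0 : 0 ≤ m := (abs_nonneg _).trans hm1.le
    lift m to NNReal using hm0
    obtain ⟨δ, hδ, hδ0⟩ := ((addHaar_image_le_mul_of_det_lt μ (fderiv ℝ f z) (m := m) (by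
      rw [ENNReal.ofReal_lt_coe_iff (by positivity)]; exact hm1)).and hself).exists
    obtain ⟨ε, hε, hA⟩ := hball δ hδ0
    have h1 := hδ _ _ hA
    rw [hμ _ Metric.isOpen_ball] at h1
    have hm2' : (m : ENNReal) < 1 := by exact_mod_cast hm2
    have h2 := ENNReal.mul_lt_mul_left (hpos ε hε) (hfin ε) hm2'
    rw [one_mul] at h2
    exact absurd h1 (not_le.mpr h2)
  · exact h
  · exfalso
    obtain ⟨m, hm1, hm2⟩ := exists_between h
    lift m to NNReal using zero_le_one.trans hm1.le
    obtain ⟨δ, hδ, hδ0⟩ := ((mul_le_addHaar_image_of_lt_det μ (fderiv ℝ f z) (m := m) (by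
      rw [ENNReal.lt_ofReal_iff_toReal_lt (by simp)]; exact hm2)).and hself).exists
    obtain ⟨ε, hε, hA⟩ := hball δ hδ0
    have h1 := hδ _ _ hA
    rw [hμ _ Metric.isOpen_ball] at h1
    have hm1' : (1 : ENNReal) < m := by exact_mod_cast hm1
    have h2 := ENNReal.mul_lt_mul_left (hpos ε hε) (hfin ε) hm1'
    rw [one_mul] at h2
    exact absurd h1 (not_le.mpr h2)

/-- A measure-preserving diffeomorphism with conformal derivative at the origin has Jacobian one. -/
lemma symp_fderiv_eq_one {f : ℂ → ℂ} (hf : ContDiff ℝ (⊤ : ℕ∞) f) (μ : Measure ℂ)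
    [μ.IsAddHaarMeasure] (hμ : ∀ A, IsOpen A → μ (f '' A) = μ A) {ω : ℂ}
    (hD : ∀ z, fderiv ℝ f 0 z = ω * z) (z : ℂ) :
    symp (fderiv ℝ f z 1) (fderiv ℝ f z I) = 1 := by
  have habs : ∀ z, |symp (fderiv ℝ f z 1) (fderiv ℝ f z I)| = 1 := fun z => by
    rw [← det_eq_symp]
    exact abs_det_eq_one_of_preserving hf μ hμ z
  have hc : Continuous (fderiv ℝ f) := hf.continuous_fderiv (by simp)
  have hcont : Continuous fun z => symp (fderiv ℝ f z 1) (fderiv ℝ f z I) := by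
    unfold symp
    fun_prop
  have h0 : symp (fderiv ℝ f 0 1) (fderiv ℝ f 0 I) = 1 := by
    have h := habs 0
    have h' : 0 ≤ symp (fderiv ℝ f 0 1) (fderiv ℝ f 0 I) := by
      rw [hD, hD]
      simp only [symp, mul_re, mul_im, one_re, one_im, I_re, I_im]
      nlinarith [sq_nonneg ω.re, sq_nonneg ω.im]
    rwa [abs_of_nonneg h'] at h
  have key := isPreconnected_univ.eq_of_sq_eq hcont.continuousOn
    (continuous_const (y := (1 : ℝ))).continuousOn (fun z _ => by
      simp only [Pi.pow_apply]
      rw [← sq_abs, habs]) (fun _ => one_ne_zero) (mem_univ (0 : ℂ)) h0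
  exact key (mem_univ z)

/-- Linear coordinates in which a real operator with a nonreal eigenvalue is a complex
multiplication. -/
lemma exists_complex_coordinates {A : (Fin 2 → ℝ) →L[ℝ] (Fin 2 → ℝ)} {ω : ℂ} (hω : ω.im ≠ 0)
    (h : ∃ v : Fin 2 → ℂ, v ≠ 0 ∧
      ((LinearMap.toMatrix' A.toLinearMap).map Complex.ofReal).mulVec v = ω • v) :
    ∃ φ : ℂ ≃L[ℝ] (Fin 2 → ℝ), ∀ z, A (φ z) = φ (ω * z) := by
  obtain ⟨v, hv0, hv⟩ := h
  let φ₀ : ℂ →ₗ[ℝ] (Fin 2 → ℝ) :=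
    { toFun := fun z i => (z * v i).re
      map_add' := fun z w => by ext i; simp [add_mul]
      map_smul' := fun a z => by ext i; simp [mul_assoc] }
  have hφ₀ : ∀ z i, φ₀ z i = (z * v i).re := fun _ _ => rfl
  have hvi : ∀ i, (∑ j, ((LinearMap.toMatrix' A.toLinearMap i j : ℝ) : ℂ) * v j) = ω * v i := by
    intro i
    have := congrFun hv i
    simpa [Matrix.mulVec, dotProduct] using this
  have hcomm : ∀ z, A (φ₀ z) = φ₀ (ω * z) := by
    intro z
    have hA : A (φ₀ z) = (LinearMap.toMatrix' A.toLinearMap).mulVec (φ₀ z) := by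
      rw [LinearMap.toMatrix'_mulVec]
      rfl
    rw [hA]
    ext i
    rw [hφ₀, show ω * z * v i = z * (ω * v i) by ring, ← hvi i, Finset.mul_sum, Complex.re_sum,
      Matrix.mulVec, dotProduct]
    refine Finset.sum_congr rfl fun j _ => ?_
    rw [hφ₀, show ∀ a : ℝ, z * ((a : ℂ) * v j) = (a : ℂ) * (z * v j) from fun a => by ring,
      re_ofReal_mul]
  have hinj : Function.Injective φ₀ := by
    rw [← LinearMap.ker_eq_bot, LinearMap.ker_eq_bot']
    intro z hz
    by_contra hz0
    obtain ⟨i, hi⟩ := Function.ne_iff.mp hv0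
    have h1 : (z * v i).re = 0 := by rw [← hφ₀, hz]; rfl
    have h2 : (ω * z * v i).re = 0 := by rw [← hφ₀, ← hcomm, hz, map_zero]; rfl
    rw [mul_assoc, mul_re, h1, mul_zero, zero_sub, neg_eq_zero] at h2
    have h3 : (z * v i).im = 0 := (mul_eq_zero.mp h2).resolve_left hω
    have h4 : z * v i = 0 := Complex.ext h1 h3
    exact (mul_eq_zero.mp h4).elim hz0 hi
  have hdim : Module.finrank ℝ ℂ = Module.finrank ℝ (Fin 2 → ℝ) := by simp
  refine ⟨(LinearMap.linearEquivOfInjective φ₀ hinj hdim).toContinuousLinearEquiv, fun z => ?_⟩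
  exact hcomm z

lemma ec_im_ne_zero {ρ c : ℝ} {T : ℕ} (hc : 0 < c)
    (H : ∀ q p : ℤ, q ≠ 0 → c / |(q : ℝ)| ^ T ≤ |q * ρ - p|) : (ec ρ).im ≠ 0 := by
  intro h
  rw [ec, show (2 * Real.pi * I * ρ : ℂ) = ((2 * Real.pi * ρ : ℝ) : ℂ) * I by push_cast; ring,
    exp_ofReal_mul_I_im, Real.sin_eq_zero_iff] at h
  obtain ⟨n, hn⟩ := h
  have hpi := Real.pi_pos
  have h2 : (n : ℝ) = 2 * ρ := by
    have : Real.pi * (n - 2 * ρ) = 0 := by linarith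
    linarith [(mul_eq_zero.mp this).resolve_left hpi.ne']
  have := H 2 n two_ne_zero
  rw [h2] at this
  push_cast at this
  rw [sub_self, abs_zero] at this
  have : 0 < c / |(2 : ℝ)| ^ T := by positivity
  linarith

/-- Stability in complex coordinates. -/
theorem exists_invariant_complex {f g : ℂ → ℂ} (hf : ContDiff ℝ (⊤ : ℕ∞) f) (hg : Continuous g)
    (hgf : Function.LeftInverse g f) (hfg : Function.RightInverse g f) (hf0 : f 0 = 0) (μ : Measure ℂ)
    [μ.IsAddHaarMeasure] (hμ : MeasurePreserving f μ μ) {ρ : ℝ}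
    (hD : ∀ z, fderiv ℝ f 0 z = ec ρ * z) {c : ℝ} {T : ℕ} (hc : 0 < c)
    (H : ∀ q p : ℤ, q ≠ 0 → c / |(q : ℝ)| ^ T ≤ |q * ρ - p|) {U : Set ℂ} (hU : U ∈ 𝓝 0) :
    ∃ K : Set ℂ, IsCompact K ∧ K ∈ 𝓝 0 ∧ K ⊆ U ∧ f '' K = K := by
  have hμ' : ∀ A, IsOpen A → μ (f '' A) = μ A := by
    intro A hA
    have himg : f '' A = g ⁻¹' A := congrFun (Set.image_eq_preimage_of_inverse hgf hfg) A
    have hm : MeasurableSet (f '' A) := by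
      rw [himg]
      exact (hA.preimage hg).measurableSet
    rw [← hμ.measure_preimage hm.nullMeasurableSet, Set.preimage_image_eq _ hgf.injective]
  obtain ⟨δ, hδ, hδU⟩ := Metric.mem_nhds_iff.mp hU
  obtain ⟨u, v, β, Λ, r, hr, hrδ, hu, hv, hu1, hv1, hvb, h⟩ := exists_translated_circle hf hf0 hD
    (symp_fderiv_eq_one hf μ hμ' hD) hc H (show 0 < δ / 4 by positivity)
  obtain ⟨K, hK, hK0, hKr, hfK⟩ := exists_invariant_of_translated_circle hf.continuous hg hgf hfg hf0
    μ hμ' hr hu hv.continuous hu1 hv1 hvb h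
  refine ⟨K, hK, hK0, hKr.trans ((Metric.closedBall_subset_ball ?_).trans hδU), hfK⟩
  linarith

/-- Stability in arbitrary linear coordinates. -/
theorem exists_invariant_real {f g : (Fin 2 → ℝ) → (Fin 2 → ℝ)} (hf : ContDiff ℝ (⊤ : ℕ∞) f)
    (hg : Continuous g) (hgf : Function.LeftInverse g f) (hfg : Function.RightInverse g f)
    (hμ : MeasurePreserving f volume volume) (hf0 : f 0 = 0) {ρ : ℝ}
    (hv : ∃ v : Fin 2 → ℂ, v ≠ 0 ∧
      ((LinearMap.toMatrix' (fderiv ℝ f 0).toLinearMap).map Complex.ofReal).mulVec v = ec ρ • v)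
    {c : ℝ} {T : ℕ} (hc : 0 < c) (H : ∀ q p : ℤ, q ≠ 0 → c / |(q : ℝ)| ^ T ≤ |q * ρ - p|)
    {U : Set (Fin 2 → ℝ)} (hU : U ∈ 𝓝 0) :
    ∃ K : Set (Fin 2 → ℝ), IsCompact K ∧ K ∈ 𝓝 0 ∧ K ⊆ U ∧ f '' K = K := by
  obtain ⟨φ, hφ⟩ := exists_complex_coordinates (ec_im_ne_zero hc H) hv
  set F : ℂ → ℂ := fun z => φ.symm (f (φ z)) with hF
  set G : ℂ → ℂ := fun z => φ.symm (g (φ z)) with hG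
  have hFc : ContDiff ℝ (⊤ : ℕ∞) F := φ.symm.contDiff.comp (hf.comp φ.contDiff)
  have hGc : Continuous G := φ.symm.continuous.comp (hg.comp φ.continuous)
  have hGF : Function.LeftInverse G F := fun z => by simp [hF, hG, hgf (φ z)]
  have hFG : Function.RightInverse G F := fun z => by simp [hF, hG, hfg (φ z)]
  have hF0 : F 0 = 0 := by simp [hF, hf0]
  have hD : ∀ z, fderiv ℝ F 0 z = ec ρ * z := by
    intro z
    have h1 : HasFDerivAt f (fderiv ℝ f 0) (φ 0) := by
      rw [map_zero]
      exact (hf.differentiable (by simp) 0).hasFDerivAt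
    have h2 : HasFDerivAt F _ 0 :=
      φ.symm.hasFDerivAt.comp 0 (h1.comp 0 φ.hasFDerivAt)
    rw [h2.fderiv]
    change φ.symm (fderiv ℝ f 0 (φ z)) = _
    rw [hφ, φ.symm_apply_apply]
  have hsymm : MeasurePreserving φ.symm volume (volume.map φ.symm) :=
    φ.symm.continuous.measurable.measurePreserving _
  have hφm : MeasurePreserving φ (volume.map φ.symm) volume := by
    refine ⟨φ.continuous.measurable, ?_⟩
    rw [Measure.map_map φ.continuous.measurable φ.symm.continuous.measurable]
    simp
  have hUφ : φ ⁻¹' U ∈ 𝓝 (0 : ℂ) := φ.continuous.continuousAt.preimage_mem_nhds (by rwa [map_zero])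
  obtain ⟨K, hK, hK0, hKU, hFK⟩ := exists_invariant_complex hFc hGc hGF hFG hF0
    (volume.map φ.symm) (hsymm.comp (hμ.comp hφm)) hD hc H hUφ
  refine ⟨φ '' K, hK.image φ.continuous, ?_, Set.image_subset_iff.mpr hKU, ?_⟩
  · have := φ.toHomeomorph.isOpenMap.image_mem_nhds hK0
    rwa [show φ.toHomeomorph 0 = 0 from map_zero φ] at this
  · conv_rhs => rw [← hFK]
    rw [Set.image_image, Set.image_image]
    simp [hF]

lemma iterate_image_of_image {α : Type*} {f : α → α} {K : Set α} (h : f '' K = K) (n : ℕ) :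
    f^[n] '' K = K := by
  rw [Set.image_iterate_eq]
  exact Function.iterate_fixed h n

end HermanKAM

/-- (Herman) Let `f : ℝ² → ℝ²` be a `C^∞` diffeomorphism (with `C^∞` inverse `g`)
preserving Lebesgue measure, with `f 0 = 0`, whose derivative at `0` has complex
eigenvalues `e^{2πiρ}` and `e^{-2πiρ}` for a Diophantine rotation number `ρ`
(there exist `c, τ > 0` with `|ρ - p/q| ≥ c / |q|^{2+τ}` for all rationals `p/q`).
Then the elliptic fixed point `0` is stable: every neighborhood `U` of `0` contains
a compact `f`-invariant neighborhood `K` of `0`; in particular every neighborhood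
`U` of `0` contains a neighborhood `V` with `f^n(V) ⊆ U` for all `n ∈ ℤ`. -/
theorem herman_diophantine_elliptic_stable
    (f g : (Fin 2 → ℝ) → (Fin 2 → ℝ)) (ρ : ℝ)
    (hf : ContDiff ℝ (⊤ : ℕ∞) f) (hg : ContDiff ℝ (⊤ : ℕ∞) g)
    (hgf : Function.LeftInverse g f) (hfg : Function.RightInverse g f)
    (hmp : MeasurePreserving f volume volume)
    (hf0 : f 0 = 0)
    (heig : ∀ σ : ℝ, σ = 1 ∨ σ = -1 →
      ∃ v : Fin 2 → ℂ, v ≠ 0 ∧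
        ((LinearMap.toMatrix' ((fderiv ℝ f 0).toLinearMap)).map
            Complex.ofReal).mulVec v
          = Complex.exp (2 * Real.pi * Complex.I * σ * ρ) • v)
    (hdio : ∃ c > (0 : ℝ), ∃ τ > (0 : ℝ), ∀ p q : ℤ, q ≠ 0 →
      c / |(q : ℝ)| ^ ((2 : ℝ) + τ) ≤ |ρ - p / q|) :
    (∀ U ∈ nhds (0 : Fin 2 → ℝ), ∃ K : Set (Fin 2 → ℝ),
      IsCompact K ∧ K ∈ nhds 0 ∧ K ⊆ U ∧ f '' K = K) ∧
    (∀ U ∈ nhds (0 : Fin 2 → ℝ), ∃ V ∈ nhds (0 : Fin 2 → ℝ),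
      ∀ n : ℕ, f^[n] '' V ⊆ U ∧ g^[n] '' V ⊆ U) := by
  obtain ⟨c, hc, T, H⟩ := HermanKAM.exists_pow_dio hdio
  have hv := heig 1 (Or.inl rfl)
  rw [show (2 * Real.pi * Complex.I * ((1 : ℝ) : ℂ) * ρ : ℂ) = 2 * Real.pi * Complex.I * ρ by
    push_cast; ring] at hv
  have key : ∀ U ∈ nhds (0 : Fin 2 → ℝ), ∃ K : Set (Fin 2 → ℝ),
      IsCompact K ∧ K ∈ nhds 0 ∧ K ⊆ U ∧ f '' K = K := fun U hU =>
    HermanKAM.exists_invariant_real hf hg.continuous hgf hfg hmp hf0 hv hc H hU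
  refine ⟨key, fun U hU => ?_⟩
  obtain ⟨K, -, hK, hKU, hfK⟩ := key U hU
  have hgK : g '' K = K := by
    conv_lhs => rw [← hfK]
    rw [Set.image_image]
    simp [hgf _]
  exact ⟨K, hK, fun n => ⟨(HermanKAM.iterate_image_of_image hfK n).subset.trans hKU,
    (HermanKAM.iterate_image_of_image hgK n).subset.trans hKU⟩⟩
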